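/- arXiv:0809.0457 — 2 statements merged into one kernel-verified Lean document; each statement's English description precedes it below -/
import Mathlib

section
/- Let X be a proper CAT(0) space, not reduced to a point, with finite-dimensional Tits boundary, and suppose Isom(X) acts minimally on X. Then ∂X has circumradius strictly greater than π/2 with respect to the Tits angle metric; in particular X is boundary-minimal. -/
open Metric Set Filter

universe u v

variable {X : Type u}

/-- An affinely parametrised geodesic segment from `x` to `y`, defined on `[0,1]`. -/
def IsGeodesicSeg [MetricSpace X] (x y : X) (γ : ℝ → X) : Prop :=
  γ 0 = x ∧ γ 1 = y ∧
    ∀ s ∈ Set.Icc (0:ℝ) 1, ∀ t ∈ Set.Icc (0:ℝ) 1, dist (γ s) (γ t) = |s - t| * dist x y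

/-- A CAT(0) space: a geodesic metric space in which every geodesic triangle is at least as
thin as its Euclidean comparison triangle, expressed via the standard comparison
(convexity) inequality along geodesics. -/
class CAT0Space (X : Type u) [MetricSpace X] : Prop where
  exists_geodesic : ∀ x y : X, ∃ γ : ℝ → X, IsGeodesicSeg x y γ
  comparison : ∀ (p x y : X) (γ : ℝ → X), IsGeodesicSeg x y γ → ∀ t ∈ Set.Icc (0:ℝ) 1,
    dist p (γ t) ^ 2 ≤ (1 - t) * dist p x ^ 2 + t * dist p y ^ 2 - t * (1 - t) * dist x y ^ 2

/-- A subset is (geodesically) convex if it contains every geodesic segment between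
any two of its points. -/
def GeoConvex [MetricSpace X] (C : Set X) : Prop :=
  ∀ x ∈ C, ∀ y ∈ C, ∀ γ : ℝ → X, IsGeodesicSeg x y γ → ∀ t ∈ Set.Icc (0:ℝ) 1, γ t ∈ C

/-- Every geodesic segment of positive length extends to a locally isometric embedding
of the whole real line. -/
def GeodesicallyComplete (X : Type u) [MetricSpace X] : Prop :=
  ∀ x y : X, x ≠ y → ∀ γ : ℝ → X, IsGeodesicSeg x y γ →
    ∃ ℓ : ℝ → X,
      (∀ t : ℝ, ∃ ε > (0:ℝ), ∀ s₁ ∈ Set.Ioo (t - ε) (t + ε), ∀ s₂ ∈ Set.Ioo (t - ε) (t + ε),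
        dist (ℓ s₁) (ℓ s₂) = |s₁ - s₂|) ∧
      ∀ t ∈ Set.Icc (0:ℝ) 1, ℓ (t * dist x y) = γ t

/-- A (unit speed) geodesic ray, parametrised by `[0,∞)`. -/
structure GeodesicRay (X : Type u) [MetricSpace X] where
  toFun : ℝ → X
  isom : ∀ s, 0 ≤ s → ∀ t, 0 ≤ t → dist (toFun s) (toFun t) = |s - t|

/-- Two rays are asymptotic if they remain at bounded distance. -/
def GeodesicRay.Asymp [MetricSpace X] (ρ σ : GeodesicRay X) : Prop :=
  ∃ C : ℝ, ∀ t, 0 ≤ t → dist (ρ.toFun t) (σ.toFun t) ≤ C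

theorem GeodesicRay.asymp_equivalence (X : Type u) [MetricSpace X] :
    Equivalence (GeodesicRay.Asymp (X := X)) where
  refl ρ := ⟨0, fun t _ => by simp⟩
  symm := fun {ρ σ} ⟨C, hC⟩ => ⟨C, fun t ht => by rw [dist_comm]; exact hC t ht⟩
  trans := fun {ρ σ τ} ⟨C₁, h₁⟩ ⟨C₂, h₂⟩ =>
    ⟨C₁ + C₂, fun t ht => (dist_triangle (ρ.toFun t) (σ.toFun t) (τ.toFun t)).trans
      (add_le_add (h₁ t ht) (h₂ t ht))⟩

instance GeodesicRay.setoid (X : Type u) [MetricSpace X] : Setoid (GeodesicRay X) :=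
  ⟨GeodesicRay.Asymp, GeodesicRay.asymp_equivalence X⟩

/-- The boundary at infinity: asymptote classes of geodesic rays. -/
def Boundary (X : Type u) [MetricSpace X] : Type u := Quotient (GeodesicRay.setoid X)

/-- The boundary point determined by a ray. -/
def GeodesicRay.cls [MetricSpace X] (ρ : GeodesicRay X) : Boundary X := Quotient.mk _ ρ

/-- The boundary at infinity of a subset `Y ⊆ X`: classes of rays staying within
bounded distance of `Y`. -/
def boundarySet [MetricSpace X] (Y : Set X) : Set (Boundary X) :=
  {ξ | ∃ ρ : GeodesicRay X, ρ.cls = ξ ∧ ∃ C : ℝ, ∀ t, 0 ≤ t → ∃ y ∈ Y, dist (ρ.toFun t) y ≤ C}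

/-- Composition of a ray with an isometric map. -/
def GeodesicRay.comp [MetricSpace X] (f : X → X) (hf : Isometry f) (ρ : GeodesicRay X) :
    GeodesicRay X :=
  ⟨fun t => f (ρ.toFun t), fun s hs t ht => by simpa [hf.dist_eq] using ρ.isom s hs t ht⟩

/-- The induced map of an isometric map on the boundary at infinity. -/
def Boundary.map [MetricSpace X] (f : X → X) (hf : Isometry f) : Boundary X → Boundary X :=
  Quotient.map (GeodesicRay.comp f hf)
    (fun ρ σ h => by
      obtain ⟨C, hC⟩ := h
      exact ⟨C, fun t ht => by simpa [GeodesicRay.comp, hf.dist_eq] using hC t ht⟩)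

/-- The Euclidean comparison angle at `p` of the points `x, y`. -/
noncomputable def cmpAngle [MetricSpace X] (p x y : X) : ℝ :=
  Real.arccos ((dist p x ^ 2 + dist p y ^ 2 - dist x y ^ 2) / (2 * dist p x * dist p y))

/-- The Alexandrov angle between two geodesic rays issuing from the same point
(in a CAT(0) space, the comparison angles are monotone, so the limit defining the
Alexandrov angle is the infimum of comparison angles). -/
noncomputable def alexAngleRays [MetricSpace X] (ρ σ : ℝ → X) : ℝ :=
  sInf {a | ∃ s, 0 < s ∧ ∃ t, 0 < t ∧ a = cmpAngle (ρ 0) (ρ s) (σ t)}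

/-- The Alexandrov angle between two geodesic segments (parametrised on `[0,1]`)
issuing from the same point. -/
noncomputable def alexAngleSegs [MetricSpace X] (γ δ : ℝ → X) : ℝ :=
  sInf {a | ∃ s ∈ Set.Ioc (0:ℝ) 1, ∃ t ∈ Set.Ioc (0:ℝ) 1, a = cmpAngle (γ 0) (γ s) (δ t)}

/-- The Tits angle between two boundary points: the supremum over basepoints of the
Alexandrov angle between the rays issuing from that basepoint representing them. -/
noncomputable def titsAngle [MetricSpace X] (ξ η : Boundary X) : ℝ :=
  sSup {a | ∃ ρ σ : GeodesicRay X, ρ.toFun 0 = σ.toFun 0 ∧ ρ.cls = ξ ∧ σ.cls = η ∧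
    a = alexAngleRays ρ.toFun σ.toFun}

/-- The circumradius of `Z` within `Y`, with respect to the distance function `d`. -/
noncomputable def circumradiusIn {B : Type v} (d : B → B → ℝ) (Y Z : Set B) : ℝ :=
  sInf ((fun y => sSup ((fun z => d y z) '' Z)) '' Y)

/-- The topology of the Tits boundary, generated by the balls of the Tits angle metric. -/
instance boundaryTopology (X : Type u) [MetricSpace X] : TopologicalSpace (Boundary X) :=
  TopologicalSpace.generateFrom
    {U | ∃ (ξ : Boundary X) (r : ℝ), U = {η | titsAngle ξ η < r}}

/-- Lebesgue covering dimension of a subset `K` is at most `n`: every open cover of `K`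
admits an open refinement covering `K` of multiplicity at most `n+1` on `K`. -/
def CovDimSubsetLE {B : Type v} [TopologicalSpace B] (K : Set B) (n : ℕ) : Prop :=
  ∀ 𝒰 : Set (Set B), (∀ U ∈ 𝒰, IsOpen U) → K ⊆ ⋃₀ 𝒰 →
    ∃ 𝒱 : Set (Set B), (∀ V ∈ 𝒱, IsOpen V) ∧ K ⊆ ⋃₀ 𝒱 ∧
      (∀ V ∈ 𝒱, ∃ U ∈ 𝒰, V ⊆ U) ∧
      ∀ x ∈ K, {V | V ∈ 𝒱 ∧ x ∈ V}.Finite ∧ {V | V ∈ 𝒱 ∧ x ∈ V}.ncard ≤ n + 1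

/-- The Tits boundary is finite-dimensional: the topological dimension of compact
subsets of the Tits boundary is bounded. -/
def FiniteDimTitsBoundary (X : Type u) [MetricSpace X] : Prop :=
  ∃ n : ℕ, ∀ K : Set (Boundary X), IsCompact K → CovDimSubsetLE K n

/-- The topology of uniform convergence on compacta (compact-open topology) on the
isometry group of `X`. -/
instance isomEquivTopology (X : Type u) [MetricSpace X] : TopologicalSpace (X ≃ᵢ X) :=
  TopologicalSpace.induced (fun g : X ≃ᵢ X => (⟨⇑g, g.continuous⟩ : C(X, X)))
    ContinuousMap.compactOpen

/-- A subgroup of the isometry group acts minimally: there is no nonempty proper closed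
convex invariant subset. -/
def MinimalSubgroupAction [MetricSpace X] (G : Subgroup (X ≃ᵢ X)) : Prop :=
  ∀ C : Set X, C.Nonempty → IsClosed C → GeoConvex C →
    (∀ g ∈ G, ∀ x ∈ C, g x ∈ C) → C = Set.univ

section SMulNotions
variable {G : Type v} [Group G] [MulAction G X] [MetricSpace X]

/-- The translation length of `g`. -/
noncomputable def transLength (g : G) : ℝ := sInf (Set.range fun x : X => dist (g • x) x)

/-- `g` acts as an elliptic isometry: it fixes a point. -/
def IsEllipticSMul (g : G) : Prop := ∃ x : X, g • x = x

/-- `g` acts as a hyperbolic isometry: its translation length is positive and attained. -/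
def IsHyperbolicSMul (g : G) : Prop :=
  ∃ x : X, dist (g • x) x = transLength (X := X) g ∧ 0 < dist (g • x) x

end SMulNotions

/-- The Busemann function associated with a geodesic ray, based at `ρ 0`
(the limit exists, hence agrees with the `limsup`). -/
noncomputable def busemann [MetricSpace X] (ρ : GeodesicRay X) (y : X) : ℝ :=
  Filter.limsup (fun t : ℝ => dist (ρ.toFun t) y - dist (ρ.toFun t) (ρ.toFun 0)) Filter.atTop

/-- Convergence of a sequence to a boundary point in the cône topology (in a CAT(0)
space): the sequence escapes to infinity and the geodesics from the basepoint `p` to the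
points of the sequence converge pointwise to the ray from `p` representing `η`. -/
def SeqTendstoBoundary [MetricSpace X] (p : X) (u : ℕ → X) (η : Boundary X) : Prop :=
  Filter.Tendsto (fun n => dist p (u n)) Filter.atTop Filter.atTop ∧
  ∃ σ : GeodesicRay X, σ.toFun 0 = p ∧ σ.cls = η ∧
    ∀ γ : ℕ → ℝ → X, (∀ n, IsGeodesicSeg p (u n) (γ n)) →
      ∀ t, 0 ≤ t →
        Filter.Tendsto (fun n => γ n (t / dist p (u n))) Filter.atTop (nhds (σ.toFun t))

/-- The closed convex hull of a subset. -/
def closedGeoConvexHull [MetricSpace X] (S : Set X) : Set X :=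
  ⋂₀ {C : Set X | IsClosed C ∧ GeoConvex C ∧ S ⊆ C}

/-- A real function is convex if its restriction to every geodesic is convex. -/
def ConvexFun [MetricSpace X] (f : X → ℝ) : Prop :=
  ∀ (x y : X) (γ : ℝ → X), IsGeodesicSeg x y γ →
    ∀ s ∈ Set.Icc (0:ℝ) 1, ∀ t ∈ Set.Icc (0:ℝ) 1, ∀ a b : ℝ, 0 ≤ a → 0 ≤ b → a + b = 1 →
      f (γ (a * s + b * t)) ≤ a * f (γ s) + b * f (γ t)

/-- `X` is boundary-minimal: no proper closed convex subset has full boundary. -/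
def BoundaryMinimal (X : Type u) [MetricSpace X] : Prop :=
  ∀ Y : Set X, IsClosed Y → GeoConvex Y → boundarySet Y = boundarySet (Set.univ : Set X) →
    Y = Set.univ

/-- A geodesic segment with respect to an abstract distance function `d`. -/
def IsGeodesicSegD {B : Type v} (d : B → B → ℝ) (x y : B) (γ : ℝ → B) : Prop :=
  γ 0 = x ∧ γ 1 = y ∧
    ∀ s ∈ Set.Icc (0:ℝ) 1, ∀ t ∈ Set.Icc (0:ℝ) 1, d (γ s) (γ t) = |s - t| * d x y

/-- Convexity with respect to an abstract distance function `d`. -/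
def DConvex {B : Type v} (d : B → B → ℝ) (A : Set B) : Prop :=
  ∀ x ∈ A, ∀ y ∈ A, ∀ γ : ℝ → B, IsGeodesicSegD d x y γ → ∀ t ∈ Set.Icc (0:ℝ) 1, γ t ∈ A

/-- `X` is irreducible: it admits no isometric splitting as an (ℓ²-)product with both
factors containing more than one point. -/
def IrreducibleCAT0 (X : Type u) [MetricSpace X] : Prop :=
  ¬ ∃ (A : Type u) (B : Type u) (_ : MetricSpace A) (_ : MetricSpace B)
      (_ : X ≃ᵢ WithLp 2 (A × B)), Nontrivial A ∧ Nontrivial B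

/-- The forward ray of a geodesic line. -/
def GeodesicRay.ofLineFwd [MetricSpace X] (ℓ : ℝ → X)
    (h : ∀ s t : ℝ, dist (ℓ s) (ℓ t) = |s - t|) : GeodesicRay X :=
  ⟨ℓ, fun s _ t _ => h s t⟩

/-- The backward ray of a geodesic line. -/
def GeodesicRay.ofLineBwd [MetricSpace X] (ℓ : ℝ → X)
    (h : ∀ s t : ℝ, dist (ℓ s) (ℓ t) = |s - t|) : GeodesicRay X :=
  ⟨fun t => ℓ (-t), fun s _ t _ => by
    rw [h (-s) (-t), show (-s) - (-t) = -(s - t) by ring, abs_neg]⟩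

/-- Two boundary points are opposite if they are the two endpoints of a geodesic line. -/
def OppositeBd [MetricSpace X] (ξ η : Boundary X) : Prop :=
  ∃ (ℓ : ℝ → X) (h : ∀ s t : ℝ, dist (ℓ s) (ℓ t) = |s - t|),
    (GeodesicRay.ofLineBwd ℓ h).cls = ξ ∧ (GeodesicRay.ofLineFwd ℓ h).cls = η

/-- An isometry is parabolic if its displacement function does not attain its infimum. -/
def IsParabolicIsom [MetricSpace X] (g : X ≃ᵢ X) : Prop :=
  ¬ ∃ x : X, dist (g x) x = sInf (Set.range fun y : X => dist (g y) y)

/-- The fixed-point set of an isometry in the boundary at infinity. -/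
def boundaryFixedSet [MetricSpace X] (g : X ≃ᵢ X) : Set (Boundary X) :=
  {ξ | Boundary.map (⇑g) g.isometry ξ = ξ}

open Topology

section Geodesics
variable [MetricSpace X]

theorem IsGeodesicSeg.dist_left {x y : X} {γ : ℝ → X} (h : IsGeodesicSeg x y γ) {t : ℝ}
    (ht : t ∈ Set.Icc (0:ℝ) 1) : dist x (γ t) = t * dist x y := by
  have := h.2.2 0 (by simp) t ht
  rwa [h.1, zero_sub, abs_neg, abs_of_nonneg ht.1] at this

theorem IsGeodesicSeg.symm {x y : X} {γ : ℝ → X} (h : IsGeodesicSeg x y γ) :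
    IsGeodesicSeg y x (fun t => γ (1 - t)) := by
  refine ⟨by simpa using h.2.1, by simpa using h.1, fun s hs t ht => ?_⟩
  rw [h.2.2 (1 - s) ⟨by linarith [hs.2], by linarith [hs.1]⟩ (1 - t)
    ⟨by linarith [ht.2], by linarith [ht.1]⟩, dist_comm y x, abs_sub_comm]
  congr 2; ring

theorem IsGeodesicSeg.comp_isometry {Y : Type*} [MetricSpace Y] {f : X → Y} (hf : Isometry f)
    {x y : X} {γ : ℝ → X} (h : IsGeodesicSeg x y γ) :
    IsGeodesicSeg (f x) (f y) (fun t => f (γ t)) := by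
  refine ⟨congrArg f h.1, congrArg f h.2.1, fun s hs t ht => ?_⟩
  rw [hf.dist_eq, hf.dist_eq, h.2.2 s hs t ht]

variable [CAT0Space X]

theorem IsGeodesicSeg.dist_le_of_left {x y z : X} {γ δ : ℝ → X} (hγ : IsGeodesicSeg x y γ)
    (hδ : IsGeodesicSeg x z δ) {t : ℝ} (ht : t ∈ Set.Icc (0:ℝ) 1) :
    dist (γ t) (δ t) ≤ t * dist y z := by
  have h1 := CAT0Space.comparison (γ t) x z δ hδ t ht
  have h2 := CAT0Space.comparison z x y γ hγ t ht
  rw [dist_comm (γ t) x, hγ.dist_left ht, dist_comm (γ t) z] at h1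
  rw [dist_comm z x, dist_comm z y] at h2
  have h3 := mul_le_mul_of_nonneg_left h2 ht.1
  refine abs_le_of_sq_le_sq' ?_ (mul_nonneg ht.1 dist_nonneg) |>.2
  nlinarith [h1, h3]

theorem IsGeodesicSeg.dist_le {x y x' y' : X} {γ δ : ℝ → X} (hγ : IsGeodesicSeg x y γ)
    (hδ : IsGeodesicSeg x' y' δ) {t : ℝ} (ht : t ∈ Set.Icc (0:ℝ) 1) :
    dist (γ t) (δ t) ≤ (1 - t) * dist x x' + t * dist y y' := by
  obtain ⟨ε, hε⟩ := CAT0Space.exists_geodesic x y'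
  have h1 := hγ.dist_le_of_left hε ht
  have h2 := hε.symm.dist_le_of_left hδ.symm (t := 1 - t) ⟨by linarith [ht.2], by linarith [ht.1]⟩
  simp only [sub_sub_cancel] at h2
  linarith [dist_triangle (γ t) (ε t) (δ t)]

/-- A chosen geodesic segment between two points. -/
noncomputable def geoSeg (x y : X) : ℝ → X := (CAT0Space.exists_geodesic x y).choose

theorem geoSeg_spec (x y : X) : IsGeodesicSeg x y (geoSeg x y) :=
  (CAT0Space.exists_geodesic x y).choose_spec

theorem dist_geoSeg_half_sq_le (q x y : X) : dist q (geoSeg x y (1 / 2)) ^ 2 ≤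
    1 / 2 * dist q x ^ 2 + 1 / 2 * dist q y ^ 2 - 1 / 4 * dist x y ^ 2 := by
  have := CAT0Space.comparison q x y _ (geoSeg_spec x y) (1 / 2) (by norm_num)
  linarith

/-- The sum of the squared diagonals of a quadrilateral is at most the sum of its squared sides. -/
theorem dist_sq_add_dist_sq_le (a b c d : X) : dist a c ^ 2 + dist b d ^ 2 ≤
    dist a b ^ 2 + dist b c ^ 2 + dist c d ^ 2 + dist d a ^ 2 := by
  have h1 := dist_geoSeg_half_sq_le b a c
  have h2 := dist_geoSeg_half_sq_le d a c
  have h3 := dist_triangle_right b d (geoSeg a c (1 / 2))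
  rw [dist_comm b a] at h1
  rw [dist_comm d c] at h2
  nlinarith [sq_nonneg (dist b (geoSeg a c (1 / 2)) - dist d (geoSeg a c (1 / 2))),
    dist_nonneg (x := b) (y := d), dist_nonneg (x := b) (y := geoSeg a c (1 / 2)),
    dist_nonneg (x := d) (y := geoSeg a c (1 / 2))]

end Geodesics

section Ultralimits
variable [MetricSpace X] [ProperSpace X]

theorem exists_tendsto_hyperfilter (p : X) (w : ℕ → X) (R : ℝ)
    (h : ∀ᶠ n in (hyperfilter ℕ : Filter ℕ), dist p (w n) ≤ R) :
    ∃ z, Tendsto w (hyperfilter ℕ : Filter ℕ) (𝓝 z) := by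
  have hK := isCompact_closedBall p R
  have := hK.ultrafilter_le_nhds ((hyperfilter ℕ).map w) (by
    rw [le_principal_iff]
    refine h.mono fun n hn => ?_
    simpa [dist_comm] using hn)
  obtain ⟨z, -, hz⟩ := this
  exact ⟨z, hz⟩

theorem exists_real_tendsto_hyperfilter (w : ℕ → ℝ) (R : ℝ) (h : ∀ n, |w n| ≤ R) :
    ∃ z, Tendsto w (hyperfilter ℕ : Filter ℕ) (𝓝 z) :=
  exists_tendsto_hyperfilter 0 w R (Eventually.of_forall fun n => by simpa [Real.dist_eq] using h n)

/-- A pointwise ultralimit of maps that are eventually linearly reparametrised geodesics from `p`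
is a linearly reparametrised geodesic ray from `p`. -/
theorem exists_ultralimit_ray (p : X) (r : ℕ → ℝ → X) (a : ℕ → ℝ) (R : ℝ) (ha : ∀ n, |a n| ≤ R)
    (h0 : ∀ n, r n 0 = p)
    (hr : ∀ s, 0 ≤ s → ∀ t, 0 ≤ t → ∀ᶠ n in (hyperfilter ℕ : Filter ℕ),
      dist (r n s) (r n t) = a n * |s - t|) :
    ∃ (f : ℝ → X) (b : ℝ), Tendsto a (hyperfilter ℕ : Filter ℕ) (𝓝 b) ∧ (∀ t ≤ 0, f t = p) ∧
      (∀ t, 0 ≤ t → Tendsto (fun n => r n t) (hyperfilter ℕ : Filter ℕ) (𝓝 (f t))) ∧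
      ∀ s, 0 ≤ s → ∀ t, 0 ≤ t → dist (f s) (f t) = b * |s - t| := by
  obtain ⟨b, hb⟩ := exists_real_tendsto_hyperfilter a R ha
  have key : ∀ t, 0 ≤ t → ∃ z, Tendsto (fun n => r n t) (hyperfilter ℕ : Filter ℕ) (𝓝 z) := by
    intro t ht
    refine exists_tendsto_hyperfilter p _ (R * t) ?_
    filter_upwards [hr 0 le_rfl t ht] with n hn
    rw [h0, zero_sub, abs_neg, abs_of_nonneg ht] at hn
    rw [hn]
    exact mul_le_mul_of_nonneg_right ((le_abs_self _).trans (ha n)) ht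
  have : Nonempty X := ⟨p⟩
  choose! f hf using key
  have hf0 : f 0 = p := tendsto_nhds_unique (hf 0 le_rfl) (by simp [h0])
  refine ⟨fun t => f (max t 0), b, hb, fun t ht => by simp [max_eq_right ht, hf0], fun t ht => ?_,
    fun s hs t ht => ?_⟩
  · simpa [max_eq_left ht] using hf t ht
  · simp only [max_eq_left hs, max_eq_left ht]
    exact tendsto_nhds_unique (((hf s hs).dist (hf t ht)).congr' (hr s hs t ht))
      (hb.mul_const _)

end Ultralimits

section TangentCone
variable [MetricSpace X]

/-- A linearly reparametrised geodesic ray from `p`, of arbitrary speed (extended constantly to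
negative times). Such rays are the points of the Euclidean cone over the Tits boundary. -/
structure ConeRay (p : X) where
  toFun : ℝ → X
  eq_base : ∀ t ≤ 0, toFun t = p
  exists_speed : ∃ a : ℝ, 0 ≤ a ∧ ∀ s, 0 ≤ s → ∀ t, 0 ≤ t → dist (toFun s) (toFun t) = a * |s - t|

namespace ConeRay
variable {p : X}

theorem ext_fun {r q : ConeRay p} (h : ∀ t, r.toFun t = q.toFun t) : r = q := by
  cases r; cases q; congr; exact funext h

noncomputable def speed (r : ConeRay p) : ℝ := r.exists_speed.choose

theorem speed_nonneg (r : ConeRay p) : 0 ≤ r.speed := r.exists_speed.choose_spec.1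

theorem dist_eq (r : ConeRay p) {s t : ℝ} (hs : 0 ≤ s) (ht : 0 ≤ t) :
    dist (r.toFun s) (r.toFun t) = r.speed * |s - t| :=
  r.exists_speed.choose_spec.2 s hs t ht

theorem dist_base (r : ConeRay p) {t : ℝ} (ht : 0 ≤ t) :
    dist p (r.toFun t) = r.speed * t := by
  have := r.dist_eq le_rfl ht
  rwa [r.eq_base 0 le_rfl, zero_sub, abs_neg, abs_of_nonneg ht] at this

theorem isGeodesicSeg (r : ConeRay p) {T : ℝ} (hT : 0 ≤ T) :
    IsGeodesicSeg p (r.toFun T) (fun t => r.toFun (t * T)) := by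
  refine ⟨by simp [r.eq_base], by simp, fun s hs t ht => ?_⟩
  rw [r.dist_eq (mul_nonneg hs.1 hT) (mul_nonneg ht.1 hT), r.dist_base hT, ← sub_mul, abs_mul,
    abs_of_nonneg hT]
  ring

/-- The difference quotient whose supremum is the cone distance. -/
noncomputable def quot (r q : ConeRay p) (t : ℝ) : ℝ := dist (r.toFun t) (q.toFun t) / t

theorem quot_of_nonpos (r q : ConeRay p) {t : ℝ} (ht : t ≤ 0) : quot r q t = 0 := by
  simp [quot, r.eq_base t ht, q.eq_base t ht]

theorem quot_nonneg (r q : ConeRay p) (t : ℝ) : 0 ≤ quot r q t := by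
  rcases le_total t 0 with h | h
  · rw [quot_of_nonpos r q h]
  · exact div_nonneg dist_nonneg h

theorem quot_le (r q : ConeRay p) (t : ℝ) : quot r q t ≤ r.speed + q.speed := by
  rcases le_or_gt t 0 with h | h
  · rw [quot_of_nonpos r q h]; exact add_nonneg r.speed_nonneg q.speed_nonneg
  · rw [quot, div_le_iff₀ h]
    have := dist_triangle_left (r.toFun t) (q.toFun t) p
    rw [r.dist_base h.le, q.dist_base h.le] at this
    linarith

theorem bddAbove_quot (r q : ConeRay p) : BddAbove (range (quot r q)) :=
  ⟨_, by rintro _ ⟨t, rfl⟩; exact quot_le r q t⟩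

theorem quot_self (r : ConeRay p) (t : ℝ) : quot r r t = 0 := by simp [quot]

theorem quot_comm (r q : ConeRay p) (t : ℝ) : quot r q t = quot q r t := by
  simp [quot, dist_comm]

noncomputable instance : MetricSpace (ConeRay p) where
  dist r q := ⨆ t, quot r q t
  dist_self r := by simp [quot_self]
  dist_comm r q := by simp only [quot_comm r q]
  dist_triangle r q s := by
    refine ciSup_le fun t => ?_
    refine le_trans ?_ (add_le_add (le_ciSup (bddAbove_quot r q) t)
      (le_ciSup (bddAbove_quot q s) t))
    rcases le_or_gt t 0 with h | h
    · simp [quot_of_nonpos _ _ h]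
    · rw [quot, quot, quot, ← add_div]
      exact div_le_div_of_nonneg_right (dist_triangle _ _ _) h.le
  eq_of_dist_eq_zero {r q} h := by
    refine ext_fun fun t => ?_
    rcases le_or_gt t 0 with ht | ht
    · rw [r.eq_base t ht, q.eq_base t ht]
    · have h1 : quot r q t ≤ 0 := (le_ciSup (bddAbove_quot r q) t).trans h.le
      rw [quot, div_le_iff₀ ht, zero_mul] at h1
      exact dist_le_zero.1 h1

theorem dist_def (r q : ConeRay p) : dist r q = ⨆ t, quot r q t := rfl

theorem dist_apply_le (r q : ConeRay p) {t : ℝ} (ht : 0 ≤ t) :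
    dist (r.toFun t) (q.toFun t) ≤ t * dist r q := by
  rcases ht.eq_or_lt with rfl | h
  · simp [r.eq_base, q.eq_base]
  · have : quot r q t ≤ dist r q := le_ciSup (bddAbove_quot r q) t
    rw [quot, div_le_iff₀ h] at this
    linarith

theorem dist_le_of_forall {r q : ConeRay p} {C : ℝ} (hC : 0 ≤ C)
    (h : ∀ t, 0 < t → dist (r.toFun t) (q.toFun t) ≤ t * C) : dist r q ≤ C := by
  refine ciSup_le fun t => ?_
  rcases le_or_gt t 0 with ht | ht
  · rwa [quot_of_nonpos r q ht]
  · rw [quot, div_le_iff₀ ht, mul_comm]; exact h t ht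

/-- The constant ray, which is the cone point. -/
def origin (p : X) : ConeRay p := ⟨fun _ => p, fun _ _ => rfl, 0, le_rfl, by simp⟩

theorem dist_origin (r : ConeRay p) : dist (origin p) r = r.speed := by
  apply le_antisymm
  · refine dist_le_of_forall r.speed_nonneg fun t ht => ?_
    change dist p _ ≤ _
    rw [r.dist_base ht.le, mul_comm]
  · have := dist_apply_le (origin p) r zero_le_one
    change dist p _ ≤ _ at this
    rw [r.dist_base zero_le_one] at this
    linarith

/-- Rescaling the speed of a ray. -/
def scale (c : ℝ) (r : ConeRay p) : ConeRay p :=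
  ⟨fun t => r.toFun (|c| * t),
    fun t ht => r.eq_base _ (mul_nonpos_of_nonneg_of_nonpos (abs_nonneg c) ht),
    |c| * r.speed, mul_nonneg (abs_nonneg c) r.speed_nonneg, fun s hs t ht => by
      rw [r.dist_eq (by positivity) (by positivity), ← mul_sub, abs_mul, abs_abs]; ring⟩

theorem scale_toFun (c : ℝ) (r : ConeRay p) (t : ℝ) :
    (scale c r).toFun t = r.toFun (|c| * t) := rfl

theorem dist_scale_scale_self {a b : ℝ} (ha : 0 ≤ a) (hb : 0 ≤ b) (r : ConeRay p) :
    dist (scale a r) (scale b r) = |a - b| * dist (origin p) r := by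
  rw [dist_origin]
  apply le_antisymm
  · refine dist_le_of_forall (mul_nonneg (abs_nonneg _) r.speed_nonneg) fun t ht => ?_
    rw [scale_toFun, scale_toFun, r.dist_eq (by positivity) (by positivity), ← sub_mul, abs_mul,
      abs_of_nonneg ha, abs_of_nonneg hb, abs_of_pos ht]
    apply le_of_eq; ring
  · have := dist_apply_le (scale a r) (scale b r) zero_le_one
    rw [scale_toFun, scale_toFun, r.dist_eq (by positivity) (by positivity), ← sub_mul, abs_mul,
      abs_of_nonneg ha, abs_of_nonneg hb] at this
    simpa [mul_comm] using this

theorem scale_scale {a b : ℝ} (r : ConeRay p) : scale a (scale b r) = scale (a * b) r :=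
  ext_fun fun t => by simp only [scale_toFun, abs_mul]; congr 1; ring

theorem scale_one (r : ConeRay p) : scale 1 r = r := ext_fun fun t => by simp [scale_toFun]

theorem scale_zero (r : ConeRay p) : scale 0 r = origin p :=
  ext_fun fun t => by simp [scale_toFun, r.eq_base, origin]

theorem dist_scale_le (c : ℝ) (r q : ConeRay p) : dist (scale c r) (scale c q) ≤ |c| * dist r q :=
  dist_le_of_forall (by positivity) fun t ht => by
    rw [scale_toFun, scale_toFun]
    refine (dist_apply_le r q (by positivity)).trans (le_of_eq (by ring))

theorem dist_scale (c : ℝ) (r q : ConeRay p) : dist (scale c r) (scale c q) = |c| * dist r q := by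
  refine le_antisymm (dist_scale_le c r q) ?_
  by_cases hc : c = 0
  · simp [hc]
  · have := dist_scale_le c⁻¹ (scale c r) (scale c q)
    rw [scale_scale, scale_scale, inv_mul_cancel₀ hc, scale_one, scale_one, abs_inv] at this
    rwa [inv_mul_eq_div, le_div_iff₀ (abs_pos.2 hc), mul_comm] at this

section CAT0
variable [CAT0Space X]

theorem monotone_quot (r q : ConeRay p) : Monotone (quot r q) := by
  intro s t hst
  rcases le_or_gt s 0 with hs | hs
  · rw [quot_of_nonpos r q hs]; exact quot_nonneg r q t
  · have ht := hs.trans_le hst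
    have := (r.isGeodesicSeg ht.le).dist_le_of_left (q.isGeodesicSeg ht.le) (t := s / t)
      ⟨by positivity, by rwa [div_le_one ht]⟩
    simp only [div_mul_cancel₀ s ht.ne'] at this
    rw [quot, quot, div_le_iff₀ hs]
    refine this.trans (le_of_eq ?_)
    field_simp

theorem tendsto_quot (r q : ConeRay p) : Tendsto (quot r q) atTop (𝓝 (dist r q)) :=
  tendsto_atTop_ciSup (monotone_quot r q) (bddAbove_quot r q)

theorem comparison (r q : ConeRay p) {c : ℝ} (h0 : 0 ≤ c) (h1 : c ≤ 1) :
    dist q (scale c r) ^ 2 ≤ (1 - c) * dist (origin p) q ^ 2 + c * dist q r ^ 2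
      - c * (1 - c) * dist (origin p) r ^ 2 := by
  refine le_of_tendsto_of_tendsto ((tendsto_quot _ _).pow 2)
    ((tendsto_const_nhds.add (((tendsto_quot q r).pow 2).const_mul c)).sub_const _) ?_
  filter_upwards [eventually_gt_atTop 0] with t ht
  have := CAT0Space.comparison (q.toFun t) _ _ _ (r.isGeodesicSeg ht.le) c ⟨h0, h1⟩
  rw [dist_comm _ p, r.dist_base ht.le, q.dist_base ht.le, ← dist_origin, ← dist_origin] at this
  simp only [quot, scale_toFun, abs_of_nonneg h0, div_pow]
  rw [div_le_iff₀ (by positivity)]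
  refine this.trans (le_of_eq ?_)
  field_simp

variable [ProperSpace X]

theorem exists_midpoint (r r' : ConeRay p) : ∃ m : ConeRay p, ∀ q, dist q m ^ 2 ≤
    1 / 2 * dist q r ^ 2 + 1 / 2 * dist q r' ^ 2 - 1 / 4 * dist r r' ^ 2 := by
  set M : ℕ → X := fun n => geoSeg (r.toFun n) (r'.toFun n) (1 / 2) with hM
  have hseg : ∀ n, IsGeodesicSeg p (M n) (geoSeg p (M n)) := fun n => geoSeg_spec _ _
  have hhalf : (1 / 2 : ℝ) ∈ Set.Icc (0:ℝ) 1 := by norm_num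
  have hquot : ∀ t : ℝ, 0 ≤ t → ∀ᶠ n : ℕ in (hyperfilter ℕ : Filter ℕ),
      0 < (n : ℝ) ∧ t / n ∈ Set.Icc (0:ℝ) 1 := by
    intro t ht
    have h : ∀ᶠ n : ℕ in atTop, 0 < (n : ℝ) ∧ t / n ∈ Set.Icc (0:ℝ) 1 := by
      filter_upwards [eventually_gt_atTop 0, eventually_ge_atTop ⌈t⌉₊] with n hn hn'
      have : 0 < (n : ℝ) := by exact_mod_cast hn
      exact ⟨this, by positivity, by rw [div_le_one this]; exact Nat.ceil_le.1 hn'⟩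
    exact (Nat.hyperfilter_le_atTop) h
  have hbound : ∀ n : ℕ, |dist p (M n) / n| ≤ 2 * r.speed + r'.speed := by
    intro n
    rcases Nat.eq_zero_or_pos n with rfl | hn
    · simpa using by linarith [r.speed_nonneg, r'.speed_nonneg]
    have hn : 0 < (n : ℝ) := by exact_mod_cast hn
    rw [abs_of_nonneg (by positivity), div_le_iff₀ hn]
    have h1 := (geoSeg_spec (r.toFun n) (r'.toFun n)).dist_left hhalf
    have h2 := dist_triangle p (r.toFun n) (M n)
    have h3 := dist_triangle_left (r.toFun n) (r'.toFun n) p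
    rw [r.dist_base hn.le] at h2 h3
    rw [r'.dist_base hn.le] at h3
    have h4 := mul_nonneg r'.speed_nonneg hn.le
    have h5 := mul_nonneg r.speed_nonneg hn.le
    simp only [hM] at *
    nlinarith
  obtain ⟨f, b, hb, hf0, hf, hfd⟩ := exists_ultralimit_ray p
    (fun n t => geoSeg p (M n) (t / n)) (fun n => dist p (M n) / n) _ hbound
    (fun n => by simp [(hseg n).1]) (fun s hs t ht => by
      filter_upwards [hquot s hs, hquot t ht] with n hsn htn
      rw [(hseg n).2.2 _ hsn.2 _ htn.2, ← sub_div, abs_div, abs_of_pos hsn.1]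
      ring)
  have hb0 : 0 ≤ b := by
    refine ge_of_tendsto hb (Eventually.of_forall fun n => by positivity)
  refine ⟨⟨f, hf0, b, hb0, hfd⟩, fun q => ?_⟩
  have hnn : 0 ≤ 1 / 2 * dist q r ^ 2 + 1 / 2 * dist q r' ^ 2 - 1 / 4 * dist r r' ^ 2 := by
    have := dist_triangle_left r r' q
    nlinarith [sq_nonneg (dist q r - dist q r'), dist_nonneg (x := q) (y := r),
      dist_nonneg (x := q) (y := r'), dist_nonneg (x := r) (y := r')]
  suffices dist q ⟨f, hf0, b, hb0, hfd⟩ ≤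
      √(1 / 2 * dist q r ^ 2 + 1 / 2 * dist q r' ^ 2 - 1 / 4 * dist r r' ^ 2) by
    calc _ ≤ _ := pow_le_pow_left₀ dist_nonneg this 2
      _ = _ := Real.sq_sqrt hnn
  refine dist_le_of_forall (Real.sqrt_nonneg _) fun t ht => ?_
  have hlim : ∀ a c : ConeRay p, Tendsto (fun n : ℕ => quot a c n)
      (hyperfilter ℕ : Filter ℕ) (𝓝 (dist a c)) := fun a c =>
    ((tendsto_quot a c).comp tendsto_natCast_atTop_atTop).mono_left Nat.hyperfilter_le_atTop
  refine le_of_tendsto_of_tendsto ((tendsto_const_nhds (x := q.toFun t)).dist (hf t ht.le))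
    ((((((hlim q r).pow 2).const_mul (1 / 2)).add (((hlim q r').pow 2).const_mul (1 / 2))).sub
      (((hlim r r').pow 2).const_mul (1 / 4))).sqrt.const_mul t) ?_
  filter_upwards [hquot t ht.le] with n hn
  have h1 := (q.isGeodesicSeg hn.1.le).dist_le_of_left (hseg n) hn.2
  simp only [div_mul_cancel₀ t hn.1.ne'] at h1
  refine h1.trans ?_
  rw [div_mul_eq_mul_div, mul_div_assoc]
  refine mul_le_mul_of_nonneg_left (Real.le_sqrt_of_sq_le ?_) ht.le
  have h2 := dist_geoSeg_half_sq_le (q.toFun n) (r.toFun n) (r'.toFun n)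
  have hn2 : (0:ℝ) < (n:ℝ) ^ 2 := by have := hn.1; positivity
  simp only [quot, div_pow]
  rw [div_le_iff₀ hn2]
  refine h2.trans (le_of_eq ?_)
  have hn1 : (n:ℝ) ≠ 0 := hn.1.ne'
  field_simp

end CAT0
end ConeRay
end TangentCone

namespace ConeRay
section InnerProduct
variable [MetricSpace X] {p : X}

/-- The cone "inner product" of two rays. -/
noncomputable def ip (r q : ConeRay p) : ℝ := (r.speed ^ 2 + q.speed ^ 2 - dist r q ^ 2) / 2

theorem ip_comm (r q : ConeRay p) : ip r q = ip q r := by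
  rw [ip, ip, dist_comm]; ring

theorem ip_self (r : ConeRay p) : ip r r = r.speed ^ 2 := by simp [ip]

theorem dist_sq_eq (r q : ConeRay p) : dist r q ^ 2 = r.speed ^ 2 + q.speed ^ 2 - 2 * ip r q := by
  rw [ip]; ring

theorem speed_scale {c : ℝ} (hc : 0 ≤ c) (r : ConeRay p) : (scale c r).speed = c * r.speed := by
  have h : scale c (origin p) = origin p := ext_fun fun t => rfl
  rw [← dist_origin, ← dist_origin, ← h, dist_scale, h, abs_of_nonneg hc]

theorem ip_scale_scale {c : ℝ} (hc : 0 ≤ c) (r q : ConeRay p) :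
    ip (scale c r) (scale c q) = c ^ 2 * ip r q := by
  rw [ip, ip, speed_scale hc, speed_scale hc, dist_scale, abs_of_nonneg hc]; ring

theorem abs_ip_sub_ip_le {r r' q : ConeRay p} (hr : r.speed = 1) (hr' : r'.speed = 1)
    (hq : q.speed = 1) : |ip r q - ip r' q| ≤ 2 * dist r r' := by
  have h1 : dist r q ≤ 2 := by
    have := dist_triangle_left r q (origin p)
    rw [dist_origin, dist_origin, hr, hq] at this; linarith
  have h2 : dist r' q ≤ 2 := by
    have := dist_triangle_left r' q (origin p)
    rw [dist_origin, dist_origin, hr', hq] at this; linarith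
  have h3 : |dist r' q - dist r q| ≤ dist r r' := by
    rw [dist_comm r r']; exact abs_dist_sub_le r' r q
  have h4 : ip r q - ip r' q = (dist r' q - dist r q) * ((dist r' q + dist r q) / 2) := by
    rw [ip, ip, hr, hr']; ring
  have h5 : 0 ≤ (dist r' q + dist r q) / 2 := by positivity
  rw [h4, abs_mul, abs_of_nonneg h5, mul_comm]
  exact mul_le_mul (by linarith) h3 (abs_nonneg _) (by norm_num)

theorem ip_le_one {r q : ConeRay p} (hr : r.speed = 1) (hq : q.speed = 1) : ip r q ≤ 1 := by
  rw [ip, hr, hq]; nlinarith [sq_nonneg (dist r q)]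

theorem continuous_scale {S : Type*} [TopologicalSpace S] {c : S → ℝ} {f : S → ConeRay p}
    (hc : Continuous c) (hc0 : ∀ x, 0 ≤ c x) (hf : Continuous f) :
    Continuous fun x => scale (c x) (f x) := by
  rw [continuous_iff_continuousAt]
  intro x
  rw [ContinuousAt, tendsto_iff_dist_tendsto_zero]
  have h : Tendsto (fun y => c y * dist (f y) (f x) + |c y - c x| * (f x).speed) (𝓝 x)
      (𝓝 (c x * dist (f x) (f x) + |c x - c x| * (f x).speed)) := by
    refine Continuous.tendsto ?_ x
    fun_prop
  simp only [dist_self, mul_zero, sub_self, abs_zero, zero_mul, add_zero] at h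
  refine squeeze_zero (fun _ => dist_nonneg) (fun y => ?_) h
  refine (dist_triangle _ (scale (c y) (f x)) _).trans (le_of_eq ?_)
  rw [dist_scale, dist_scale_scale_self (hc0 y) (hc0 x), dist_origin, abs_of_nonneg (hc0 y)]

/-- The unit speed ray with the same image. -/
noncomputable def unit (r : ConeRay p) : ConeRay p := scale (r.speed)⁻¹ r

theorem speed_unit {r : ConeRay p} (h : 0 < r.speed) : (unit r).speed = 1 := by
  rw [unit, speed_scale (by positivity), inv_mul_cancel₀ h.ne']

theorem continuous_speed : Continuous (speed : ConeRay p → ℝ) := by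
  have : (speed : ConeRay p → ℝ) = fun r => dist (origin p) r := funext fun r => (dist_origin r).symm
  rw [this]; fun_prop

theorem continuous_unit {S : Type*} [TopologicalSpace S] {f : S → ConeRay p}
    (hf : Continuous f) (h0 : ∀ x, 0 < (f x).speed) : Continuous fun x => unit (f x) := by
  refine continuous_scale ?_ (fun x => inv_nonneg.2 (f x).speed_nonneg) hf
  exact (continuous_speed.comp hf).inv₀ fun x => (h0 x).ne'

section Limits
variable [ProperSpace X]

theorem exists_unit_limit (w : ℕ → ConeRay p) (hw : ∀ n, (w n).speed = 1) :
    ∃ w' : ConeRay p, w'.speed = 1 ∧ ∀ (v : ConeRay p) (κ : ℕ → ℝ) (κ' : ℝ),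
      Tendsto κ atTop (𝓝 κ') → (∀ n, κ n ≤ ip (w n) v) → κ' ≤ ip w' v := by
  obtain ⟨f, b, hb, hf0, hf, hfd⟩ := exists_ultralimit_ray p
    (fun n => (w n).toFun) (fun _ => 1) 1 (fun _ => by simp)
    (fun n => (w n).eq_base 0 le_rfl) (fun s hs t ht => Eventually.of_forall fun n => by
      rw [(w n).dist_eq hs ht, hw])
  obtain rfl : 1 = b := tendsto_nhds_unique tendsto_const_nhds hb
  let w' : ConeRay p := ⟨f, hf0, 1, zero_le_one, hfd⟩
  have hs : w'.speed = 1 := by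
    have h1 := w'.dist_base zero_le_one
    have h2 := hfd 0 le_rfl 1 zero_le_one
    rw [hf0 0 le_rfl] at h2
    have h3 : dist p (f 1) = w'.speed * 1 := h1
    rw [h2] at h3; simpa using h3.symm
  refine ⟨w', hs, fun v κ κ' hκ hle => ?_⟩
  have hle' : ∀ n, dist (w n) v ^ 2 ≤ 1 + v.speed ^ 2 - 2 * κ n := fun n => by
    rw [dist_sq_eq, hw]; linarith [hle n]
  have hlim : Tendsto (fun n => 1 + v.speed ^ 2 - 2 * κ n) (hyperfilter ℕ : Filter ℕ)
      (𝓝 (1 + v.speed ^ 2 - 2 * κ')) :=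
    ((hκ.mono_left Nat.hyperfilter_le_atTop).const_mul 2).const_sub _
  have hnn : 0 ≤ 1 + v.speed ^ 2 - 2 * κ' :=
    ge_of_tendsto' hlim fun n => (sq_nonneg _).trans (hle' n)
  have hd : dist w' v ≤ √(1 + v.speed ^ 2 - 2 * κ') := by
    refine dist_le_of_forall (Real.sqrt_nonneg _) fun t ht => ?_
    refine le_of_tendsto_of_tendsto' ((hf t ht.le).dist tendsto_const_nhds)
      (hlim.sqrt.const_mul t) fun n => ?_
    refine (dist_apply_le _ _ ht.le).trans ?_
    exact mul_le_mul_of_nonneg_left (Real.le_sqrt_of_sq_le (hle' n)) ht.le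
  have := pow_le_pow_left₀ dist_nonneg hd 2
  rw [Real.sq_sqrt hnn, dist_sq_eq, hs] at this
  linarith

end Limits

variable [CAT0Space X]

theorem le_ip_scale {c : ℝ} (h0 : 0 ≤ c) (h1 : c ≤ 1) (q r : ConeRay p) :
    c * ip q r ≤ ip q (scale c r) := by
  have := comparison r q h0 h1
  rw [dist_origin, dist_origin] at this
  rw [ip, ip, speed_scale h0]
  nlinarith

theorem ip_scale {c : ℝ} (h0 : 0 ≤ c) (q r : ConeRay p) : ip q (scale c r) = c * ip q r := by
  have key : ∀ c : ℝ, 0 < c → c ≤ 1 → ∀ q r : ConeRay p, ip q (scale c r) = c * ip q r := by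
    intro c hc h1 q r
    refine le_antisymm ?_ (le_ip_scale hc.le h1 q r)
    have h := le_ip_scale hc.le h1 (scale c r) q
    rw [ip_comm _ (scale c q), ip_scale_scale hc.le, ip_comm _ q] at h
    refine le_of_mul_le_mul_left (h.trans (le_of_eq ?_)) hc
    ring
  rcases h0.eq_or_lt with rfl | hc
  · refine le_antisymm ?_ (le_ip_scale le_rfl zero_le_one q r)
    rw [scale_zero, ip, dist_comm, dist_origin, ← dist_origin (origin p), dist_self]
    simp
  · rcases le_total c 1 with h1 | h1
    · exact key c hc h1 q r
    · have := key c⁻¹ (by positivity) (inv_le_one_of_one_le₀ h1) q (scale c r)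
      rw [scale_scale, inv_mul_cancel₀ hc.ne', scale_one] at this
      rw [this]; field_simp

theorem ip_unit (q r : ConeRay p) : ip q (unit r) = ip q r / r.speed := by
  rw [unit, ip_scale (inv_nonneg.2 r.speed_nonneg), inv_mul_eq_div]

variable [ProperSpace X]

/-- The midpoint in the cone. -/
noncomputable def mid (r r' : ConeRay p) : ConeRay p := (exists_midpoint r r').choose

theorem mid_spec (r r' q : ConeRay p) : dist q (mid r r') ^ 2 ≤
    1 / 2 * dist q r ^ 2 + 1 / 2 * dist q r' ^ 2 - 1 / 4 * dist r r' ^ 2 :=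
  (exists_midpoint r r').choose_spec q

theorem ip_mid (r r' q : ConeRay p) : (ip r q + ip r' q) / 2 ≤ ip q (mid r r') := by
  obtain ⟨e, he⟩ : ∃ e, ∀ q, ip r q + ip r' q - e ≤ 2 * ip q (mid r r') := by
    refine ⟨1 / 2 * r.speed ^ 2 + 1 / 2 * r'.speed ^ 2 - 1 / 4 * dist r r' ^ 2
      - (mid r r').speed ^ 2, fun q => ?_⟩
    have := mid_spec r r' q
    rw [ip, ip, ip, dist_comm r, dist_comm r']
    linarith
  have h2 : ∀ n : ℕ, ip r q + ip r' q - e / (n + 1) ≤ 2 * ip q (mid r r') := by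
    intro n
    have hn : (0:ℝ) < n + 1 := by positivity
    have := he (scale (n + 1) q)
    rw [ip_comm _ (mid r r'), ip_scale hn.le, ip_scale hn.le, ip_scale hn.le,
      ip_comm (mid r r')] at this
    rw [sub_le_iff_le_add, ← sub_le_iff_le_add', le_div_iff₀ hn]
    linarith
  have h3 : Tendsto (fun n : ℕ => ip r q + ip r' q - e / ((n:ℝ) + 1)) atTop
      (𝓝 (ip r q + ip r' q - 0)) := by
    refine tendsto_const_nhds.sub ?_
    have := (tendsto_one_div_add_atTop_nhds_zero_nat (𝕜 := ℝ)).const_mul e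
    simpa [div_eq_mul_inv] using this
  have := le_of_tendsto' h3 h2
  linarith

theorem speed_mid_sq_le (r r' : ConeRay p) : (mid r r').speed ^ 2 ≤
    1 / 2 * r.speed ^ 2 + 1 / 2 * r'.speed ^ 2 - 1 / 4 * dist r r' ^ 2 := by
  simpa only [dist_origin] using mid_spec r r' (origin p)

theorem speed_mid_le (r r' : ConeRay p) : (mid r r').speed ≤ (r.speed + r'.speed) / 2 := by
  have h1 := speed_mid_sq_le r r'
  have h2 : |r.speed - r'.speed| ≤ dist r r' := by
    have := abs_dist_sub_le r r' (origin p)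
    rwa [dist_comm r, dist_comm r', dist_origin, dist_origin] at this
  have h3 : (r.speed - r'.speed) ^ 2 ≤ dist r r' ^ 2 := by
    rw [← sq_abs]; exact pow_le_pow_left₀ (abs_nonneg _) h2 2
  have h4 := r.speed_nonneg
  have h5 := r'.speed_nonneg
  refine le_of_sq_le_sq ?_ (by positivity)
  nlinarith

theorem le_speed_mid_sq (r r' : ConeRay p) :
    (r.speed ^ 2 + r'.speed ^ 2 + 2 * ip r r') / 4 ≤ (mid r r').speed ^ 2 := by
  have h1 := ip_mid r r' (mid r r')
  have h2 := ip_mid r r' r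
  have h3 := ip_mid r r' r'
  rw [ip_self] at h1 h2 h3
  rw [ip_comm r' r] at h2
  linarith

theorem dist_mid_left (r r' : ConeRay p) : dist r (mid r r') ≤ dist r r' / 2 := by
  refine le_of_sq_le_sq ?_ (by positivity)
  have := mid_spec r r' r
  rw [dist_self] at this
  linarith

theorem dist_mid_right (r r' : ConeRay p) : dist r' (mid r r') ≤ dist r r' / 2 := by
  refine le_of_sq_le_sq ?_ (by positivity)
  have := mid_spec r r' r'
  rw [dist_self, dist_comm r' r] at this
  linarith

theorem continuous_mid {S : Type*} [TopologicalSpace S] {f g : S → ConeRay p}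
    (hf : Continuous f) (hg : Continuous g) : Continuous fun x => mid (f x) (g x) := by
  rw [continuous_iff_continuousAt]
  intro x
  rw [ContinuousAt, tendsto_iff_dist_tendsto_zero]
  have h : Tendsto (fun y => 1 / 2 * (dist (f y) (g y) / 2 + dist (f y) (f x)) ^ 2 +
      1 / 2 * (dist (f y) (g y) / 2 + dist (g y) (g x)) ^ 2 - 1 / 4 * dist (f x) (g x) ^ 2) (𝓝 x)
      (𝓝 (1 / 2 * (dist (f x) (g x) / 2 + dist (f x) (f x)) ^ 2 +
      1 / 2 * (dist (f x) (g x) / 2 + dist (g x) (g x)) ^ 2 - 1 / 4 * dist (f x) (g x) ^ 2)) := by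
    refine Continuous.tendsto ?_ x
    fun_prop
  have h0 : (1 / 2 * (dist (f x) (g x) / 2 + dist (f x) (f x)) ^ 2 +
      1 / 2 * (dist (f x) (g x) / 2 + dist (g x) (g x)) ^ 2 - 1 / 4 * dist (f x) (g x) ^ 2) = 0 := by
    rw [dist_self, dist_self]; ring
  rw [h0] at h
  have h' := h.sqrt
  rw [Real.sqrt_zero] at h'
  refine squeeze_zero (fun _ => dist_nonneg) (fun y => Real.le_sqrt_of_sq_le ?_) h'
  refine (mid_spec (f x) (g x) (mid (f y) (g y))).trans ?_
  have h1 : dist (mid (f y) (g y)) (f x) ≤ dist (f y) (g y) / 2 + dist (f y) (f x) := by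
    refine (dist_triangle_left _ _ (f y)).trans ?_
    gcongr
    exact dist_mid_left _ _
  have h2 : dist (mid (f y) (g y)) (g x) ≤ dist (f y) (g y) / 2 + dist (g y) (g x) := by
    refine (dist_triangle_left _ _ (g y)).trans ?_
    gcongr
    exact dist_mid_right _ _
  gcongr

end InnerProduct
end ConeRay

namespace ConeRay
section Central
variable [MetricSpace X] {p : X}

/-- The unit rays at angle at most `π/2` from every ray. -/
def central (p : X) : Set (ConeRay p) := {ξ | ξ.speed = 1 ∧ ∀ v : ConeRay p, v.speed = 1 → 0 ≤ ip ξ v}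

variable [CAT0Space X] [ProperSpace X]

theorem ip_unit_mid_ge (r r' q : ConeRay p) :
    (ip r q + ip r' q) / 2 / (mid r r').speed ≤ ip (unit (mid r r')) q := by
  rw [ip_comm (unit _), ip_unit]
  exact div_le_div_of_nonneg_right (ip_mid r r' q) (speed_nonneg _)

theorem unit_mid_mem_central {r r' : ConeRay p} (h0 : 0 < (mid r r').speed)
    (h : ∀ v : ConeRay p, v.speed = 1 → 0 ≤ ip r v) (h' : ∀ v : ConeRay p, v.speed = 1 → 0 ≤ ip r' v) :
    unit (mid r r') ∈ central p := by
  refine ⟨speed_unit h0, fun v hv => le_trans ?_ (ip_unit_mid_ge r r' v)⟩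
  have := h v hv
  have := h' v hv
  positivity

theorem half_le_speed_mid_sq {r r' : ConeRay p} (h : r ∈ central p) (h' : r' ∈ central p) :
    1 / 2 ≤ (mid r r').speed ^ 2 := by
  have h1 := le_speed_mid_sq r r'
  have h2 := h.2 r' h'.1
  rw [h.1, h'.1] at h1
  linarith

theorem speed_mid_pos {r r' : ConeRay p} (h : r ∈ central p) (h' : r' ∈ central p) :
    0 < (mid r r').speed := by
  refine (speed_nonneg _).lt_of_ne' fun h0 => ?_
  have := half_le_speed_mid_sq h h'
  rw [h0] at this
  norm_num at this

theorem speed_mid_le_one {r r' : ConeRay p} (h : r ∈ central p) (h' : r' ∈ central p) :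
    (mid r r').speed ≤ 1 := by
  have h1 := speed_mid_le r r'
  rw [h.1, h'.1] at h1
  linarith

/-- If some central ray is uniformly at angle less than `π/2` from all central rays, then there is
a unique circumcentre of the set of central rays. -/
theorem exists_unique_center {c : ConeRay p} {κ : ℝ} (hc : c ∈ central p) (hκ : 0 < κ)
    (h : ∀ v ∈ central p, κ ≤ ip c v) :
    ∃ κ > 0, ∃! c, c ∈ central p ∧ ∀ v ∈ central p, κ ≤ ip c v := by
  set S : Set ℝ := {κ | ∃ c ∈ central p, ∀ v ∈ central p, κ ≤ ip c v} with hS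
  have hbdd : BddAbove S := ⟨1, by
    rintro κ ⟨c, hc, h⟩
    exact (h c hc).trans (ip_le_one hc.1 hc.1)⟩
  have hne : S.Nonempty := ⟨κ, c, hc, h⟩
  obtain ⟨a, -, ha, haS⟩ := exists_seq_tendsto_sSup hne hbdd
  have hpos : 0 < sSup S := hκ.trans_le (le_csSup hbdd ⟨c, hc, h⟩)
  choose w hw hwa using haS
  obtain ⟨w', hw's, hw'⟩ := exists_unit_limit w fun n => (hw n).1
  have hmem : w' ∈ central p := ⟨hw's, fun v hv =>
    hw' v (fun _ => 0) 0 tendsto_const_nhds fun n => (hw n).2 v hv⟩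
  have hle : ∀ v ∈ central p, sSup S ≤ ip w' v := fun v hv => hw' v a _ ha fun n => hwa n v hv
  refine ⟨sSup S, hpos, w', ⟨hmem, hle⟩, fun c' ⟨hc', hle'⟩ => ?_⟩
  have hm0 := speed_mid_pos hc' hmem
  have hm1 := unit_mid_mem_central hm0 hc'.2 hmem.2
  have h2 : sSup S / (mid c' w').speed ≤ sSup S := by
    refine le_csSup hbdd ⟨_, hm1, fun v hv => le_trans ?_ (ip_unit_mid_ge _ _ _)⟩
    refine div_le_div_of_nonneg_right ?_ hm0.le
    linarith [hle v hv, hle' v hv]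
  rw [div_le_iff₀ hm0] at h2
  have h3 : 1 ≤ (mid c' w').speed := by
    by_contra h4
    nlinarith
  have h4 := speed_mid_sq_le c' w'
  rw [hc'.1, hw's] at h4
  have h5 : dist c' w' ^ 2 ≤ 0 := by nlinarith
  have h6 : dist c' w' = 0 := by
    have := sq_nonneg (dist c' w')
    exact pow_eq_zero_iff (two_ne_zero) |>.1 (le_antisymm h5 this)
  exact dist_eq_zero.1 h6

theorem exists_dominating (hne : (central p).Nonempty) (S : Finset (ConeRay p))
    (hS : ∀ s ∈ S, s ∈ central p) :
    ∃ c ∈ central p, ∃ l : ℝ, 0 < l ∧ ∀ s ∈ S, ∀ v ∈ central p, l * ip s v ≤ ip c v := by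
  classical
  induction S using Finset.induction_on with
  | empty => exact ⟨hne.some, hne.some_mem, 1, one_pos, by simp⟩
  | insert a S _ ih =>
    obtain ⟨c, hc, l, hl, h⟩ := ih fun s hs => hS s (Finset.mem_insert_of_mem hs)
    have ha := hS a (Finset.mem_insert_self _ _)
    refine ⟨unit (mid c a), unit_mid_mem_central (speed_mid_pos hc ha) hc.2 ha.2,
      min (l / 2) (1 / 2), by positivity, fun s hs v hv => ?_⟩
    have h0 : (ip c v + ip a v) / 2 ≤ ip (unit (mid c a)) v := by
      refine le_trans ?_ (ip_unit_mid_ge c a v)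
      rw [le_div_iff₀ (speed_mid_pos hc ha)]
      have := hc.2 v hv.1
      have := ha.2 v hv.1
      have := speed_mid_le_one hc ha
      nlinarith
    have h1 := hc.2 v hv.1
    have h2 := ha.2 v hv.1
    rcases Finset.mem_insert.1 hs with rfl | hs
    · have := mul_le_mul_of_nonneg_right (min_le_right (l / 2) (1 / 2)) h2
      linarith
    · have h3 := (hS s (Finset.mem_insert_of_mem hs)).2 v hv.1
      have := mul_le_mul_of_nonneg_right (min_le_left (l / 2) (1 / 2)) h3
      linarith [h s hs v hv]

theorem exists_almost_orthogonal (hne : (central p).Nonempty)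
    (hB : ∀ c ∈ central p, ∀ κ > 0, ∃ v ∈ central p, ip c v < κ) {T : Set (ConeRay p)}
    (hT : IsCompact T) (hsub : T ⊆ central p) {ε : ℝ} (hε : 0 < ε) :
    ∃ η ∈ central p, ∀ s ∈ T, ip s η < ε := by
  obtain ⟨t, hts, htf, hcov⟩ := hT.finite_cover_balls (e := ε / 4) (by positivity)
  obtain ⟨c, hc, l, hl, h⟩ := exists_dominating hne htf.toFinset
    (fun s hs => hsub (hts (by simpa using hs)))
  obtain ⟨v, hv, hlt⟩ := hB c hc (l * (ε / 2)) (by positivity)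
  refine ⟨v, hv, fun s hs => ?_⟩
  obtain ⟨s', hs', hss⟩ := mem_iUnion₂.1 (hcov hs)
  rw [mem_ball] at hss
  have h1 := h s' (by simpa using hs') v hv
  have h2 : ip s' v < ε / 2 := lt_of_mul_lt_mul_left (h1.trans_lt hlt) hl.le
  have h3 := (le_abs_self _).trans
    (abs_ip_sub_ip_le (hsub hs).1 (hsub (hts hs')).1 hv.1)
  linarith

/-- The face condition on the cube. -/
def Face (k i : ℕ) (x : ℕ → unitInterval) : Prop :=
  (1 ≤ i ∧ x i = 0) ∨ ∃ j, i < j ∧ j ≤ k ∧ x j = 1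

/-- Maps of cubes of any dimension which are essential, in the sense that no point is close to the
images of all the (deformed) faces of a simplex. -/
theorem exists_essential_cube (hne : (central p).Nonempty)
    (hB : ∀ c ∈ central p, ∀ κ > 0, ∃ v ∈ central p, ip c v < κ) (k : ℕ) :
    ∃ (ψ : (ℕ → unitInterval) → ConeRay p) (δ : ℝ), Continuous ψ ∧ (∀ x, ψ x ∈ central p) ∧
      0 < δ ∧ ∀ ζ : ConeRay p, ∃ i ≤ k, ∀ x, Face k i x → δ ≤ dist ζ (ψ x) := by
  induction k with
  | zero =>
    refine ⟨fun _ => hne.some, 1, continuous_const, fun _ => hne.some_mem, one_pos, fun ζ =>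
      ⟨0, le_rfl, fun x hx => ?_⟩⟩
    rcases hx with ⟨h, -⟩ | ⟨j, h, h', -⟩ <;> omega
  | succ k ih =>
    obtain ⟨ψ, d, hψ, hψC, hd, hζ⟩ := ih
    set e := min d 1 with he
    have he0 : 0 < e := lt_min hd one_pos
    have he1 : e ≤ 1 := min_le_right _ _
    have hed : e ≤ d := min_le_left _ _
    set δ := e ^ 2 / 40 with hδ
    have hδ0 : 0 < δ := by positivity
    obtain ⟨η, hη, hηs⟩ := exists_almost_orthogonal hne hB (isCompact_range hψ)
      (by rintro _ ⟨x, rfl⟩; exact hψC x) hδ0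
    let a : (ℕ → unitInterval) → ℝ := fun x => 1 - (x (k + 1) : ℝ)
    let b : (ℕ → unitInterval) → ℝ := fun x => (x (k + 1) : ℝ)
    have ha0 : ∀ x, 0 ≤ a x := fun x => sub_nonneg.2 (x (k + 1)).2.2
    have hb0 : ∀ x, 0 ≤ b x := fun x => (x (k + 1)).2.1
    have hab : ∀ x, a x + b x = 1 := fun x => by simp [a, b]
    have hbc : Continuous b := by fun_prop
    have hac : Continuous a := by fun_prop
    let m : (ℕ → unitInterval) → ConeRay p := fun x => mid (scale (a x) (ψ x)) (scale (b x) η)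
    have hmc : Continuous m := continuous_mid (continuous_scale hac ha0 hψ)
      (continuous_scale hbc hb0 continuous_const)
    have hsa : ∀ x, (scale (a x) (ψ x)).speed = a x := fun x => by
      rw [speed_scale (ha0 x), (hψC x).1, mul_one]
    have hsb : ∀ x, (scale (b x) η).speed = b x := fun x => by
      rw [speed_scale (hb0 x), hη.1, mul_one]
    have hipa : ∀ x v, ip (scale (a x) (ψ x)) v = a x * ip (ψ x) v := fun x v => by
      rw [ip_comm, ip_scale (ha0 x), ip_comm]
    have hipb : ∀ x v, ip (scale (b x) η) v = b x * ip η v := fun x v => by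
      rw [ip_comm, ip_scale (hb0 x), ip_comm]
    have hmpos : ∀ x, 0 < (m x).speed := by
      intro x
      have h1 := le_speed_mid_sq (scale (a x) (ψ x)) (scale (b x) η)
      rw [hsa, hsb, hipa, ip_scale (hb0 x)] at h1
      have h2 := mul_nonneg (ha0 x) (mul_nonneg (hb0 x) ((hψC x).2 η hη.1))
      refine (speed_nonneg _).lt_of_ne' fun h0 => ?_
      have h3 : (m x).speed ^ 2 = 0 := by rw [h0]; norm_num
      have h3' : (mid (scale (a x) (ψ x)) (scale (b x) η)).speed ^ 2 = 0 := h3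
      nlinarith [hab x, ha0 x, hb0 x]
    have hmle : ∀ x, (m x).speed ≤ 1 / 2 := fun x => by
      have := speed_mid_le (scale (a x) (ψ x)) (scale (b x) η)
      rwa [hsa, hsb, hab] at this
    have hip : ∀ x v, v ∈ central p → a x * ip (ψ x) v + b x * ip η v ≤ ip (unit (m x)) v := by
      intro x v hv
      refine le_trans ?_ (ip_unit_mid_ge _ _ v)
      rw [hipa, hipb, le_div_iff₀ (hmpos x)]
      have h1 := mul_nonneg (ha0 x) ((hψC x).2 v hv.1)
      have h2 := mul_nonneg (hb0 x) (hη.2 v hv.1)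
      have := hmle x
      change (_ + _) * (m x).speed ≤ _
      nlinarith
    have hmem : ∀ x, unit (m x) ∈ central p := fun x => by
      refine unit_mid_mem_central (hmpos x) (fun v hv => ?_) (fun v hv => ?_)
      · rw [hipa]; exact mul_nonneg (ha0 x) ((hψC x).2 v hv)
      · rw [hipb]; exact mul_nonneg (hb0 x) (hη.2 v hv)
    have hdist : ∀ x, dist (unit (m x)) (ψ x) ^ 2 ≤ 2 * b x := fun x => by
      have h1 := hip x (ψ x) (hψC x)
      rw [ip_self, (hψC x).1] at h1
      rw [dist_sq_eq, (hψC x).1, (hmem x).1]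
      have h2 := mul_nonneg (hb0 x) (hη.2 (ψ x) (hψC x).1)
      nlinarith [hab x]
    refine ⟨fun x => unit (m x), δ, continuous_unit hmc hmpos, hmem, hδ0, fun ζ => ?_⟩
    by_cases hlast : ∀ x, Face (k + 1) (k + 1) x → δ ≤ dist ζ (unit (m x))
    · exact ⟨k + 1, le_rfl, hlast⟩
    push Not at hlast
    obtain ⟨x₀, hx₀, hx₀d⟩ := hlast
    have hx₀' : x₀ (k + 1) = 0 := by
      rcases hx₀ with h | ⟨j, h, h', -⟩
      · exact h.2
      · omega
    have hζx₀ : dist ζ (ψ x₀) < δ := by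
      have h1 := hdist x₀
      have h2 : b x₀ = 0 := by simp [b, hx₀']
      rw [h2, mul_zero] at h1
      have h3 : dist (unit (m x₀)) (ψ x₀) = 0 :=
        pow_eq_zero_iff two_ne_zero |>.1 (le_antisymm h1 (sq_nonneg _))
      rwa [dist_eq_zero.1 h3] at hx₀d
    obtain ⟨i, hik, hi⟩ := hζ ζ
    refine ⟨i, by omega, fun x hx => ?_⟩
    by_contra! hlt
    have h1 : b x ≤ ip (unit (m x)) η := by
      have h1 := hip x η hη
      rw [ip_self, hη.1] at h1
      have := mul_nonneg (ha0 x) ((hψC x).2 η hη.1)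
      linarith
    have h2 : dist (unit (m x)) (ψ x₀) < 2 * δ := by
      have := dist_triangle_left (unit (m x)) (ψ x₀) ζ
      linarith
    have h3 := (le_abs_self _).trans (abs_ip_sub_ip_le (hmem x).1 (hψC x₀).1 hη.1)
    have h4 := hηs _ (mem_range_self x₀)
    have h5 : b x < 5 * δ := by linarith
    have h6 : i ≤ k ∧ Face k i x := by
      refine ⟨hik, ?_⟩
      rcases hx with h | ⟨j, h, h', hj⟩
      · exact Or.inl h
      · rcases Nat.lt_or_ge k j with hkj | hkj
        · obtain rfl : j = k + 1 := by omega
          have : b x = 1 := by simp [b, hj]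
          nlinarith
        · exact Or.inr ⟨j, h, hkj, hj⟩
    have h7 := hi x h6.2
    have h8 := dist_triangle ζ (unit (m x)) (ψ x)
    have h9 : dist (unit (m x)) (ψ x) ≤ e / 2 := by
      refine le_of_sq_le_sq ((hdist x).trans ?_) (by positivity)
      linarith
    nlinarith

end Central
end ConeRay

section Rays
variable [MetricSpace X]

namespace GeodesicRay

theorem dist_eq_sub (ρ : GeodesicRay X) {s t : ℝ} (hs : 0 ≤ s) (hst : s ≤ t) :
    dist (ρ.toFun s) (ρ.toFun t) = t - s := by
  rw [ρ.isom s hs t (hs.trans hst), abs_sub_comm, abs_of_nonneg (sub_nonneg.2 hst)]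

theorem dist_zero (ρ : GeodesicRay X) {t : ℝ} (ht : 0 ≤ t) :
    dist (ρ.toFun 0) (ρ.toFun t) = t := by
  rw [ρ.dist_eq_sub le_rfl ht, sub_zero]

/-- The subray starting at time `a`. -/
def shift (ρ : GeodesicRay X) {a : ℝ} (ha : 0 ≤ a) : GeodesicRay X :=
  ⟨fun t => ρ.toFun (a + t), fun s hs t ht => by
    rw [ρ.isom _ (by positivity) _ (by positivity)]; congr 1; ring⟩

theorem shift_toFun (ρ : GeodesicRay X) {a : ℝ} (ha : 0 ≤ a) (t : ℝ) :
    (ρ.shift ha).toFun t = ρ.toFun (a + t) := rfl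

theorem asymp_shift (ρ : GeodesicRay X) {a : ℝ} (ha : 0 ≤ a) : (ρ.shift ha).Asymp ρ :=
  ⟨a, fun t ht => by
    rw [shift_toFun, ρ.isom _ (by positivity) _ ht]
    simp [abs_of_nonneg ha]⟩

theorem isGeodesicSeg (ρ : GeodesicRay X) {T : ℝ} (hT : 0 ≤ T) :
    IsGeodesicSeg (ρ.toFun 0) (ρ.toFun T) (fun t => ρ.toFun (t * T)) := by
  refine ⟨by simp, by simp, fun s hs t ht => ?_⟩
  rw [ρ.isom _ (mul_nonneg hs.1 hT) _ (mul_nonneg ht.1 hT), ρ.dist_zero hT, ← sub_mul, abs_mul,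
    abs_of_nonneg hT]

theorem cls_eq_iff {ρ σ : GeodesicRay X} : ρ.cls = σ.cls ↔ ρ.Asymp σ := Quotient.eq

theorem exists_cls_eq (ξ : Boundary X) : ∃ ρ : GeodesicRay X, ρ.cls = ξ := Quotient.exists_rep ξ

/-- A unit speed ray, seen as a point of the cone of rays from its origin. -/
def toCone (ρ : GeodesicRay X) {p : X} (hp : ρ.toFun 0 = p) : ConeRay p :=
  ⟨fun t => ρ.toFun (max t 0), fun t ht => by rw [max_eq_right ht, hp], 1, zero_le_one,
    fun s hs t ht => by rw [max_eq_left hs, max_eq_left ht, ρ.isom s hs t ht, one_mul]⟩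

theorem toCone_toFun (ρ : GeodesicRay X) {p : X} (hp : ρ.toFun 0 = p) {t : ℝ} (ht : 0 ≤ t) :
    (ρ.toCone hp).toFun t = ρ.toFun t := by
  change ρ.toFun (max t 0) = _
  rw [max_eq_left ht]

theorem speed_toCone (ρ : GeodesicRay X) {p : X} (hp : ρ.toFun 0 = p) :
    (ρ.toCone hp).speed = 1 := by
  subst hp
  have := (ρ.toCone rfl).dist_base zero_le_one
  rw [toCone_toFun _ _ zero_le_one, ρ.dist_zero zero_le_one] at this
  linarith

section CAT0
variable [CAT0Space X]

theorem comparison_monotone (ρ : GeodesicRay X) (z : X) {s' s : ℝ} (hs' : 0 < s') (h : s' ≤ s) :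
    (s ^ 2 + dist (ρ.toFun 0) z ^ 2 - dist (ρ.toFun s) z ^ 2) / s ≤
      (s' ^ 2 + dist (ρ.toFun 0) z ^ 2 - dist (ρ.toFun s') z ^ 2) / s' := by
  have hs := hs'.trans_le h
  have h1 := CAT0Space.comparison z _ _ _ (ρ.isGeodesicSeg hs.le) (s' / s)
    ⟨by positivity, (div_le_one hs).2 h⟩
  simp only [div_mul_cancel₀ s' hs.ne', ρ.dist_zero hs.le, dist_comm z] at h1
  rw [div_le_div_iff₀ hs hs']
  have h2 : dist (ρ.toFun s') z ^ 2 * s ≤ (s - s') * dist (ρ.toFun 0) z ^ 2 +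
      s' * dist (ρ.toFun s) z ^ 2 - s' * (s - s') * s := by
    refine (mul_le_mul_of_nonneg_right h1 hs.le).trans (le_of_eq ?_)
    field_simp
  nlinarith

variable [ProperSpace X]

/-- Existence of a ray from a given point of a closed convex set asymptotic to a given ray which
stays close to the convex set. -/
theorem exists_asymp_mem (ρ : GeodesicRay X) {K : Set X} (hK : IsClosed K) (hconv : GeoConvex K)
    {p : X} (hp : p ∈ K) {C : ℝ} (hC : ∀ t, 0 ≤ t → ∃ y ∈ K, dist (ρ.toFun t) y ≤ C) :
    ∃ σ : GeodesicRay X, σ.toFun 0 = p ∧ σ.Asymp ρ ∧ ∀ t, 0 ≤ t → σ.toFun t ∈ K := by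
  have : Nonempty X := ⟨p⟩
  choose! y hyK hy using hC
  set B := C + dist p (ρ.toFun 0) with hB
  have hC0 : 0 ≤ C := dist_nonneg.trans (hy 0 le_rfl)
  have hB0 : 0 ≤ B := by positivity
  have hdist : ∀ n : ℕ, |dist p (y n) - n| ≤ B := by
    intro n
    have h1 := dist_triangle4 p (ρ.toFun 0) (ρ.toFun n) (y n)
    have h2 := dist_triangle4 (ρ.toFun 0) p (y n) (ρ.toFun n)
    rw [ρ.dist_zero n.cast_nonneg] at h1 h2
    rw [dist_comm _ p, dist_comm (y n)] at h2
    have h3 := hy n n.cast_nonneg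
    rw [abs_le]
    constructor <;> linarith
  have hquot : ∀ t : ℝ, 0 ≤ t → ∀ᶠ n : ℕ in (hyperfilter ℕ : Filter ℕ),
      0 < (n : ℝ) ∧ t / n ∈ Set.Icc (0:ℝ) 1 := by
    intro t ht
    have h : ∀ᶠ n : ℕ in atTop, 0 < (n : ℝ) ∧ t / n ∈ Set.Icc (0:ℝ) 1 := by
      filter_upwards [eventually_gt_atTop 0, eventually_ge_atTop ⌈t⌉₊] with n hn hn'
      have : 0 < (n : ℝ) := by exact_mod_cast hn
      exact ⟨this, by positivity, by rw [div_le_one this]; exact Nat.ceil_le.1 hn'⟩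
    exact Nat.hyperfilter_le_atTop h
  have hspeed : ∀ n : ℕ, |dist p (y n) / n - (if n = 0 then 0 else 1)| ≤ B / n := by
    intro n
    rcases Nat.eq_zero_or_pos n with rfl | hn
    · simp
    have hn' : 0 < (n : ℝ) := by exact_mod_cast hn
    have : dist p (y n) / n - 1 = (dist p (y n) - n) / n := by field_simp
    rw [if_neg hn.ne', this, abs_div, abs_of_pos hn']
    exact div_le_div_of_nonneg_right (hdist n) hn'.le
  obtain ⟨f, b, hb, hf0, hf, hfd⟩ := exists_ultralimit_ray p
    (fun n t => geoSeg p (y n) (t / n)) (fun n => dist p (y n) / n) (B + 1) (by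
      intro n
      rcases Nat.eq_zero_or_pos n with rfl | hn
      · simpa using by positivity
      have hn' : 1 ≤ (n : ℝ) := by exact_mod_cast hn
      have h1 := hspeed n
      have h2 : B / n ≤ B := div_le_self hB0 hn'
      rw [if_neg hn.ne', abs_le] at h1
      rw [abs_le]
      constructor <;> linarith)
    (fun n => by simp [(geoSeg_spec p (y n)).1]) (fun s hs t ht => by
      filter_upwards [hquot s hs, hquot t ht] with n hsn htn
      rw [(geoSeg_spec p (y n)).2.2 _ hsn.2 _ htn.2, ← sub_div, abs_div, abs_of_pos hsn.1]
      ring)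
  have hb1 : b = 1 := by
    refine tendsto_nhds_unique hb ?_
    refine Tendsto.mono_left ?_ Nat.hyperfilter_le_atTop
    rw [tendsto_iff_dist_tendsto_zero]
    refine squeeze_zero' (Eventually.of_forall fun _ => dist_nonneg) ?_
      (tendsto_const_div_atTop_nhds_zero_nat B)
    filter_upwards [eventually_gt_atTop 0] with n hn
    have := hspeed n
    rwa [if_neg hn.ne'] at this
  subst hb1
  refine ⟨⟨f, fun s hs t ht => by rw [hfd s hs t ht, one_mul]⟩, hf0 0 le_rfl, ⟨B, fun t ht => ?_⟩,
    fun t ht => ?_⟩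
  · refine le_of_tendsto ((hf t ht).dist tendsto_const_nhds) ?_
    filter_upwards [hquot t ht] with n hn
    have h1 := (geoSeg_spec p (y n)).dist_le (ρ.isGeodesicSeg hn.1.le) hn.2
    simp only [div_mul_cancel₀ t hn.1.ne'] at h1
    refine h1.trans ?_
    have h2 := hy n hn.1.le
    rw [dist_comm] at h2
    have h3 : 0 ≤ dist p (ρ.toFun 0) := dist_nonneg
    obtain ⟨h4, h5⟩ := hn.2
    nlinarith
  · refine hK.mem_of_tendsto (hf t ht) ?_
    filter_upwards [hquot t ht] with n hn
    exact hconv _ hp _ (hyK n n.cast_nonneg) _ (geoSeg_spec p (y n)) _ hn.2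

theorem exists_asymp (ρ : GeodesicRay X) (p : X) :
    ∃ σ : GeodesicRay X, σ.toFun 0 = p ∧ σ.Asymp ρ := by
  obtain ⟨σ, h1, h2, -⟩ := ρ.exists_asymp_mem isClosed_univ (fun _ _ _ _ _ _ _ _ => mem_univ _)
    (mem_univ p) (C := 0) (fun t _ => ⟨ρ.toFun t, mem_univ _, by simp⟩)
  exact ⟨σ, h1, h2⟩

end CAT0

/-- The Busemann function, as an infimum. -/
noncomputable def bus (σ : GeodesicRay X) (y : X) : ℝ := ⨅ n : ℕ, (dist (σ.toFun n) y - n)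

theorem bus_antitone (σ : GeodesicRay X) (y : X) :
    Antitone fun n : ℕ => dist (σ.toFun n) y - (n:ℝ) := by
  intro m n h
  have h1 := dist_triangle_left (σ.toFun n) y (σ.toFun m)
  rw [σ.dist_eq_sub m.cast_nonneg (Nat.cast_le.2 h)] at h1
  change dist (σ.toFun n) y - (n:ℝ) ≤ dist (σ.toFun m) y - (m:ℝ)
  linarith

theorem neg_dist_le_bus_term (σ : GeodesicRay X) (y : X) (n : ℕ) :
    - dist (σ.toFun 0) y ≤ dist (σ.toFun n) y - n := by
  have h1 := dist_triangle_right (σ.toFun 0) (σ.toFun n) y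
  rw [σ.dist_zero n.cast_nonneg] at h1
  linarith

theorem bddBelow_bus (σ : GeodesicRay X) (y : X) :
    BddBelow (range fun n : ℕ => dist (σ.toFun n) y - (n:ℝ)) :=
  ⟨_, by rintro _ ⟨n, rfl⟩; exact σ.neg_dist_le_bus_term y n⟩

theorem bus_le (σ : GeodesicRay X) (y : X) (n : ℕ) : σ.bus y ≤ dist (σ.toFun n) y - n :=
  ciInf_le (σ.bddBelow_bus y) n

theorem tendsto_bus (σ : GeodesicRay X) (y : X) :
    Tendsto (fun n : ℕ => dist (σ.toFun n) y - n) atTop (𝓝 (σ.bus y)) :=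
  tendsto_atTop_ciInf (σ.bus_antitone y) (σ.bddBelow_bus y)

theorem bus_le_add (σ : GeodesicRay X) (y z : X) : σ.bus y ≤ σ.bus z + dist z y := by
  refine le_of_tendsto_of_tendsto' (σ.tendsto_bus y) ((σ.tendsto_bus z).add_const _) fun n => ?_
  have := dist_triangle (σ.toFun n) z y
  linarith

theorem bus_self (σ : GeodesicRay X) {t : ℝ} (ht : 0 ≤ t) : σ.bus (σ.toFun t) = -t := by
  refine tendsto_nhds_unique (σ.tendsto_bus _) (tendsto_const_nhds.congr' ?_)
  filter_upwards [eventually_ge_atTop ⌈t⌉₊] with n hn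
  rw [dist_comm, σ.dist_eq_sub ht (Nat.ceil_le.1 hn)]
  ring

variable [CAT0Space X]

theorem bus_convex (σ : GeodesicRay X) {x y : X} {γ : ℝ → X} (h : IsGeodesicSeg x y γ) {t : ℝ}
    (ht : t ∈ Set.Icc (0:ℝ) 1) : σ.bus (γ t) ≤ (1 - t) * σ.bus x + t * σ.bus y := by
  refine le_of_tendsto_of_tendsto' (σ.tendsto_bus _)
    (((σ.tendsto_bus x).const_mul _).add ((σ.tendsto_bus y).const_mul _)) fun n => ?_
  have h1 : IsGeodesicSeg (σ.toFun n) (σ.toFun n) (fun _ => σ.toFun n) := ⟨rfl, rfl, by simp⟩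
  have := h1.dist_le h ht
  linarith

theorem bus_of_asymp (σ τ : GeodesicRay X) (h : τ.Asymp σ) {t : ℝ} (ht : 0 ≤ t) :
    σ.bus (τ.toFun t) = σ.bus (τ.toFun 0) - t := by
  obtain ⟨C, hC⟩ := h
  apply le_antisymm
  · have h1 : Tendsto (fun n : ℕ => (1 - t / n) * σ.bus (τ.toFun 0) + (t * (C / n) - t)) atTop
        (𝓝 ((1 - 0) * σ.bus (τ.toFun 0) + (t * 0 - t))) :=
      (((tendsto_const_div_atTop_nhds_zero_nat t).const_sub 1).mul_const _).add
        (((tendsto_const_div_atTop_nhds_zero_nat C).const_mul t).sub_const _)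
    refine (ge_of_tendsto h1 ?_).trans (le_of_eq (by ring))
    filter_upwards [eventually_ge_atTop ⌈t⌉₊, eventually_gt_atTop 0] with n hn hn0
    have hn' : (0:ℝ) < n := by exact_mod_cast hn0
    have h2 := σ.bus_convex (τ.isGeodesicSeg hn'.le) (t := t / n)
      ⟨by positivity, by rw [div_le_one hn']; exact Nat.ceil_le.1 hn⟩
    simp only [div_mul_cancel₀ t hn'.ne'] at h2
    have h3 := σ.bus_le_add (τ.toFun n) (σ.toFun n)
    rw [σ.bus_self hn'.le, dist_comm] at h3
    have h4 := hC n hn'.le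
    have h5 : t / n * σ.bus (τ.toFun n) ≤ t / n * (C - n) :=
      mul_le_mul_of_nonneg_left (by linarith) (by positivity)
    have h6 : t / n * (C - n) = t * (C / n) - t := by field_simp
    linarith
  · have := σ.bus_le_add (τ.toFun 0) (τ.toFun t)
    rw [dist_comm, τ.dist_zero ht] at this
    linarith

theorem bus_le_bus_add (σ τ : GeodesicRay X) (h : τ.Asymp σ) (y : X) :
    σ.bus y ≤ σ.bus (τ.toFun 0) + τ.bus y := by
  refine ge_of_tendsto' ((τ.tendsto_bus y).const_add _) fun n => ?_
  have := σ.bus_le_add y (τ.toFun n)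
  rw [σ.bus_of_asymp τ h n.cast_nonneg] at this
  linarith

/-- Busemann functions of asymptotic rays differ by a constant. -/
theorem bus_eq_add (σ τ : GeodesicRay X) (h : τ.Asymp σ) (y : X) :
    σ.bus y = σ.bus (τ.toFun 0) + τ.bus y := by
  refine le_antisymm (σ.bus_le_bus_add τ h y) ?_
  have h' : σ.Asymp τ := (GeodesicRay.asymp_equivalence X).symm h
  have h1 := τ.bus_le_bus_add σ h' y
  suffices σ.bus (τ.toFun 0) + τ.bus (σ.toFun 0) ≤ 0 by linarith
  obtain ⟨C, hC⟩ := h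
  set A := σ.bus (τ.toFun 0) with hA
  set B := τ.bus (σ.toFun 0) with hB
  refine ge_of_tendsto (tendsto_const_div_atTop_nhds_zero_nat (C ^ 2)) ?_
  filter_upwards [eventually_gt_atTop 0, eventually_ge_atTop ⌈-A⌉₊, eventually_ge_atTop ⌈-B⌉₊]
    with n hn hnA hnB
  have hn' : (0:ℝ) < n := by exact_mod_cast hn
  have hA' := Nat.ceil_le.1 hnA
  have hB' := Nat.ceil_le.1 hnB
  rw [le_div_iff₀ hn']
  have h2 := dist_sq_add_dist_sq_le (σ.toFun 0) (σ.toFun n) (τ.toFun n) (τ.toFun 0)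
  rw [σ.dist_zero hn'.le, dist_comm (τ.toFun n) (τ.toFun 0), τ.dist_zero hn'.le] at h2
  have h3 := σ.bus_le (τ.toFun 0) n
  have h4 := τ.bus_le (σ.toFun 0) n
  rw [dist_comm] at h4
  have h5 : (n + A) ^ 2 ≤ dist (σ.toFun n) (τ.toFun 0) ^ 2 :=
    pow_le_pow_left₀ (by linarith) (by linarith) 2
  have h6 : (n + B) ^ 2 ≤ dist (σ.toFun 0) (τ.toFun n) ^ 2 :=
    pow_le_pow_left₀ (by linarith) (by linarith) 2
  have h7 := pow_le_pow_left₀ dist_nonneg (hC n hn'.le) 2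
  have h8 := pow_le_pow_left₀ dist_nonneg (hC 0 le_rfl) 2
  rw [dist_comm] at h7
  nlinarith [sq_nonneg A, sq_nonneg B]

end GeodesicRay
end Rays

section TitsAngle
variable [MetricSpace X]

namespace ConeRay
variable {p p' : X}

/-- A unit element of the cone, seen as a geodesic ray. -/
def toRay (r : ConeRay p) (h : r.speed = 1) : GeodesicRay X :=
  ⟨r.toFun, fun s hs t ht => by rw [r.dist_eq hs ht, h, one_mul]⟩

theorem toRay_toFun (r : ConeRay p) (h : r.speed = 1) (t : ℝ) :
    (r.toRay h).toFun t = r.toFun t := rfl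

theorem toRay_zero (r : ConeRay p) (h : r.speed = 1) : (r.toRay h).toFun 0 = p :=
  r.eq_base 0 le_rfl

theorem cls_toRay_toCone (ρ : GeodesicRay X) (hp : ρ.toFun 0 = p) :
    ((ρ.toCone hp).toRay (ρ.speed_toCone hp)).cls = ρ.cls :=
  GeodesicRay.cls_eq_iff.2 ⟨0, fun t ht => by
    rw [toRay_toFun, ρ.toCone_toFun hp ht, dist_self]⟩

variable [CAT0Space X]

theorem dist_eq_of_bounded {r q : ConeRay p} {r' q' : ConeRay p'} {C C' : ℝ}
    (hr : ∀ t, 0 ≤ t → dist (r.toFun t) (r'.toFun t) ≤ C)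
    (hq : ∀ t, 0 ≤ t → dist (q.toFun t) (q'.toFun t) ≤ C') : dist r q = dist r' q' := by
  have h : Tendsto (fun n : ℕ => quot r q n - quot r' q' n) atTop (𝓝 (dist r q - dist r' q')) :=
    ((tendsto_quot r q).comp tendsto_natCast_atTop_atTop).sub
      ((tendsto_quot r' q').comp tendsto_natCast_atTop_atTop)
  have h0 : Tendsto (fun n : ℕ => quot r q n - quot r' q' n) atTop (𝓝 0) := by
    refine squeeze_zero_norm' ?_ (tendsto_const_div_atTop_nhds_zero_nat (C + C'))
    filter_upwards [eventually_gt_atTop 0] with n hn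
    have hn' : (0:ℝ) < n := by exact_mod_cast hn
    have h1 := dist_triangle4 (r.toFun n) (r'.toFun n) (q'.toFun n) (q.toFun n)
    have h2 := dist_triangle4 (r'.toFun n) (r.toFun n) (q.toFun n) (q'.toFun n)
    rw [dist_comm (q'.toFun n)] at h1
    rw [dist_comm (r'.toFun n) (r.toFun n)] at h2
    have h3 := hr n hn'.le
    have h4 := hq n hn'.le
    rw [quot, quot, ← sub_div, norm_div, Real.norm_eq_abs, Real.norm_eq_abs, abs_of_pos hn']
    refine div_le_div_of_nonneg_right ?_ hn'.le
    rw [abs_le]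
    constructor <;> linarith
  exact sub_eq_zero.1 (tendsto_nhds_unique h h0)

theorem dist_eq_of_cls_eq {r q : ConeRay p} {r' q' : ConeRay p'} (hr : r.speed = 1)
    (hq : q.speed = 1) (hr' : r'.speed = 1) (hq' : q'.speed = 1)
    (h : (r.toRay hr).cls = (r'.toRay hr').cls) (h' : (q.toRay hq).cls = (q'.toRay hq').cls) :
    dist r q = dist r' q' := by
  obtain ⟨C, hC⟩ := GeodesicRay.cls_eq_iff.1 h
  obtain ⟨C', hC'⟩ := GeodesicRay.cls_eq_iff.1 h'
  exact dist_eq_of_bounded hC hC'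

theorem ip_eq_of_cls_eq {r q : ConeRay p} {r' q' : ConeRay p'} (hr : r.speed = 1)
    (hq : q.speed = 1) (hr' : r'.speed = 1) (hq' : q'.speed = 1)
    (h : (r.toRay hr).cls = (r'.toRay hr').cls) (h' : (q.toRay hq).cls = (q'.toRay hq').cls) :
    ip r q = ip r' q' := by
  rw [ip, ip, hr, hq, hr', hq', dist_eq_of_cls_eq hr hq hr' hq' h h']

theorem exists_toRay_cls_eq [ProperSpace X] (p : X) (ξ : Boundary X) :
    ∃ (r : ConeRay p) (h : r.speed = 1), (r.toRay h).cls = ξ := by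
  obtain ⟨ρ, rfl⟩ := GeodesicRay.exists_cls_eq ξ
  obtain ⟨σ, h0, hσ⟩ := ρ.exists_asymp p
  exact ⟨σ.toCone h0, σ.speed_toCone h0,
    (cls_toRay_toCone σ h0).trans (GeodesicRay.cls_eq_iff.2 hσ)⟩

end ConeRay

open ConeRay

theorem cmpAngle_nonneg (p x y : X) : 0 ≤ cmpAngle p x y := Real.arccos_nonneg _

theorem alexAngleRays_le (ρ σ : ℝ → X) {s t : ℝ} (hs : 0 < s) (ht : 0 < t) :
    alexAngleRays ρ σ ≤ cmpAngle (ρ 0) (ρ s) (σ t) :=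
  csInf_le ⟨0, by rintro _ ⟨s, _, t, _, rfl⟩; exact cmpAngle_nonneg _ _ _⟩ ⟨s, hs, t, ht, rfl⟩

theorem le_alexAngleRays {ρ σ : ℝ → X} {a : ℝ}
    (h : ∀ s t, 0 < s → 0 < t → a ≤ cmpAngle (ρ 0) (ρ s) (σ t)) : a ≤ alexAngleRays ρ σ :=
  le_csInf ⟨_, 1, one_pos, 1, one_pos, rfl⟩ (by
    rintro _ ⟨s, hs, t, ht, rfl⟩; exact h s t hs ht)

theorem cmpAngle_rays {ρ σ : GeodesicRay X} (h : ρ.toFun 0 = σ.toFun 0) {s t : ℝ} (hs : 0 < s)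
    (ht : 0 < t) : cmpAngle (ρ.toFun 0) (ρ.toFun s) (σ.toFun t) =
      Real.arccos ((s ^ 2 + t ^ 2 - dist (ρ.toFun s) (σ.toFun t) ^ 2) / (2 * s * t)) := by
  rw [cmpAngle, ρ.dist_zero hs.le, h, σ.dist_zero ht.le]

theorem bddAbove_titsAngle (ξ η : Boundary X) :
    BddAbove {a | ∃ ρ σ : GeodesicRay X, ρ.toFun 0 = σ.toFun 0 ∧ ρ.cls = ξ ∧ σ.cls = η ∧
      a = alexAngleRays ρ.toFun σ.toFun} := by
  refine ⟨Real.pi, ?_⟩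
  rintro _ ⟨ρ, σ, -, -, -, rfl⟩
  exact (alexAngleRays_le _ _ one_pos one_pos).trans (Real.arccos_le_pi _)

theorem alexAngleRays_congr {ρ σ ρ' σ' : ℝ → X} (h : ∀ t, 0 ≤ t → ρ t = ρ' t)
    (h' : ∀ t, 0 ≤ t → σ t = σ' t) : alexAngleRays ρ σ = alexAngleRays ρ' σ' := by
  apply le_antisymm
  · refine le_alexAngleRays fun s t hs ht => ?_
    rw [← h 0 le_rfl, ← h s hs.le, ← h' t ht.le]
    exact alexAngleRays_le _ _ hs ht
  · refine le_alexAngleRays fun s t hs ht => ?_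
    rw [h 0 le_rfl, h s hs.le, h' t ht.le]
    exact alexAngleRays_le _ _ hs ht

/-- The angle between two rays with the same origin is at most their angle at infinity. -/
theorem alexAngleRays_le_arccos_ip {p : X} {r q : ConeRay p} (hr : r.speed = 1) (hq : q.speed = 1) :
    alexAngleRays r.toFun q.toFun ≤ Real.arccos (ip r q) := by
  refine (alexAngleRays_le _ _ one_pos one_pos).trans ?_
  have h := cmpAngle_rays (ρ := r.toRay hr) (σ := q.toRay hq)
    ((r.toRay_zero hr).trans (q.toRay_zero hq).symm) one_pos one_pos
  simp only [toRay_toFun] at h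
  rw [h]
  refine Real.arccos_le_arccos ?_
  have h1 := pow_le_pow_left₀ dist_nonneg (dist_apply_le r q zero_le_one) 2
  rw [one_mul] at h1
  rw [ip, hr, hq]
  linarith

variable [CAT0Space X]

theorem bus_ge_of_cone {ρ σ : GeodesicRay X} (h : ρ.toFun 0 = σ.toFun 0) {T : ℝ} (hT : 0 < T) :
    -(T * (1 - (dist (ρ.toFun T) (σ.toFun T) / T) ^ 2 / 2)) ≤ σ.bus (ρ.toFun T) := by
  refine ge_of_tendsto (σ.tendsto_bus _) ?_
  filter_upwards [eventually_ge_atTop ⌈T⌉₊] with n hn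
  have hn' := Nat.ceil_le.1 hn
  have hn0 := hT.trans_le hn'
  have h1 := σ.comparison_monotone (ρ.toFun T) hT hn'
  rw [← h, ρ.dist_zero hT.le, dist_comm (σ.toFun T)] at h1
  set d := dist (ρ.toFun T) (σ.toFun T)
  set D := dist (σ.toFun n) (ρ.toFun T)
  have h2 : (T ^ 2 + T ^ 2 - d ^ 2) / T = 2 * (T * (1 - (d / T) ^ 2 / 2)) := by
    field_simp; ring
  rw [h2, div_le_iff₀ hn0] at h1
  set c := 1 - (d / T) ^ 2 / 2
  have hd : d ≤ 2 * T := by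
    have := dist_triangle_left (ρ.toFun T) (σ.toFun T) (ρ.toFun 0)
    rw [ρ.dist_zero hT.le, h, σ.dist_zero hT.le] at this
    linarith
  have hc1 : c ≤ 1 := by simp only [c]; nlinarith [sq_nonneg (d / T)]
  have hc2 : -1 ≤ c := by
    have h3 : d / T ≤ 2 := by rwa [div_le_iff₀ hT]
    have h4 : 0 ≤ d / T := div_nonneg dist_nonneg hT.le
    simp only [c]; nlinarith
  have h5 : (n - T * c) ^ 2 ≤ D ^ 2 := by
    have : (T * c) ^ 2 ≤ T ^ 2 := by
      rw [mul_pow]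
      have : c ^ 2 ≤ 1 := by nlinarith
      nlinarith [sq_nonneg T]
    nlinarith
  have := (abs_le_of_sq_le_sq' h5 dist_nonneg).2
  linarith

/-- Far along the ray to `ξ`, the angle of the rays to `ξ` and `η` is almost the Tits angle. -/
theorem arccos_le_alexAngleRays {p : X} {ρ σ τ : GeodesicRay X} (hρ : ρ.toFun 0 = p)
    (hσ : σ.toFun 0 = p) {T : ℝ} (hT : 0 < T) (hτ : τ.toFun 0 = ρ.toFun T) (hτσ : τ.Asymp σ) :
    Real.arccos (1 - (dist (ρ.toFun T) (σ.toFun T) / T) ^ 2 / 2) ≤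
      alexAngleRays (ρ.shift hT.le).toFun τ.toFun := by
  set c := 1 - (dist (ρ.toFun T) (σ.toFun T) / T) ^ 2 / 2
  have hfT : -(T * c) ≤ σ.bus (ρ.toFun T) := bus_ge_of_cone (hρ.trans hσ.symm) hT
  set κ := -σ.bus (ρ.toFun T) / T with hκ
  have hκT : σ.bus (ρ.toFun T) = -(T * κ) := by rw [hκ]; field_simp
  have hκc : κ ≤ c := by
    rw [hκ, div_le_iff₀ hT]; linarith
  refine (Real.arccos_le_arccos hκc).trans ?_
  have h0 : (ρ.shift hT.le).toFun 0 = τ.toFun 0 := by rw [hτ, ρ.shift_toFun, add_zero]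
  refine le_alexAngleRays fun s t hs ht => ?_
  rw [cmpAngle_rays h0 hs ht]
  refine Real.arccos_le_arccos ?_
  set z := τ.toFun t
  have hbz : σ.bus z = -(T * κ) - t := by
    rw [σ.bus_of_asymp τ hτσ ht.le, hτ, hκT]
  have hdist : ∀ s, 0 < s → t - s * κ ≤ dist ((ρ.shift hT.le).toFun s) z := by
    intro s hs
    have h1 := σ.bus_le_add (ρ.toFun (T + s)) z
    have hTs : 0 < T + s := by positivity
    have h2 := σ.bus_convex (ρ.isGeodesicSeg hTs.le) (t := T / (T + s))
      ⟨by positivity, by rw [div_le_one hTs]; linarith⟩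
    simp only [div_mul_cancel₀ T hTs.ne', hρ, ← hσ, σ.bus_self le_rfl] at h2
    rw [neg_zero, mul_zero, zero_add, hκT, div_mul_eq_mul_div, le_div_iff₀ hTs] at h2
    have h3 : -((T + s) * κ) ≤ σ.bus (ρ.toFun (T + s)) := by
      refine le_of_mul_le_mul_left (le_of_eq_of_le ?_ h2) hT
      ring
    rw [hbz, dist_comm] at h1
    rw [ρ.shift_toFun]
    linarith
  have hdz : dist ((ρ.shift hT.le).toFun 0) z = t := by rw [h0, τ.dist_zero ht.le]
  have hmain : (s ^ 2 + t ^ 2 - dist ((ρ.shift hT.le).toFun s) z ^ 2) / s ≤ 2 * t * κ := by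
    have hlim : Tendsto (fun e : ℝ => e * (1 - κ ^ 2) + 2 * t * κ) (𝓝[>] 0)
        (𝓝 (0 * (1 - κ ^ 2) + 2 * t * κ)) :=
      (Continuous.tendsto (by fun_prop) 0).mono_left nhdsWithin_le_nhds
    rw [zero_mul, zero_add] at hlim
    refine ge_of_tendsto hlim ?_
    have hev : ∀ᶠ e : ℝ in 𝓝[>] 0, 0 < t - e * κ := by
      have : Tendsto (fun e : ℝ => t - e * κ) (𝓝[>] 0) (𝓝 (t - 0 * κ)) :=
        (Continuous.tendsto (by fun_prop) 0).mono_left nhdsWithin_le_nhds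
      rw [zero_mul, sub_zero] at this
      exact this.eventually_const_lt ht
    filter_upwards [hev, Ioc_mem_nhdsGT hs] with e he hes
    have h1 := (ρ.shift hT.le).comparison_monotone z hes.1 hes.2
    rw [hdz] at h1
    refine h1.trans ?_
    rw [div_le_iff₀ hes.1]
    have h2 := pow_le_pow_left₀ he.le (hdist e hes.1) 2
    nlinarith
  rw [div_le_iff₀ hs] at hmain
  rw [div_le_iff₀ (by positivity)]
  linarith

/-- The Tits angle is the angle in the cone of rays from any base point. -/
theorem titsAngle_toRay [ProperSpace X] {p : X} {r q : ConeRay p} (hr : r.speed = 1)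
    (hq : q.speed = 1) :
    titsAngle (r.toRay hr).cls (q.toRay hq).cls = Real.arccos (ip r q) := by
  apply le_antisymm
  · refine csSup_le ⟨_, r.toRay hr, q.toRay hq, (r.toRay_zero hr).trans (q.toRay_zero hq).symm,
      rfl, rfl, rfl⟩ ?_
    rintro _ ⟨ρ, σ, h0, hρ, hσ, rfl⟩
    have h1 := alexAngleRays_le_arccos_ip (ρ.speed_toCone h0) (σ.speed_toCone rfl)
    rw [ip_eq_of_cls_eq (ρ.speed_toCone h0) (σ.speed_toCone rfl) hr hq
      ((cls_toRay_toCone ρ h0).trans hρ) ((cls_toRay_toCone σ rfl).trans hσ)] at h1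
    refine le_of_eq_of_le (alexAngleRays_congr (fun t ht => ?_) fun t ht => ?_) h1
    · exact (ρ.toCone_toFun h0 ht).symm
    · exact (σ.toCone_toFun rfl ht).symm
  · have hlim : Tendsto (fun t : ℝ => Real.arccos (1 - quot r q t ^ 2 / 2)) atTop
        (𝓝 (Real.arccos (ip r q))) := by
      have h1 : ip r q = 1 - dist r q ^ 2 / 2 := by rw [ip, hr, hq]; ring
      rw [h1]
      exact (Real.continuous_arccos.tendsto _).comp
        ((((tendsto_quot r q).pow 2).div_const 2).const_sub 1)
    refine le_of_tendsto hlim ?_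
    filter_upwards [eventually_gt_atTop 0] with T hT
    obtain ⟨τ, hτ0, hτ⟩ := (q.toRay hq).exists_asymp (r.toFun T)
    refine (arccos_le_alexAngleRays (ρ := r.toRay hr) (r.toRay_zero hr) (q.toRay_zero hq) hT
      hτ0 hτ).trans ?_
    refine le_csSup (bddAbove_titsAngle _ _) ⟨(r.toRay hr).shift hT.le, τ, ?_, ?_, ?_, rfl⟩
    · rw [hτ0, GeodesicRay.shift_toFun, add_zero, toRay_toFun]
    · exact GeodesicRay.cls_eq_iff.2 (GeodesicRay.asymp_shift _ _)
    · exact GeodesicRay.cls_eq_iff.2 hτ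

end TitsAngle

theorem GeoConvex.image_isometryEquiv [MetricSpace X] {K : Set X} (h : GeoConvex K) (g : X ≃ᵢ X) :
    GeoConvex (g '' K) := by
  rintro _ ⟨x, hx, rfl⟩ _ ⟨y, hy, rfl⟩ γ hγ t ht
  have h1 := hγ.comp_isometry g.symm.isometry
  simp only [IsometryEquiv.symm_apply_apply] at h1
  exact ⟨_, h x hx y hy _ h1 t ht, by simp⟩

theorem dist_iterate_le [MetricSpace X] (g : X ≃ᵢ X) (p : X) (m n : ℕ) :
    dist ((g ^ m) p) ((g ^ (m + n)) p) = dist p ((g ^ n) p) := by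
  rw [pow_add]; exact (g ^ m).isometry.dist_eq _ _

section NormalStructure
variable [MetricSpace X] [CAT0Space X] [ProperSpace X]

theorem infDist_geodesic_le {K : Set X} (hK : IsClosed K) (hconv : GeoConvex K) (hne : K.Nonempty)
    {x y : X} {γ : ℝ → X} (h : IsGeodesicSeg x y γ) {t : ℝ} (ht : t ∈ Set.Icc (0:ℝ) 1) :
    infDist (γ t) K ≤ (1 - t) * infDist x K + t * infDist y K := by
  obtain ⟨x', hx', hxd⟩ := hK.exists_infDist_eq_dist hne x
  obtain ⟨y', hy', hyd⟩ := hK.exists_infDist_eq_dist hne y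
  rw [hxd, hyd]
  exact (infDist_le_dist_of_mem (hconv _ hx' _ hy' _ (geoSeg_spec x' y') _ ht)).trans
    (h.dist_le (geoSeg_spec x' y') ht)

/-- In a minimal proper CAT(0) space, an invariant family of closed convex subsets meeting a common
ball is reduced to the whole space. -/
theorem eq_univ_of_invariant_family (hmin : MinimalSubgroupAction (⊤ : Subgroup (X ≃ᵢ X)))
    {F : Set (Set X)} (hclosed : ∀ K ∈ F, IsClosed K) (hconv : ∀ K ∈ F, GeoConvex K)
    (hne : ∀ K ∈ F, K.Nonempty) (hinv : ∀ (g : X ≃ᵢ X), ∀ K ∈ F, g '' K ∈ F) {x₀ : X} {R : ℝ}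
    (hR : ∀ K ∈ F, infDist x₀ K ≤ R) {K₀ : Set X} (hK₀ : K₀ ∈ F) : K₀ = univ := by
  have : Nonempty F := ⟨⟨K₀, hK₀⟩⟩
  let f : X → ℝ := fun x => ⨆ K : F, infDist x (K : Set X)
  have hbdd : ∀ x, BddAbove (range fun K : F => infDist x (K : Set X)) := fun x =>
    ⟨R + dist x x₀, by
      rintro _ ⟨K, rfl⟩
      exact infDist_le_infDist_add_dist.trans (by linarith [hR K K.2])⟩
  have hle : ∀ x, ∀ K ∈ F, infDist x K ≤ f x := fun x K hK => le_ciSup (hbdd x) ⟨K, hK⟩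
  have hlip : LipschitzWith 1 f := LipschitzWith.of_le_add fun x y =>
    ciSup_le fun K => infDist_le_infDist_add_dist.trans (by linarith [hle y K K.2])
  have hfg : ∀ (g : X ≃ᵢ X) x, f (g x) ≤ f x := fun g x => ciSup_le fun K => by
    have h1 := hle x _ (hinv g.symm K K.2)
    rwa [← infDist_image g.isometry, ← image_comp, show (g ∘ g.symm : X → X) = id from
      funext fun x => by simp, image_id] at h1
  have hconst : ∀ x y, f x ≤ f y := by
    intro x y
    have := hmin {z | f z ≤ f y} ⟨y, le_refl (f y)⟩
      (isClosed_le hlip.continuous continuous_const)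
      (fun a ha b hb γ hγ t ht => by
        replace ha : f a ≤ f y := ha
        replace hb : f b ≤ f y := hb
        change (⨆ K : F, infDist (γ t) (K : Set X)) ≤ f y
        refine ciSup_le fun K => ?_
        refine (infDist_geodesic_le (hclosed K K.2) (hconv K K.2) (hne K K.2) hγ ht).trans ?_
        have h1 := (hle a K K.2).trans ha
        have h2 := (hle b K K.2).trans hb
        have h3 := ht.1
        have h4 := ht.2
        nlinarith)
      (fun g _ z hz => (hfg g z).trans hz)
    exact (this.symm ▸ mem_univ x : x ∈ {z | f z ≤ f y})
  set c := f x₀ with hc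
  have hlec : ∀ x, ∀ K ∈ F, infDist x K ≤ c := fun x K hK => (hle x K hK).trans (hconst _ _)
  rcases le_or_gt c 0 with hc0 | hc0
  · refine eq_univ_of_forall fun x => ?_
    rw [(hclosed _ hK₀).mem_iff_infDist_zero (hne _ hK₀)]
    exact le_antisymm ((hlec x _ hK₀).trans hc0) infDist_nonneg
  exfalso
  obtain ⟨S, -, hSf, hScov⟩ := (isCompact_closedBall x₀ R).finite_cover_balls
    (e := c / 2) (by positivity)
  have hbary : ∀ S : Finset X, ∃ m : X, ∃ w : ℝ, 0 < w ∧ w ≤ 1 ∧ ∀ K ∈ F, ∀ s ∈ S,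
      infDist m K ≤ (1 - w) * c + w * infDist s K := by
    classical
    intro S
    induction S using Finset.induction_on with
    | empty => exact ⟨x₀, 1, one_pos, le_rfl, by simp⟩
    | insert a S _ ih =>
      obtain ⟨m, w, hw0, hw1, h⟩ := ih
      refine ⟨geoSeg m a (1 / 2), w / 2, by positivity, by linarith, fun K hK s hs => ?_⟩
      refine (infDist_geodesic_le (hclosed K hK) (hconv K hK) (hne K hK) (geoSeg_spec m a)
        (by norm_num)).trans ?_
      have ha := hlec a K hK
      rcases Finset.mem_insert.1 hs with rfl | hs
      · have hm := hlec m K hK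
        nlinarith
      · have := h K hK s hs
        linarith
  obtain ⟨m, w, hw0, hw1, hm⟩ := hbary hSf.toFinset
  have h1 : c - w * (c / 2) < f m := by
    have := hconst x₀ m
    have : 0 < w * (c / 2) := by positivity
    linarith
  obtain ⟨⟨K, hK⟩, hKm⟩ := exists_lt_of_lt_ciSup h1
  obtain ⟨y, hyK, hyd⟩ := (hclosed K hK).exists_infDist_eq_dist (hne K hK) x₀
  have hyR : y ∈ closedBall x₀ R := by
    rw [mem_closedBall, dist_comm, ← hyd]; exact hR K hK
  obtain ⟨s, hsS, hys⟩ := mem_iUnion₂.1 (hScov hyR)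
  rw [mem_ball, dist_comm] at hys
  have h2 := hm K hK s (by simpa using hsS)
  have h3 : infDist s K < c / 2 := (infDist_le_dist_of_mem hyK).trans_lt hys
  have h4 := mul_lt_mul_of_pos_left h3 hw0
  simp only at hKm
  linarith

end NormalStructure

section Limits
variable [MetricSpace X] [CAT0Space X] [ProperSpace X]

theorem exists_limit_ray (p : X) (z : ℕ → X) (hz : Tendsto (fun n => dist p (z n)) atTop atTop) :
    ∃ ρ : GeodesicRay X, ρ.toFun 0 = p ∧ ∀ t, 0 ≤ t →
      Tendsto (fun n => geoSeg p (z n) (t / dist p (z n))) (hyperfilter ℕ : Filter ℕ)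
        (𝓝 (ρ.toFun t)) := by
  have hquot : ∀ t : ℝ, 0 ≤ t → ∀ᶠ n : ℕ in (hyperfilter ℕ : Filter ℕ),
      0 < dist p (z n) ∧ t / dist p (z n) ∈ Set.Icc (0:ℝ) 1 := by
    intro t ht
    have h : ∀ᶠ n : ℕ in atTop, 0 < dist p (z n) ∧ t / dist p (z n) ∈ Set.Icc (0:ℝ) 1 := by
      filter_upwards [hz.eventually_gt_atTop 0, hz.eventually_ge_atTop t] with n hn hn'
      exact ⟨hn, by positivity, by rwa [div_le_one hn]⟩
    exact Nat.hyperfilter_le_atTop h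
  obtain ⟨f, b, hb, hf0, hf, hfd⟩ := exists_ultralimit_ray p
    (fun n t => geoSeg p (z n) (t / dist p (z n))) (fun _ => 1) 1 (fun _ => by simp)
    (fun n => by simp [(geoSeg_spec p (z n)).1]) (fun s hs t ht => by
      filter_upwards [hquot s hs, hquot t ht] with n hsn htn
      rw [(geoSeg_spec p (z n)).2.2 _ hsn.2 _ htn.2, ← sub_div, abs_div, abs_of_pos hsn.1,
        div_mul_cancel₀ _ hsn.1.ne', one_mul])
  obtain rfl : 1 = b := tendsto_nhds_unique tendsto_const_nhds hb
  exact ⟨⟨f, fun s hs t ht => by rw [hfd s hs t ht, one_mul]⟩, hf0 0 le_rfl, hf⟩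

theorem exists_seq_dist_tendsto (hmin : MinimalSubgroupAction (⊤ : Subgroup (X ≃ᵢ X)))
    (hX : ∃ x y : X, x ≠ y) (p : X) : ∃ z : ℕ → X, Tendsto (fun n => dist p (z n)) atTop atTop := by
  have h : ∀ n : ℕ, ∃ z, (n:ℝ) ≤ dist p z := by
    by_contra! h
    obtain ⟨n, hn⟩ := h
    have h1 : ({p} : Set X) = univ := eq_univ_of_invariant_family hmin
      (F := range fun x : X => ({x} : Set X)) (by rintro _ ⟨x, rfl⟩; exact isClosed_singleton)
      (by
        rintro _ ⟨x, rfl⟩ a ha b hb γ hγ t ht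
        obtain rfl : a = x := ha
        obtain rfl : b = a := hb
        have := hγ.dist_left ht
        rw [dist_self, mul_zero] at this
        exact (dist_eq_zero.1 this).symm)
      (by rintro _ ⟨x, rfl⟩; exact singleton_nonempty x)
      (by rintro g _ ⟨x, rfl⟩; exact ⟨g x, by simp⟩) (x₀ := p) (R := n)
      (by rintro _ ⟨x, rfl⟩; rw [infDist_singleton]; exact (hn x).le) ⟨p, rfl⟩
    obtain ⟨x, y, hxy⟩ := hX
    have hx : x ∈ ({p} : Set X) := h1 ▸ mem_univ x
    have hy : y ∈ ({p} : Set X) := h1 ▸ mem_univ y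
    exact hxy (hx.trans hy.symm)
  choose z hz using h
  exact ⟨z, tendsto_atTop_mono hz tendsto_natCast_atTop_atTop⟩

theorem nonempty_boundary (hmin : MinimalSubgroupAction (⊤ : Subgroup (X ≃ᵢ X)))
    (hX : ∃ x y : X, x ≠ y) : Nonempty (Boundary X) := by
  obtain ⟨p, -⟩ := id hX
  obtain ⟨z, hz⟩ := exists_seq_dist_tendsto hmin hX p
  obtain ⟨ρ, -⟩ := exists_limit_ray p z hz
  exact ⟨ρ.cls⟩

/-- An isometry which increases a horofunction moves points in a direction along which that
horofunction is positive (after Karlsson and Margulis). -/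
theorem exists_ray_pos_of_isometry (g : X ≃ᵢ X) (b : X → ℝ) (hb : ∀ y z, b y ≤ b z + dist z y)
    {β : ℝ} (hβ : 0 < β) (hg : ∀ y, b (g y) = b y + β) {p : X} (hp : b p = 0) :
    ∃ ρ : GeodesicRay X, ρ.toFun 0 = p ∧ ∃ t, 0 ≤ t ∧ 0 < b (ρ.toFun t) := by
  have hbg : ∀ n : ℕ, b ((g ^ n) p) = n * β := by
    intro n
    induction n with
    | zero => simpa using hp
    | succ n ih =>
      rw [pow_succ', show (g * g ^ n) p = g ((g ^ n) p) from rfl, hg, ih]; push_cast; ring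
  let a : ℕ → ℝ := fun n => dist p ((g ^ n) p)
  have hasub : Subadditive a := fun m n => by
    refine (dist_triangle _ ((g ^ m) p) _).trans ?_
    rw [dist_iterate_le]
  have haβ : ∀ n : ℕ, n * β ≤ a n := fun n => by
    have := hb ((g ^ n) p) p
    rw [hbg, hp] at this
    linarith
  have habdd : BddBelow (range fun n => a n / n) := ⟨0, by
    rintro _ ⟨n, rfl⟩; exact div_nonneg dist_nonneg n.cast_nonneg⟩
  set L := hasub.lim with hL
  have hLtend := hasub.tendsto_lim habdd
  have hLβ : β ≤ L := by
    refine ge_of_tendsto hLtend ?_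
    filter_upwards [eventually_gt_atTop 0] with n hn
    have hn' : (0:ℝ) < n := by exact_mod_cast hn
    rw [le_div_iff₀ hn', mul_comm]
    exact haβ n
  have hL0 : 0 < L := hβ.trans_le hLβ
  have haL : ∀ n : ℕ, n * L ≤ a n := fun n => by
    rcases Nat.eq_zero_or_pos n with rfl | hn
    · simp [a]
    have hn' : (0:ℝ) < n := by exact_mod_cast hn
    have := hasub.lim_le_div habdd hn.ne'
    rwa [le_div_iff₀ hn', mul_comm] at this
  set ε := β ^ 2 / (16 * L) with hε
  have hε0 : 0 < ε := by positivity
  have hεL : 16 * (L * ε) = β ^ 2 := by rw [hε]; field_simp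
  have hεlt : ε < L := by nlinarith
  obtain ⟨K, hK0, hK⟩ : ∃ K : ℕ, 0 < K ∧ a K ≤ (L + ε) * K := by
    obtain ⟨K, h1, h2⟩ := ((hLtend.eventually_lt_const (lt_add_of_pos_right L hε0)).and
      (eventually_gt_atTop 0)).exists
    have h2' : (0:ℝ) < K := by exact_mod_cast h2
    rw [div_lt_iff₀ h2'] at h1
    exact ⟨K, h2, h1.le⟩
  have hK0' : (0:ℝ) < K := by exact_mod_cast hK0
  set d := (L - ε) * K with hd
  have hd0 : 0 < d := mul_pos (sub_pos.2 hεlt) hK0'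
  have hfreq : ∀ N : ℕ, ∃ n ≥ N, a n ≤ a (n + K) - d := by
    intro N
    by_contra! hcon
    have h1 : ∀ j : ℕ, a (N + j * K) ≤ a N + j * d := by
      intro j
      induction j with
      | zero => simp
      | succ j ih =>
        have h2 := hcon (N + j * K) (by omega)
        rw [show N + (j + 1) * K = N + j * K + K by ring]
        push_cast
        linarith
    obtain ⟨j, hj⟩ := exists_nat_gt (a N / (ε * K))
    rw [div_lt_iff₀ (by positivity)] at hj
    have h3 := haL (N + j * K)
    have h4 := h1 j
    push_cast at h3
    have h5 : 0 ≤ (N:ℝ) * L := by positivity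
    rw [hd] at h4
    nlinarith
  choose n hn hna using hfreq
  let z : ℕ → X := fun j => (g ^ (n j + K)) p
  have hz : Tendsto (fun j => dist p (z j)) atTop atTop := by
    refine tendsto_atTop_mono (fun j => ?_) (tendsto_natCast_atTop_atTop.atTop_mul_const hβ)
    refine le_trans ?_ (haβ (n j + K))
    have : (j:ℝ) ≤ ((n j + K : ℕ) : ℝ) := by exact_mod_cast (hn j).trans (Nat.le_add_right _ _)
    exact mul_le_mul_of_nonneg_right this hβ.le
  obtain ⟨ρ, hρ0, hρ⟩ := exists_limit_ray p z hz
  refine ⟨ρ, hρ0, d, hd0.le, ?_⟩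
  have hbcont : Continuous b := by
    refine (LipschitzWith.of_le_add (f := b) fun x y => ?_).continuous
    rw [dist_comm]; exact hb x y
  have hlow : ∀ j, K * β / 2 ≤ b (geoSeg p (z j) (d / dist p (z j))) := by
    intro j
    set A := dist p (z j) with hA
    have hA' : A = a (n j + K) := rfl
    have hAd : d ≤ A := by
      have := hna j
      have h0 : 0 ≤ a (n j) := dist_nonneg
      linarith
    have hA0 : 0 < A := hd0.trans_le hAd
    set s := d / A with hs
    have hsA : s * A = d := div_mul_cancel₀ d hA0.ne'
    have hs01 : s ∈ Set.Icc (0:ℝ) 1 := ⟨by positivity, by rwa [div_le_one hA0]⟩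
    have h1 := CAT0Space.comparison ((g ^ K) p) _ _ _ (geoSeg_spec p (z j)) s hs01
    have h2 : dist ((g ^ K) p) (z j) = a (n j) := by
      simp only [z, add_comm (n j) K]
      exact dist_iterate_le g p K (n j)
    rw [h2, dist_comm _ p, ← hA] at h1
    have h3 : dist p ((g ^ K) p) ^ 2 ≤ ((L + ε) * K) ^ 2 := pow_le_pow_left₀ dist_nonneg hK 2
    have h4 : a (n j) ^ 2 ≤ (A - d) ^ 2 := pow_le_pow_left₀ dist_nonneg (hna j) 2
    have h5 : dist ((g ^ K) p) (geoSeg p (z j) s) ^ 2 ≤ (1 - s) * (((L + ε) * K) ^ 2 - d ^ 2) := by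
      have h6 := mul_le_mul_of_nonneg_left h3 (sub_nonneg.2 hs01.2)
      have h7 := mul_le_mul_of_nonneg_left h4 hs01.1
      rw [← hsA] at h7 ⊢
      nlinarith
    have h8 : ((L + ε) * K) ^ 2 - d ^ 2 = (K * β / 2) ^ 2 := by
      rw [hd]
      linear_combination (K:ℝ) ^ 2 / 4 * hεL
    rw [h8] at h5
    have h9 : dist ((g ^ K) p) (geoSeg p (z j) s) ≤ K * β / 2 := by
      refine le_of_sq_le_sq (h5.trans ?_) (by positivity)
      have := mul_nonneg hs01.1 (sq_nonneg (K * β / 2))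
      linarith
    have h10 := hb ((g ^ K) p) (geoSeg p (z j) s)
    rw [hbg, dist_comm] at h10
    linarith
  have := ge_of_tendsto' ((hbcont.tendsto _).comp (hρ d hd0.le)) hlow
  have : 0 < K * β / 2 := by positivity
  linarith

end Limits

theorem GeodesicRay.continuous_bus [MetricSpace X] (σ : GeodesicRay X) : Continuous σ.bus :=
  (LipschitzWith.of_le_add (f := σ.bus) fun x y => by
    rw [dist_comm]; exact σ.bus_le_add x y).continuous

theorem boundarySet_univ [MetricSpace X] : boundarySet (univ : Set X) = univ := by
  refine eq_univ_of_forall fun ξ => ?_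
  obtain ⟨ρ, hρ⟩ := GeodesicRay.exists_cls_eq ξ
  exact ⟨ρ, hρ, 0, fun t _ => ⟨ρ.toFun t, mem_univ _, by simp⟩⟩

namespace ConeRay
section Isometries
variable [MetricSpace X] {p p' : X}

/-- The image of a cone ray under an isometry. -/
def map (g : X ≃ᵢ X) (r : ConeRay p) : ConeRay (g p) :=
  ⟨fun t => g (r.toFun t), fun t ht => by rw [r.eq_base t ht],
    r.speed, r.speed_nonneg, fun s hs t ht => by rw [g.isometry.dist_eq, r.dist_eq hs ht]⟩

theorem dist_map (g : X ≃ᵢ X) (r q : ConeRay p) : dist (map g r) (map g q) = dist r q := by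
  have h : ∀ t, quot (map g r) (map g q) t = quot r q t := fun t => by
    rw [quot, quot]
    exact congrArg (· / t) (g.isometry.dist_eq _ _)
  rw [dist_def, dist_def, funext h]

/-- `r'` is asymptotic to the image of `r` under the isometry `g`. -/
def AsympMap (g : X ≃ᵢ X) (r : ConeRay p) (r' : ConeRay p') : Prop :=
  ∃ C : ℝ, ∀ t, 0 ≤ t → dist (r'.toFun t) (g (r.toFun t)) ≤ C

theorem AsympMap.symm {g : X ≃ᵢ X} {r : ConeRay p} {r' : ConeRay p'} (h : AsympMap g r r') :
    AsympMap g.symm r' r := by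
  obtain ⟨C, hC⟩ := h
  refine ⟨C, fun t ht => ?_⟩
  rw [← g.isometry.dist_eq, g.apply_symm_apply, dist_comm]
  exact hC t ht

variable [CAT0Space X]

theorem AsympMap.ip_eq {g : X ≃ᵢ X} {r q : ConeRay p} {r' q' : ConeRay p'} (hr : r.speed = 1)
    (hq : q.speed = 1) (hr' : r'.speed = 1) (hq' : q'.speed = 1) (h : AsympMap g r r')
    (h' : AsympMap g q q') : ip r' q' = ip r q := by
  obtain ⟨C, hC⟩ := h
  obtain ⟨C', hC'⟩ := h'
  have h1 : dist r' q' = dist (map g r) (map g q) := dist_eq_of_bounded hC hC'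
  rw [ip, ip, hr, hq, hr', hq', h1, dist_map]

variable [ProperSpace X]

theorem exists_asympMap (g : X ≃ᵢ X) {r : ConeRay p} (hr : r.speed = 1) :
    ∃ r' : ConeRay p, r'.speed = 1 ∧ AsympMap g r r' := by
  obtain ⟨r', hr', h⟩ := exists_toRay_cls_eq p (((r.toRay hr).comp g g.isometry).cls)
  exact ⟨r', hr', GeodesicRay.cls_eq_iff.1 h⟩

theorem AsympMap.mem_central {g : X ≃ᵢ X} {r r' : ConeRay p} (hr : r ∈ central p)
    (hr' : r'.speed = 1) (h : AsympMap g r r') : r' ∈ central p := by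
  refine ⟨hr', fun v' hv' => ?_⟩
  obtain ⟨v, hv, hvv⟩ := exists_asympMap g.symm hv'
  rw [h.ip_eq hr.1 hv hr' hv' hvv.symm]
  exact hr.2 v hv

/-- The circumcentre of the set of central rays is fixed by every isometry. -/
theorem asympMap_center (g : X ≃ᵢ X) {κ : ℝ} {c : ConeRay p} (hc : c ∈ central p)
    (hκ : ∀ v ∈ central p, κ ≤ ip c v)
    (huniq : ∀ c', (c' ∈ central p ∧ ∀ v ∈ central p, κ ≤ ip c' v) → c' = c) : AsympMap g c c := by
  obtain ⟨c', hc', h⟩ := exists_asympMap g hc.1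
  have : c' = c := by
    refine huniq c' ⟨h.mem_central hc hc', fun v' hv' => ?_⟩
    obtain ⟨v, hv, hvv⟩ := exists_asympMap g.symm hv'.1
    rw [h.ip_eq hc.1 hv hc' hv'.1 hvv.symm]
    exact hκ v (hvv.mem_central hv' hv)
  rwa [this] at h

end Isometries

section Central
variable [MetricSpace X] [CAT0Space X] {p : X}

theorem bus_apply_nonpos {c q : ConeRay p} (hc : c.speed = 1) (hq : q.speed = 1) (h : 0 ≤ ip c q)
    {T : ℝ} (hT : 0 ≤ T) : (c.toRay hc).bus (q.toFun T) ≤ 0 := by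
  refine le_of_tendsto_of_tendsto ((c.toRay hc).tendsto_bus _)
    (tendsto_const_div_atTop_nhds_zero_nat (T ^ 2)) ?_
  filter_upwards [eventually_gt_atTop 0] with n hn
  have hn' : (0:ℝ) < n := by exact_mod_cast hn
  have h1 := dist_apply_le (scale n c) (scale T q) zero_le_one
  rw [scale_toFun, scale_toFun, abs_of_pos hn', abs_of_nonneg hT, mul_one, mul_one, one_mul] at h1
  have h2 : dist (scale n c) (scale T q) ^ 2 ≤ n ^ 2 + T ^ 2 := by
    rw [dist_sq_eq, speed_scale hn'.le, speed_scale hT, hc, hq, ip_scale hT, ip_comm,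
      ip_scale hn'.le, ip_comm]
    have : 0 ≤ T * (n * ip c q) := by positivity
    linarith
  have h3 : dist (scale n c) (scale T q) ≤ n + T ^ 2 / n := by
    refine le_of_sq_le_sq (h2.trans ?_) (by positivity)
    have h4 : (n:ℝ) * (T ^ 2 / n) = T ^ 2 := by field_simp
    nlinarith [sq_nonneg (T ^ 2 / n), sq_nonneg T]
  rw [toRay_toFun]
  linarith

theorem bus_isometry {g : X ≃ᵢ X} {c : ConeRay p} (hc : c.speed = 1) (h : AsympMap g c c) (y : X) :
    (c.toRay hc).bus (g y) = (c.toRay hc).bus y + (c.toRay hc).bus (g p) := by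
  let σ := c.toRay hc
  let τ := σ.comp g g.isometry
  have hτ : τ.Asymp σ := by
    obtain ⟨C, hC⟩ := h
    exact ⟨C, fun t ht => by rw [dist_comm]; exact hC t ht⟩
  have h1 : τ.bus (g y) = σ.bus y := by
    simp only [GeodesicRay.bus]
    exact congrArg iInf (funext fun n => congrArg (· - (n:ℝ)) (g.isometry.dist_eq _ _))
  have h0 : τ.toFun 0 = g p := congrArg g (c.toRay_zero hc)
  have := σ.bus_eq_add τ hτ (g y)
  rw [h0, h1, add_comm] at this
  exact this

theorem central_eq_empty [ProperSpace X] (hmin : MinimalSubgroupAction (⊤ : Subgroup (X ≃ᵢ X)))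
    (hdim : (central p).Nonempty →
      ∃ c ∈ central p, ∃ κ > 0, ∀ v ∈ central p, κ ≤ ip c v) : central p = ∅ := by
  by_contra hne
  obtain ⟨c₀, hc₀, κ₀, hκ₀, h₀⟩ := hdim (nonempty_iff_ne_empty.2 hne)
  obtain ⟨κ, hκ, c, ⟨hc, hcκ⟩, huniq⟩ := exists_unique_center hc₀ hκ₀ h₀
  have hfix : ∀ g : X ≃ᵢ X, AsympMap g c c := fun g => asympMap_center g hc hcκ huniq
  set σ := c.toRay hc.1 with hσ
  have hσp : σ.bus p = 0 := by
    have := σ.bus_self le_rfl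
    rwa [c.toRay_zero, neg_zero] at this
  have hβ : ∀ g : X ≃ᵢ X, σ.bus (g p) ≤ 0 := by
    intro g
    by_contra! hg
    obtain ⟨ρ, hρ0, t, ht, hpos⟩ := exists_ray_pos_of_isometry g σ.bus σ.bus_le_add hg
      (bus_isometry hc.1 (hfix g)) hσp
    have := bus_apply_nonpos hc.1 (ρ.speed_toCone hρ0) (hc.2 _ (ρ.speed_toCone hρ0)) ht
    rw [ρ.toCone_toFun hρ0 ht] at this
    exact this.not_gt hpos
  have huniv := hmin {y | σ.bus y ≤ -1} ⟨σ.toFun 1, (σ.bus_self zero_le_one).le⟩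
    (isClosed_le σ.continuous_bus continuous_const)
    (fun x hx y hy γ hγ t ht => by
      have h1 := σ.bus_convex hγ ht
      have h2 : (1 - t) * σ.bus x ≤ (1 - t) * -1 :=
        mul_le_mul_of_nonneg_left hx (sub_nonneg.2 ht.2)
      have h3 : t * σ.bus y ≤ t * -1 := mul_le_mul_of_nonneg_left hy ht.1
      change σ.bus (γ t) ≤ -1
      linarith)
    (fun g _ x hx => by
      change σ.bus x ≤ -1 at hx
      change σ.bus (g x) ≤ -1
      rw [bus_isometry hc.1 (hfix g)]
      linarith [hβ g])
  have h0 : p ∈ {y | σ.bus y ≤ -1} := huniv ▸ mem_univ p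
  have h1 : σ.bus p ≤ -1 := h0
  linarith

/-- If the boundary had circumradius at most `π/2`, then there would be a central ray. -/
theorem lt_circumradius [ProperSpace X] (hne : Nonempty (Boundary X)) (hp : central p = ∅) :
    Real.pi / 2 <
      circumradiusIn titsAngle (Set.univ : Set (Boundary X)) (Set.univ : Set (Boundary X)) := by
  by_contra! hle
  have h : ∀ n : ℕ, ∃ w : ConeRay p, w.speed = 1 ∧ ∀ v : ConeRay p, v.speed = 1 →
      Real.cos (Real.pi / 2 + 1 / ((n:ℝ) + 1)) ≤ ip w v := by
    intro n
    have hn : (0:ℝ) < 1 / ((n:ℝ) + 1) := by positivity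
    have hn1 : 1 / ((n:ℝ) + 1) ≤ 1 := by
      rw [div_le_one (by positivity)]; linarith [(n.cast_nonneg : (0:ℝ) ≤ n)]
    obtain ⟨_, ⟨ξ, -, rfl⟩, hξ⟩ := exists_lt_of_csInf_lt
      ((univ_nonempty (α := Boundary X)).image _)
      (lt_of_le_of_lt hle (lt_add_of_pos_right _ hn))
    obtain ⟨w, hw, rfl⟩ := exists_toRay_cls_eq p ξ
    refine ⟨w, hw, fun v hv => ?_⟩
    have h1 : titsAngle (w.toRay hw).cls (v.toRay hv).cls ≤ Real.pi / 2 + 1 / ((n:ℝ) + 1) := by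
      have hbdd : BddAbove ((fun z => titsAngle (w.toRay hw).cls z) '' univ) := by
        refine ⟨Real.pi, ?_⟩
        rintro _ ⟨η, -, rfl⟩
        obtain ⟨q, hq, rfl⟩ := exists_toRay_cls_eq p η
        change titsAngle _ _ ≤ _
        rw [titsAngle_toRay]
        exact Real.arccos_le_pi _
      exact (le_csSup hbdd ⟨_, mem_univ _, rfl⟩).trans hξ.le
    rw [titsAngle_toRay] at h1
    have h2 : -1 ≤ ip w v := by
      have h3 := dist_sq_eq w v
      have h4 := dist_triangle_left w v (origin p)
      rw [dist_origin, dist_origin, hw, hv] at h4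
      rw [hw, hv] at h3
      nlinarith [dist_nonneg (x := w) (y := v)]
    rw [← Real.cos_arccos h2 (ip_le_one hw hv)]
    exact Real.cos_le_cos_of_nonneg_of_le_pi (Real.arccos_nonneg _)
      (by linarith [Real.pi_gt_three]) h1
  choose w hw hwv using h
  obtain ⟨w', hw', hlim⟩ := exists_unit_limit w hw
  have hlim0 : Tendsto (fun n : ℕ => Real.cos (Real.pi / 2 + 1 / ((n:ℝ) + 1))) atTop (𝓝 0) := by
    have h1 := (Real.continuous_cos.tendsto _).comp
      ((tendsto_one_div_add_atTop_nhds_zero_nat (𝕜 := ℝ)).const_add (Real.pi / 2))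
    rwa [add_zero, Real.cos_pi_div_two] at h1
  have : w' ∈ central p := ⟨hw', fun v hv => hlim v _ 0 hlim0 fun n => hwv n v hv⟩
  rw [hp] at this
  exact this

end Central
end ConeRay

section BoundaryMinimality
variable [MetricSpace X] [CAT0Space X] [ProperSpace X]
open ConeRay

/-- A horofunction is nonpositive at the projection of its base point to a convex set whose
boundary contains its centre. -/
theorem bus_nonpos_of_projection {K : Set X} (hK : IsClosed K) (hconv : GeoConvex K)
    (hbd : boundarySet K = univ) {x π : X} (hπ : π ∈ K) (hmin : ∀ y ∈ K, dist x π ≤ dist x y)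
    (σ : GeodesicRay X) (hσ : σ.toFun 0 = x) : σ.bus π ≤ 0 := by
  have hmem : σ.cls ∈ boundarySet K := hbd ▸ mem_univ _
  obtain ⟨ρ, hρ, C, hC⟩ := hmem
  obtain ⟨τ, hτ0, hτρ, hτK⟩ := ρ.exists_asymp_mem hK hconv hπ hC
  have hτσ : τ.Asymp σ := GeodesicRay.cls_eq_iff.1 ((GeodesicRay.cls_eq_iff.2 hτρ).trans hρ)
  have hdist : ∀ n : ℕ, (n:ℝ) ≤ dist x (τ.toFun n) := by
    intro n
    have hlim : Tendsto (fun s : ℝ => (1 - s) * (n:ℝ) ^ 2) (𝓝[>] 0) (𝓝 ((1 - 0) * (n:ℝ) ^ 2)) :=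
      (Continuous.tendsto (by fun_prop) 0).mono_left nhdsWithin_le_nhds
    rw [sub_zero, one_mul] at hlim
    refine le_of_sq_le_sq (le_of_tendsto hlim ?_) dist_nonneg
    filter_upwards [Ioc_mem_nhdsGT one_pos] with s hs
    have hs' : s ∈ Set.Icc (0:ℝ) 1 := ⟨hs.1.le, hs.2⟩
    have h1 := CAT0Space.comparison x _ _ _ (geoSeg_spec π (τ.toFun n)) s hs'
    have h2 := hmin _ (hconv _ hπ _ (hτK n n.cast_nonneg) _ (geoSeg_spec _ _) _ hs')
    have h3 := pow_le_pow_left₀ dist_nonneg h2 2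
    have h4 : dist π (τ.toFun n) = n := by rw [← hτ0, τ.dist_zero n.cast_nonneg]
    rw [h4] at h1
    refine le_of_mul_le_mul_left ?_ hs.1
    have := mul_nonneg hs.1.le (sq_nonneg (dist x π))
    linarith
  have h1 : 0 ≤ τ.bus x := ge_of_tendsto' (τ.tendsto_bus x) fun n => by
    rw [dist_comm]; linarith [hdist n]
  have h2 := σ.bus_eq_add τ hτσ x
  have h3 := σ.bus_self le_rfl
  rw [hσ, neg_zero] at h3
  rw [h3, hτ0] at h2
  linarith

theorem boundaryMinimal_of_central_eq_empty
    (hmin : MinimalSubgroupAction (⊤ : Subgroup (X ≃ᵢ X))) (hne : Nonempty (Boundary X))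
    (hcentral : ∀ p : X, central p = ∅) : BoundaryMinimal X := by
  intro Y hY hYc hYb
  rw [boundarySet_univ] at hYb
  set F : Set (Set X) := {K | IsClosed K ∧ GeoConvex K ∧ boundarySet K = univ} with hF
  have hFne : ∀ K ∈ F, K.Nonempty := by
    rintro K ⟨-, -, hK⟩
    obtain ⟨ξ⟩ := hne
    have : ξ ∈ boundarySet K := hK ▸ mem_univ _
    obtain ⟨ρ, -, C, hC⟩ := this
    obtain ⟨y, hy, -⟩ := hC 0 le_rfl
    exact ⟨y, hy⟩
  have hFinv : ∀ (g : X ≃ᵢ X), ∀ K ∈ F, g '' K ∈ F := by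
    rintro g K ⟨h1, h2, h3⟩
    refine ⟨g.toHomeomorph.isClosedMap _ h1, h2.image_isometryEquiv g,
      eq_univ_of_forall fun ξ => ?_⟩
    obtain ⟨ρ, rfl⟩ := GeodesicRay.exists_cls_eq ξ
    have : (ρ.comp g.symm g.symm.isometry).cls ∈ boundarySet K := h3 ▸ mem_univ _
    obtain ⟨σ, hσ, C, hC⟩ := this
    obtain ⟨C', hC'⟩ := GeodesicRay.cls_eq_iff.1 hσ
    refine ⟨ρ, rfl, C' + C, fun t ht => ?_⟩
    obtain ⟨y, hy, hyd⟩ := hC t ht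
    refine ⟨g y, mem_image_of_mem g hy, ?_⟩
    have h4 : dist (g (g.symm (ρ.toFun t))) (g y) = dist (g.symm (ρ.toFun t)) y :=
      g.isometry.dist_eq _ _
    rw [g.apply_symm_apply] at h4
    rw [h4]
    refine (dist_triangle_left _ _ (σ.toFun t)).trans (add_le_add (hC' t ht) hyd)
  obtain ⟨⟨ρ⟩⟩ := id hne
  set x := ρ.toFun 0
  by_cases hR : ∃ R, ∀ K ∈ F, infDist x K ≤ R
  · obtain ⟨R, hR⟩ := hR
    exact eq_univ_of_invariant_family hmin (fun K hK => hK.1) (fun K hK => hK.2.1) hFne hFinv hR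
      (show Y ∈ F from ⟨hY, hYc, hYb⟩)
  exfalso
  push Not at hR
  have h : ∀ n : ℕ, ∃ z : X, (n:ℝ) ≤ dist x z ∧
      ∀ σ : GeodesicRay X, σ.toFun 0 = x → σ.bus z ≤ 0 := by
    intro n
    obtain ⟨K, hK, hn⟩ := hR n
    obtain ⟨z, hz, hzd⟩ := hK.1.exists_infDist_eq_dist (hFne K hK) x
    refine ⟨z, hzd ▸ hn.le, bus_nonpos_of_projection hK.1 hK.2.1 hK.2.2 hz fun y hy => ?_⟩
    rw [← hzd]
    exact infDist_le_dist_of_mem hy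
  choose z hz hzb using h
  obtain ⟨ρ₀, hρ0, hlim⟩ := exists_limit_ray x z
    (tendsto_atTop_mono hz tendsto_natCast_atTop_atTop)
  have hb : ∀ σ : GeodesicRay X, σ.toFun 0 = x → ∀ t, 0 ≤ t → σ.bus (ρ₀.toFun t) ≤ 0 := by
    intro σ hσ t ht
    refine le_of_tendsto ((σ.continuous_bus.tendsto _).comp (hlim t ht)) ?_
    have hev : ∀ᶠ n : ℕ in atTop, σ.bus (geoSeg x (z n) (t / dist x (z n))) ≤ 0 := by
      filter_upwards [(tendsto_atTop_mono hz tendsto_natCast_atTop_atTop).eventually_gt_atTop 0,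
        (tendsto_atTop_mono hz tendsto_natCast_atTop_atTop).eventually_ge_atTop t] with n h0 h1
      have h2 : t / dist x (z n) ∈ Set.Icc (0:ℝ) 1 := ⟨by positivity, by rwa [div_le_one h0]⟩
      have h3 := σ.bus_convex (geoSeg_spec x (z n)) h2
      have h4 := σ.bus_self le_rfl
      rw [hσ, neg_zero] at h4
      rw [h4, mul_zero, zero_add] at h3
      exact h3.trans (mul_nonpos_of_nonneg_of_nonpos h2.1 (hzb n σ hσ))
    exact Nat.hyperfilter_le_atTop hev
  have hmem : ρ₀.toCone hρ0 ∈ central x := by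
    refine ⟨ρ₀.speed_toCone hρ0, fun v hv => ?_⟩
    have hd : dist (ρ₀.toCone hρ0) v ^ 2 ≤ 2 := by
      refine le_of_tendsto ((tendsto_quot (ρ₀.toCone hρ0) v).pow 2) ?_
      filter_upwards [eventually_gt_atTop 0] with T hT
      have h1 := bus_ge_of_cone (ρ := ρ₀) (σ := v.toRay hv) (hρ0.trans (v.toRay_zero hv).symm) hT
      have h2 := h1.trans (hb _ (v.toRay_zero hv) T hT.le)
      rw [quot, ρ₀.toCone_toFun hρ0 hT.le]
      rw [toRay_toFun] at h2
      have h3 := nonneg_of_mul_nonneg_right (neg_nonpos.1 h2) hT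
      linarith
    rw [ip, ρ₀.speed_toCone hρ0, hv]
    linarith
  rw [hcentral x] at hmem
  exact hmem

end BoundaryMinimality

namespace Sperner

/-- The sum of a cochain over the chains of vertices `x, x + e j₁, x + e j₁ + e j₂, …` of the cube
at `x`, for distinct directions `j₁, …, jₖ` in `J`. -/
def pathSum : ℕ → Finset ℕ → (ℕ → ℕ) → (List (ℕ → ℕ) → ZMod 2) → ZMod 2
  | 0, _, x, α => α [x]
  | k + 1, J, x, α => ∑ j ∈ J, pathSum k (J.erase j) (x + Pi.single j 1) fun l => α (x :: l)

/-- The coboundary of a cochain modulo 2. -/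
def coboundary (α : List (ℕ → ℕ) → ZMod 2) : List (ℕ → ℕ) → ZMod 2
  | [] => 0
  | x :: l => α l + coboundary (fun l' => α (x :: l')) l

theorem pathSum_add (k : ℕ) (J : Finset ℕ) (x : ℕ → ℕ) (α β : List (ℕ → ℕ) → ZMod 2) :
    pathSum k J x (fun l => α l + β l) = pathSum k J x α + pathSum k J x β := by
  induction k generalizing J x α β with
  | zero => rfl
  | succ k ih => simp only [pathSum, ih, Finset.sum_add_distrib]

theorem coboundary_zero (l : List (ℕ → ℕ)) : coboundary (fun _ => 0) l = 0 := by
  induction l with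
  | nil => rfl
  | cons x l ih => simp [coboundary, ih]

/-- The vertices of the face in directions `J` of the unit cube at `x`. -/
def Cell (J : Finset ℕ) (x v : ℕ → ℕ) : Prop :=
  (∀ i, x i ≤ v i ∧ v i ≤ x i + 1) ∧ ∀ i ∉ J, v i = x i

theorem pathSum_congr {k : ℕ} {J : Finset ℕ} {x : ℕ → ℕ} {α β : List (ℕ → ℕ) → ZMod 2}
    (h : ∀ l, (∀ v ∈ l, Cell J x v) → α l = β l) : pathSum k J x α = pathSum k J x β := by
  have hx : Cell J x x := ⟨fun i => ⟨le_rfl, Nat.le_succ _⟩, fun _ _ => rfl⟩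
  induction k generalizing J x α β with
  | zero => exact h _ (by simpa using hx)
  | succ k ih =>
    refine Finset.sum_congr rfl fun j hj => ih (fun l hl => h _ fun v hv => ?_)
      ⟨fun i => ⟨le_rfl, Nat.le_succ _⟩, fun _ _ => rfl⟩
    rcases List.mem_cons.1 hv with rfl | hv
    · exact hx
    · obtain ⟨h1, h2⟩ := hl v hv
      have hne : ∀ i, i ≠ j → (x + Pi.single j 1 : ℕ → ℕ) i = x i := fun i hi => by simp [hi]
      constructor
      · intro i
        by_cases hi : i = j
        · subst hi
          rw [h2 i (by simp)]
          simp
        · have := h1 i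
          rwa [hne i hi] at this
      · intro i hi
        rw [h2 i (by simp [hi]), hne i (by rintro rfl; exact hi hj)]

theorem pathSum_zero (k : ℕ) (J : Finset ℕ) (x : ℕ → ℕ) : pathSum k J x (fun _ => 0) = 0 := by
  induction k generalizing J x with
  | zero => rfl
  | succ k ih => simp [pathSum, ih]

theorem sum_erase_comm (J : Finset ℕ) (f : ℕ → ℕ → ZMod 2) :
    ∑ j ∈ J, ∑ i ∈ J.erase j, f j i = ∑ i ∈ J, ∑ j ∈ J.erase i, f j i := by
  refine Finset.sum_comm' fun j i => ?_
  simp only [Finset.mem_erase]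
  tauto

theorem sum_erase_eq_zero (J : Finset ℕ) (f : ℕ → ℕ → ZMod 2) (h : ∀ i j, f i j = f j i) :
    ∑ j ∈ J, ∑ i ∈ J.erase j, f j i = 0 := by
  induction J using Finset.induction_on with
  | empty => rfl
  | insert a J ha ih =>
    rw [Finset.sum_insert ha, Finset.erase_insert ha]
    have : ∀ j ∈ J, ∑ i ∈ (insert a J).erase j, f j i = f j a + ∑ i ∈ J.erase j, f j i := by
      intro j hj
      have hja : a ≠ j := by rintro rfl; exact ha hj
      rw [Finset.erase_insert_of_ne hja, Finset.sum_insert (by simp [ha])]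
    rw [Finset.sum_congr rfl this, Finset.sum_add_distrib, ih, add_zero,
      Finset.sum_congr rfl fun j _ => h j a, CharTwo.add_self_eq_zero]

/-- Stokes' formula on a cube. -/
theorem pathSum_coboundary (k : ℕ) (J : Finset ℕ) (hJ : J.card = k + 1) (x : ℕ → ℕ)
    (α : List (ℕ → ℕ) → ZMod 2) : pathSum (k + 1) J x (coboundary α) =
      ∑ j ∈ J, (pathSum k (J.erase j) x α + pathSum k (J.erase j) (x + Pi.single j 1) α) := by
  induction k generalizing J x α with
  | zero =>
    obtain ⟨j, rfl⟩ := Finset.card_eq_one.1 hJ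
    simp [pathSum, coboundary, add_comm]
  | succ k ih =>
    rw [pathSum]
    simp only [coboundary]
    simp only [pathSum_add, Finset.sum_add_distrib]
    rw [add_comm]
    congr 1
    have h1 : ∀ j ∈ J, pathSum (k + 1) (J.erase j) (x + Pi.single j 1)
        (fun l => coboundary (fun l' => α (x :: l')) l) =
        ∑ i ∈ J.erase j, pathSum k ((J.erase j).erase i) (x + Pi.single j 1)
          (fun l' => α (x :: l')) +
        ∑ i ∈ J.erase j, pathSum k ((J.erase j).erase i) (x + Pi.single j 1 + Pi.single i 1)
          (fun l' => α (x :: l')) := by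
      intro j hj
      rw [← Finset.sum_add_distrib]
      exact ih (J.erase j) (by rw [Finset.card_erase_of_mem hj, hJ]; rfl) _ _
    rw [Finset.sum_congr rfl h1, Finset.sum_add_distrib]
    refine (congrArg₂ (· + ·) (sum_erase_comm J _) (sum_erase_eq_zero J _ fun i j => ?_)).trans ?_
    · simp only [Finset.erase_right_comm (a := i), add_right_comm x (Pi.single i 1)]
    · refine (add_zero _).trans (Finset.sum_congr rfl fun i _ => Finset.sum_congr rfl fun j _ => ?_)
      rw [Finset.erase_right_comm]

/-- Vertices of the grid of side `N` in the directions `J` which are minimal in a cube. -/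
theorem finite_box (J : Finset ℕ) (N : ℕ) :
    {x : ℕ → ℕ | (∀ j ∈ J, x j < N) ∧ ∀ j ∉ J, x j = 0}.Finite := by
  refine Set.Finite.of_finite_image (f := fun (x : ℕ → ℕ) (j : J) => x j)
    (Set.Finite.subset (Set.Finite.pi (t := fun _ => Set.Iio N) fun _ => Set.finite_Iio N) ?_) ?_
  · rintro _ ⟨x, hx, rfl⟩ j -
    exact hx.1 j j.2
  · intro x hx y hy h
    funext j
    by_cases hj : j ∈ J
    · exact congrFun h ⟨j, hj⟩
    · rw [hx.2 j hj, hy.2 j hj]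

noncomputable def box (J : Finset ℕ) (N : ℕ) : Finset (ℕ → ℕ) := (finite_box J N).toFinset

theorem mem_box {J : Finset ℕ} {N : ℕ} {x : ℕ → ℕ} :
    x ∈ box J N ↔ (∀ j ∈ J, x j < N) ∧ ∀ j ∉ J, x j = 0 := by simp [box]

theorem sum_box {J : Finset ℕ} {N j : ℕ} (hj : j ∈ J) (f : (ℕ → ℕ) → ZMod 2) :
    ∑ x ∈ box J N, f x =
      ∑ y ∈ box (J.erase j) N, ∑ i ∈ Finset.range N, f (Function.update y j i) := by
  rw [← Finset.sum_product']
  refine Finset.sum_nbij' (fun x => (Function.update x j 0, x j))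
    (fun y => Function.update y.1 j y.2) ?_ ?_ ?_ ?_ ?_
  · intro x hx
    rw [mem_box] at hx
    refine Finset.mem_product.2 ⟨mem_box.2 ⟨fun i hi => ?_, fun i hi => ?_⟩,
      Finset.mem_range.2 (hx.1 j hj)⟩
    · rw [Finset.mem_erase] at hi
      simpa [hi.1] using hx.1 i hi.2
    · by_cases h : i = j
      · simp [h]
      · simpa [h] using hx.2 i fun h' => hi (Finset.mem_erase.2 ⟨h, h'⟩)
  · rintro ⟨y, a⟩ h
    obtain ⟨hy, ha⟩ := Finset.mem_product.1 h
    rw [mem_box] at hy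
    rw [Finset.mem_range] at ha
    refine mem_box.2 ⟨fun i hi => ?_, fun i hi => ?_⟩
    · by_cases h : i = j
      · simpa [h] using ha
      · simpa [h] using hy.1 i (Finset.mem_erase.2 ⟨h, hi⟩)
    · have h : i ≠ j := by rintro rfl; exact hi hj
      simpa [h] using hy.2 i fun h' => hi (Finset.mem_of_mem_erase h')
  · intro x _; simp
  · rintro ⟨y, a⟩ h
    obtain ⟨hy, -⟩ := Finset.mem_product.1 h
    have : y j = 0 := (mem_box.1 hy).2 j (by simp)
    simp [← this]
  · intro x _; simp

theorem sum_box_add {J : Finset ℕ} {N j : ℕ} (hj : j ∈ J) (f : (ℕ → ℕ) → ZMod 2) :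
    ∑ x ∈ box J N, (f x + f (x + Pi.single j 1)) =
      ∑ y ∈ box (J.erase j) N, (f y + f (Function.update y j N)) := by
  rw [sum_box hj]
  refine Finset.sum_congr rfl fun y hy => ?_
  have h0 : Function.update y j 0 = y := by
    rw [← (mem_box.1 hy).2 j (by simp), Function.update_eq_self]
  have hupd : ∀ i, (Function.update y j i + Pi.single j 1 : ℕ → ℕ) = Function.update y j (i + 1) := by
    intro i
    funext t
    by_cases h : t = j
    · subst h; simp
    · simp [h]
  simp only [hupd]
  clear hy
  induction N with
  | zero => simp [h0, CharTwo.add_self_eq_zero]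
  | succ N ih =>
    rw [Finset.sum_range_succ, ih]
    have := CharTwo.add_self_eq_zero (f (Function.update y j N))
    linear_combination this

section Labelling
variable (ℓ : (ℕ → ℕ) → ℕ)

/-- The indicator of the lists whose labels enumerate `S` bijectively. -/
def rainbow : Finset ℕ → List (ℕ → ℕ) → ZMod 2
  | S, [] => if S = ∅ then 1 else 0
  | S, x :: l => if ℓ x ∈ S then rainbow (S.erase (ℓ x)) l else 0

theorem rainbow_eq_zero {S : Finset ℕ} {s : ℕ} (hs : s ∈ S) {l : List (ℕ → ℕ)}
    (h : ∀ v ∈ l, ℓ v ≠ s) : rainbow ℓ S l = 0 := by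
  induction l generalizing S with
  | nil => rw [rainbow, if_neg (Finset.ne_empty_of_mem hs)]
  | cons x l ih =>
    rw [rainbow]
    split_ifs
    · exact ih (Finset.mem_erase.2 ⟨(h x (by simp)).symm, hs⟩) fun v hv => h v (by simp [hv])
    · rfl

theorem coboundary_rainbow {U S : Finset ℕ} (hSU : S ⊆ U) {l : List (ℕ → ℕ)}
    (h : ∀ v ∈ l, ℓ v ∈ U) :
    coboundary (rainbow ℓ S) l = ∑ u ∈ U \ S, rainbow ℓ (insert u S) l := by
  induction l generalizing S with
  | nil => simp [coboundary, rainbow]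
  | cons x l ih =>
    have hl : ∀ v ∈ l, ℓ v ∈ U := fun v hv => h v (by simp [hv])
    have hx : ℓ x ∈ U := h x (by simp)
    rw [coboundary]
    simp only [rainbow]
    by_cases hxS : ℓ x ∈ S
    · simp only [hxS, if_true, Finset.mem_insert, or_true]
      rw [ih ((Finset.erase_subset _ _).trans hSU) hl]
      have h1 : U \ S.erase (ℓ x) = insert (ℓ x) (U \ S) := by
        ext u
        simp only [Finset.mem_sdiff, Finset.mem_erase, Finset.mem_insert]
        by_cases hu : u = ℓ x
        · simp [hu, hx]
        · simp [hu]
      rw [h1, Finset.sum_insert (by simp [hxS]), Finset.insert_erase hxS, ← add_assoc,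
        CharTwo.add_self_eq_zero, zero_add]
      refine Finset.sum_congr rfl fun u hu => ?_
      have : u ≠ ℓ x := by rintro rfl; exact (Finset.mem_sdiff.1 hu).2 hxS
      rw [Finset.erase_insert_of_ne this]
    · simp only [hxS, if_false, coboundary_zero, add_zero, Finset.mem_insert, or_false]
      rw [Finset.sum_eq_single (ℓ x)]
      · simp [Finset.erase_insert hxS]
      · intro u _ hu
        rw [if_neg hu.symm]
      · intro hu
        exact absurd (Finset.mem_sdiff.2 ⟨hx, hxS⟩) hu

variable {ℓ}

theorem pathSum_rainbow_eq_zero {k : ℕ} {J : Finset ℕ} {x : ℕ → ℕ} {S : Finset ℕ} {s : ℕ}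
    (hs : s ∈ S) (h : ∀ v, Cell J x v → ℓ v ≠ s) : pathSum k J x (rainbow ℓ S) = 0 :=
  (pathSum_congr fun _ hl => rainbow_eq_zero ℓ hs fun v hv => h v (hl v hv)).trans
    (pathSum_zero k J x)

theorem sum_rainbow {N M : ℕ} (h : ∀ x : ℕ → ℕ, (∀ i, x i ≤ N) → ℓ x ≤ M ∧
      ∀ j, 1 ≤ j → j ≤ M → (x j = 0 → ℓ x ≠ j) ∧ (x j = N → j ≤ ℓ x)) (m : ℕ) (hm : m ≤ M) :
    ∑ x ∈ box (Finset.Icc 1 m) N,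
      pathSum m (Finset.Icc 1 m) x (rainbow ℓ (Finset.range (m + 1))) = 1 := by
  induction m with
  | zero =>
    have h1 : box (Finset.Icc 1 0) N = {0} := by
      ext x
      simp [mem_box, funext_iff]
    have h2 : ℓ 0 = 0 := by
      obtain ⟨h3, h4⟩ := h 0 (by simp)
      by_contra h5
      exact (h4 (ℓ 0) (Nat.one_le_iff_ne_zero.2 h5) h3).1 rfl rfl
    rw [h1, Finset.sum_singleton]
    simp [pathSum, rainbow, h2]
  | succ m ih =>
    have hcell : ∀ J : Finset ℕ, J ⊆ Finset.Icc 1 (m + 1) → ∀ x v : ℕ → ℕ,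
        (∀ j ∈ J, x j < N) → (∀ j ∉ J, x j ≤ N) → Cell J x v → ∀ i, v i ≤ N := by
      intro J _ x v h1 h2 hv i
      by_cases hi : i ∈ J
      · exact (hv.1 i).2.trans (h1 i hi)
      · rw [hv.2 i hi]; exact h2 i hi
    set J := Finset.Icc 1 (m + 1) with hJ
    have h1 : ∀ x ∈ box J N, pathSum (m + 1) J x (rainbow ℓ (Finset.range (m + 1 + 1))) =
        ∑ j ∈ J, (pathSum m (J.erase j) x (rainbow ℓ (Finset.range (m + 1))) +
          pathSum m (J.erase j) (x + Pi.single j 1) (rainbow ℓ (Finset.range (m + 1)))) := by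
      intro x hx
      rw [mem_box] at hx
      rw [← pathSum_coboundary _ _ (by simp [hJ])]
      refine pathSum_congr fun l hl => ?_
      rw [coboundary_rainbow ℓ (U := Finset.range (m + 1 + 1)) (by simp)]
      · have : Finset.range (m + 1 + 1) \ Finset.range (m + 1) = {m + 1} := by
          ext; simp; omega
        rw [this, Finset.sum_singleton, ← Finset.range_add_one]
      · intro v hv
        have hvc := hl v hv
        obtain ⟨h3, h4⟩ := h v (hcell J subset_rfl x v hx.1 (fun j hj => by simp [hx.2 j hj]) hvc)
        rw [Finset.mem_range]
        by_contra! h5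
        refine (h4 (ℓ v) (by omega) h3).1 ?_ rfl
        have h6 : ℓ v ∉ J := by simp [hJ]; omega
        rw [hvc.2 _ h6, hx.2 _ h6]
    rw [Finset.sum_congr rfl h1, Finset.sum_comm]
    rw [Finset.sum_congr rfl fun j hj => sum_box_add hj
      fun x => pathSum m (J.erase j) x (rainbow ℓ (Finset.range (m + 1)))]
    have hlow : ∀ j ∈ J, j ≠ m + 1 → ∀ y ∈ box (J.erase j) N,
        pathSum m (J.erase j) y (rainbow ℓ (Finset.range (m + 1))) = 0 := by
      intro j hj hjm y hy
      rw [mem_box] at hy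
      rw [hJ, Finset.mem_Icc] at hj
      refine pathSum_rainbow_eq_zero (s := j) (by simp; omega) fun v hv => ?_
      refine ((h v (hcell _ (Finset.erase_subset _ _) y v hy.1
        (fun i hi => by simp [hy.2 i hi]) hv)).2 j hj.1 (by omega)).1 ?_
      rw [hv.2 j (by simp), hy.2 j (by simp)]
    have hhigh : ∀ j ∈ J, ∀ y ∈ box (J.erase j) N,
        pathSum m (J.erase j) (Function.update y j N) (rainbow ℓ (Finset.range (m + 1))) = 0 := by
      intro j hj y hy
      rw [mem_box] at hy
      rw [hJ, Finset.mem_Icc] at hj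
      refine pathSum_rainbow_eq_zero (s := 0) (by simp) fun v hv => ?_
      have := ((h v (hcell _ (Finset.erase_subset j _) (Function.update y j N) v ?_ ?_ hv)).2 j hj.1
        (by omega)).2 ?_
      · omega
      · intro i hi
        rw [Function.update_of_ne (Finset.ne_of_mem_erase hi)]
        exact hy.1 i hi
      · intro i hi
        by_cases hij : i = j
        · simp [hij]
        · rw [Function.update_of_ne hij, hy.2 i hi]; exact Nat.zero_le _
      · rw [hv.2 j (by simp), Function.update_self]
    rw [Finset.sum_eq_single (m + 1)]
    · have h2 : J.erase (m + 1) = Finset.Icc 1 m := by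
        ext i; simp [hJ]
      rw [Finset.sum_add_distrib, Finset.sum_eq_zero (hhigh (m + 1) (by simp [hJ])), add_zero, h2]
      exact ih (by omega)
    · intro j hj hjm
      exact Finset.sum_eq_zero fun y hy => by
        rw [hlow j hj hjm y hy, hhigh j hj y hy, add_zero]
    · intro hnot
      simp [hJ] at hnot

/-- Sperner's lemma for cubes. -/
theorem exists_rainbow_cell {N M : ℕ} (h : ∀ x : ℕ → ℕ, (∀ i, x i ≤ N) → ℓ x ≤ M ∧
      ∀ j, 1 ≤ j → j ≤ M → (x j = 0 → ℓ x ≠ j) ∧ (x j = N → j ≤ ℓ x)) :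
    ∃ x ∈ box (Finset.Icc 1 M) N, ∀ s ≤ M, ∃ v, Cell (Finset.Icc 1 M) x v ∧ ℓ v = s := by
  by_contra! hcon
  have h1 := sum_rainbow h M le_rfl
  rw [Finset.sum_eq_zero] at h1
  · exact zero_ne_one h1
  intro x hx
  obtain ⟨s, hs, hsv⟩ := hcon x hx
  exact pathSum_rainbow_eq_zero (s := s) (by simp; omega) hsv

end Labelling
end Sperner

section Dimension

/-- A point of the grid of mesh `1 / N` in the cube. -/
noncomputable def gridPoint (m N : ℕ) (v : ℕ → ℕ) : Fin (m + 1) → unitInterval :=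
  fun i => projIcc 0 1 zero_le_one ((v i : ℝ) / N)

theorem dist_gridPoint_le {m N : ℕ} {v w : ℕ → ℕ} (h : ∀ i, v i ≤ w i ∧ w i ≤ v i + 1) :
    dist (gridPoint m N v) (gridPoint m N w) ≤ 1 / N := by
  refine (dist_pi_le_iff (by positivity)).2 fun i => ?_
  refine (LipschitzWith.projIcc (zero_le_one (α := ℝ))).dist_le_mul _ _ |>.trans ?_
  rw [NNReal.coe_one, one_mul, Real.dist_eq, ← sub_div, abs_div, abs_of_nonneg (N.cast_nonneg (α := ℝ))]
  refine div_le_div_of_nonneg_right ?_ N.cast_nonneg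
  have h1 : (v i : ℝ) ≤ w i := by exact_mod_cast (h i).1
  have h2 : (w i : ℝ) ≤ v i + 1 := by exact_mod_cast (h i).2
  rw [abs_le]
  constructor <;> linarith

/-- The inclusion of a finite-dimensional cube in the Hilbert cube. -/
def extendCube (m : ℕ) (q : Fin (m + 1) → unitInterval) (i : ℕ) : unitInterval :=
  if h : i < m + 1 then q ⟨i, h⟩ else 0

theorem continuous_extendCube (m : ℕ) : Continuous (extendCube m) := by
  refine continuous_pi fun i => ?_
  by_cases h : i < m + 1
  · simpa only [extendCube, dif_pos h] using continuous_apply _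
  · simpa only [extendCube, dif_neg h] using continuous_const

theorem extendCube_gridPoint {m N : ℕ} {v : ℕ → ℕ} {i : ℕ} (h : i ≤ m) :
    extendCube m (gridPoint m N v) i = projIcc 0 1 zero_le_one ((v i : ℝ) / N) := by
  rw [extendCube, dif_pos (Nat.lt_succ_of_le h), gridPoint]

variable [MetricSpace X] [CAT0Space X] [ProperSpace X]
open ConeRay

theorem continuous_cls {S : Type*} [TopologicalSpace S] {p : X} {ψ : S → ConeRay p}
    (hψ : Continuous ψ) (h : ∀ x, (ψ x).speed = 1) :
    Continuous fun x => ((ψ x).toRay (h x)).cls := by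
  refine continuous_generateFrom_iff.2 ?_
  rintro _ ⟨ξ, r, rfl⟩
  obtain ⟨w, hw, rfl⟩ := exists_toRay_cls_eq p ξ
  have hcont : Continuous fun x => Real.arccos (ip w (ψ x)) := by
    refine Real.continuous_arccos.comp ?_
    simp only [ip]
    have := continuous_speed.comp hψ
    simp only [Function.comp_def] at this
    fun_prop
  convert isOpen_lt hcont (continuous_const (y := r)) using 1
  ext x
  simp only [mem_preimage, mem_ofPred_eq, titsAngle_toRay hw (h x)]

/-- If the Tits boundary is finite-dimensional, the set of central rays has circumradius less than
`π/2`. -/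
theorem exists_center_of_finiteDim (hfd : FiniteDimTitsBoundary X) {p : X}
    (hne : (central p).Nonempty) : ∃ c ∈ central p, ∃ κ > 0, ∀ v ∈ central p, κ ≤ ip c v := by
  by_contra! hB
  obtain ⟨n, hn⟩ := hfd
  set m := n + 1 with hm
  obtain ⟨ψ, δ, hψ, hψc, hδ, hess⟩ := exists_essential_cube hne hB m
  let φ : (ℕ → unitInterval) → Boundary X := fun x => ((ψ x).toRay (hψc x).1).cls
  have hφ : Continuous φ := continuous_cls hψ fun x => (hψc x).1
  let O : ℕ → Set (Boundary X) := fun i => interior (φ '' {x | Face m i x})ᶜ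
  have hO : ∀ i x, φ x ∈ O i → ¬ Face m i x := fun i x hx hF =>
    interior_subset hx (mem_image_of_mem φ hF)
  have hcover : range φ ⊆ ⋃₀ (O '' {i | i ≤ m}) := by
    rintro _ ⟨x, rfl⟩
    obtain ⟨i, him, hi⟩ := hess (ψ x)
    refine ⟨O i, ⟨i, him, rfl⟩, mem_interior.2 ⟨{η | titsAngle (φ x) η <
      Real.arccos (1 - δ ^ 2 / 2)}, ?_, TopologicalSpace.isOpen_generateFrom_of_mem ⟨_, _, rfl⟩, ?_⟩⟩
    · rintro _ hlt ⟨y, hy, rfl⟩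
      have h1 : titsAngle (φ x) (φ y) < Real.arccos (1 - δ ^ 2 / 2) := hlt
      rw [titsAngle_toRay] at h1
      refine h1.not_ge (Real.arccos_le_arccos ?_)
      rw [ip, (hψc x).1, (hψc y).1]
      have := pow_le_pow_left₀ hδ.le (hi y hy) 2
      linarith
    · change titsAngle (φ x) (φ x) < _
      rw [titsAngle_toRay, ip_self, (hψc x).1, one_pow, Real.arccos_one, Real.arccos_pos]
      have := pow_pos hδ 2
      linarith
  obtain ⟨𝒱, h𝒱o, h𝒱c, h𝒱r, h𝒱n⟩ := hn (range φ) (isCompact_range hφ) _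
    (by rintro _ ⟨i, -, rfl⟩; exact isOpen_interior) hcover
  have hidx : ∀ V ∈ 𝒱, ∃ i ≤ m, V ⊆ O i := by
    intro V hV
    obtain ⟨_, ⟨i, hi, rfl⟩, h⟩ := h𝒱r V hV
    exact ⟨i, hi, h⟩
  choose! idx hidx hidxO using hidx
  let f : (Fin (m + 1) → unitInterval) → Boundary X := φ ∘ extendCube m
  have hf : Continuous f := hφ.comp (continuous_extendCube m)
  obtain ⟨ε, hε, hleb⟩ := lebesgue_number_lemma_of_metric (s := univ) (c := fun V : 𝒱 => f ⁻¹' V)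
    isCompact_univ (fun V => (h𝒱o V V.2).preimage hf) (fun q _ => by
      obtain ⟨V, hV, hq⟩ := h𝒱c (mem_range_self (extendCube m q))
      exact mem_iUnion.2 ⟨⟨V, hV⟩, hq⟩)
  choose V hV using fun q => hleb q (mem_univ q)
  have hmem : ∀ q, f q ∈ (V q : Set (Boundary X)) := fun q => hV q (mem_ball_self hε)
  obtain ⟨N, hN⟩ := exists_nat_one_div_lt hε
  have hN' : (1:ℝ) / ((N + 1 : ℕ) : ℝ) < ε := by exact_mod_cast hN
  have hN0 : ((N + 1 : ℕ) : ℝ) ≠ 0 := by positivity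
  let ℓ : (ℕ → ℕ) → ℕ := fun v => idx (V (gridPoint m (N + 1) v))
  have hℓ : ∀ v, ¬ Face m (ℓ v) (extendCube m (gridPoint m (N + 1) v)) := fun v =>
    hO _ _ (hidxO _ (V _).2 (hmem _))
  obtain ⟨x, -, hx⟩ := Sperner.exists_rainbow_cell (ℓ := ℓ) (N := N + 1) (M := m) fun v hv => by
    refine ⟨hidx _ (V _).2, fun j hj hjm => ⟨fun h0 hj' => hℓ v (Or.inl ⟨hj'.symm ▸ hj, ?_⟩),
      fun h1 => ?_⟩⟩
    · rw [hj', extendCube_gridPoint hjm, h0, Nat.cast_zero, zero_div]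
      exact projIcc_left _
    · by_contra! hlt
      refine hℓ v (Or.inr ⟨j, hlt, hjm, ?_⟩)
      rw [extendCube_gridPoint hjm, h1, div_self hN0]
      exact projIcc_right _
  obtain ⟨hfin, hcard⟩ := h𝒱n (f (gridPoint m (N + 1) x)) (mem_range_self _)
  have hsub : (Finset.range (m + 1) : Set ℕ) ⊆
      idx '' {W | W ∈ 𝒱 ∧ f (gridPoint m (N + 1) x) ∈ W} := by
    intro s hs
    obtain ⟨v, hv, rfl⟩ := hx s (Nat.lt_succ_iff.1 (Finset.mem_range.1 hs))
    exact ⟨_, ⟨(V (gridPoint m (N + 1) v)).2, hV _ (mem_ball.2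
      ((dist_gridPoint_le hv.1).trans_lt hN'))⟩, rfl⟩
  have h1 := (ncard_le_ncard hsub (hfin.image _)).trans ((ncard_image_le hfin).trans hcard)
  rw [ncard_coe_finset, Finset.card_range] at h1
  omega

end Dimension

/-- boundaries of minimal proper CAT(0) spaces have circumradius > π/2. -/
theorem stmt8 (X : Type u) [MetricSpace X] [ProperSpace X] [CAT0Space X]
    (hnontrivial : ∃ x y : X, x ≠ y) (hfd : FiniteDimTitsBoundary X)
    (hmin : MinimalSubgroupAction (⊤ : Subgroup (X ≃ᵢ X))) :
    Real.pi / 2 <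
      circumradiusIn titsAngle (Set.univ : Set (Boundary X)) (Set.univ : Set (Boundary X)) ∧
    BoundaryMinimal X := by
  have hcentral : ∀ p : X, ConeRay.central p = ∅ := fun p =>
    ConeRay.central_eq_empty hmin (exists_center_of_finiteDim hfd)
  have hne := nonempty_boundary hmin hnontrivial
  obtain ⟨p, -⟩ := id hnontrivial
  exact ⟨ConeRay.lt_circumradius hne (hcentral p),
    boundaryMinimal_of_central_eq_empty hmin hne hcentral⟩
end

section
/- Let X be a proper CAT(0) space, ξ ∈ ∂X, and g an isometry of X fixing ξ such that the Busemann character satisfies β_ξ(g) ≠ 0. Then g is ballistic. If moreover β_ξ(g) > 0, then the Tits angle between ξ and the attracting fixed point η_g of g is strictly greater than π/2. -/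
open Metric Set Filter

universe u v

variable {X : Type u}

open Topology

section CAT0Comparison
variable [MetricSpace X]

theorem GeodesicRay.isGeodesicSeg_s9 (σ : GeodesicRay X) {a b : ℝ} (ha : 0 ≤ a) (hab : a ≤ b) :
    IsGeodesicSeg (σ.toFun a) (σ.toFun b) (fun l => σ.toFun (a + l * (b - a))) := by
  have h0 : 0 ≤ b - a := sub_nonneg.2 hab
  refine ⟨by simp, by simp, fun s hs t ht => ?_⟩
  have h1 := mul_nonneg hs.1 h0
  have h2 := mul_nonneg ht.1 h0
  rw [σ.isom _ (by linarith) _ (by linarith), σ.isom a ha b (ha.trans hab), abs_sub_comm a b,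
    ← abs_mul]
  congr 1
  ring

/-- The four-point inequality for the diagonals of a quadrilateral in a CAT(0) space. -/
theorem CAT0Space.dist_sq_add_dist_sq_le [CAT0Space X] (y z p q : X) :
    dist y p ^ 2 + dist z q ^ 2 ≤
      dist y q ^ 2 + dist z p ^ 2 + dist y z ^ 2 + dist p q ^ 2 := by
  obtain ⟨γ, hγ⟩ := CAT0Space.exists_geodesic y p
  have hh : (1 / 2 : ℝ) ∈ Set.Icc (0:ℝ) 1 := by constructor <;> norm_num
  have h1 := CAT0Space.comparison q y p γ hγ _ hh
  have h2 := CAT0Space.comparison z y p γ hγ _ hh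
  have h3 := dist_triangle_right z q (γ (1 / 2))
  have h4 : dist z q ^ 2 ≤ (dist z (γ (1 / 2)) + dist q (γ (1 / 2))) ^ 2 :=
    pow_le_pow_left₀ dist_nonneg h3 2
  rw [dist_comm q y, dist_comm q p] at h1
  rw [dist_comm z y] at h2
  nlinarith [sq_nonneg (dist z (γ (1 / 2)) - dist q (γ (1 / 2)))]

/-- The distance to a point is convex along geodesic segments of a CAT(0) space. -/
theorem CAT0Space.dist_le_of_isGeodesicSeg [CAT0Space X] (p : X) {x y : X} {γ : ℝ → X}
    (hγ : IsGeodesicSeg x y γ) {t : ℝ} (ht : t ∈ Set.Icc (0:ℝ) 1) :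
    dist p (γ t) ≤ (1 - t) * dist p x + t * dist p y := by
  have h := CAT0Space.comparison p x y γ hγ t ht
  have h1 : |dist p x - dist p y| ≤ dist x y := by
    rw [dist_comm p x, dist_comm p y]; exact abs_dist_sub_le x y p
  have h2 : (dist p x - dist p y) ^ 2 ≤ dist x y ^ 2 := sq_le_sq' (by
    linarith [abs_le.1 h1]) (abs_le.1 h1).2
  have h3 : 0 ≤ t * (1 - t) := mul_nonneg ht.1 (by linarith [ht.2])
  have h4 : 0 ≤ (1 - t) * dist p x + t * dist p y :=
    add_nonneg (mul_nonneg (by linarith [ht.2]) dist_nonneg) (mul_nonneg ht.1 dist_nonneg)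
  refine le_of_sq_le_sq ?_ h4
  nlinarith [mul_le_mul_of_nonneg_left h2 h3]

/-- Two geodesic segments with the same endpoint converge at least as fast as in the plane. -/
theorem CAT0Space.dist_le_of_common_endpoint [CAT0Space X] {x y z : X} {γ δ : ℝ → X}
    (hγ : IsGeodesicSeg x z γ) (hδ : IsGeodesicSeg y z δ) {t : ℝ} (ht : t ∈ Set.Icc (0:ℝ) 1) :
    dist (γ t) (δ t) ≤ (1 - t) * dist x y := by
  have h1 := CAT0Space.comparison (γ t) y z δ hδ t ht
  have h2 := CAT0Space.comparison y x z γ hγ t ht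
  have h3 : dist (γ t) z = (1 - t) * dist x z := by
    have := hγ.2.2 t ht 1 (by simp)
    rw [hγ.2.1, abs_sub_comm, abs_of_nonneg (by linarith [ht.2])] at this
    exact this
  rw [dist_comm y (γ t), dist_comm y x] at h2
  rw [h3] at h1
  have ht' : 0 ≤ 1 - t := by linarith [ht.2]
  refine le_of_sq_le_sq ?_ (mul_nonneg ht' dist_nonneg)
  nlinarith [mul_le_mul_of_nonneg_left h2 ht']

end CAT0Comparison

section Busemann
variable [MetricSpace X]

theorem GeodesicRay.dist_zero_s9 (ρ : GeodesicRay X) {t : ℝ} (ht : 0 ≤ t) :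
    dist (ρ.toFun t) (ρ.toFun 0) = t := by
  rw [ρ.isom t ht 0 le_rfl, sub_zero, abs_of_nonneg ht]

theorem GeodesicRay.dist_sub_le_of_le (ρ : GeodesicRay X) (y : X) {s t : ℝ} (hs : 0 ≤ s)
    (hst : s ≤ t) : dist (ρ.toFun t) y - t ≤ dist (ρ.toFun s) y - s := by
  have h := dist_triangle (ρ.toFun t) (ρ.toFun s) y
  rw [ρ.isom t (hs.trans hst) s hs, abs_of_nonneg (by linarith)] at h
  linarith

theorem tendsto_busemann (ρ : GeodesicRay X) (y : X) :
    Tendsto (fun t : ℝ => dist (ρ.toFun t) y - t) atTop (𝓝 (busemann ρ y)) := by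
  set f : ℝ → ℝ := fun t => dist (ρ.toFun (max t 0)) y - max t 0 with hf
  have hanti : Antitone f := fun s t hst =>
    ρ.dist_sub_le_of_le y (le_max_right _ _) (max_le_max_right 0 hst)
  have hbdd : BddBelow (range f) := by
    refine ⟨-dist (ρ.toFun 0) y, ?_⟩
    rintro _ ⟨t, rfl⟩
    have h := dist_triangle_right (ρ.toFun (max t 0)) (ρ.toFun 0) y
    rw [ρ.dist_zero_s9 (le_max_right _ _)] at h
    simp only [hf]
    linarith
  have hlim := tendsto_atTop_ciInf hanti hbdd
  have he : ∀ᶠ t : ℝ in atTop, f t = dist (ρ.toFun t) y - dist (ρ.toFun t) (ρ.toFun 0) := by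
    filter_upwards [eventually_ge_atTop 0] with t ht
    simp only [hf, max_eq_left ht, ρ.dist_zero_s9 ht]
  have hlim' := hlim.congr' he
  rw [busemann, hlim'.limsup_eq]
  refine hlim.congr' ?_
  filter_upwards [eventually_ge_atTop 0] with t ht
  simp only [hf, max_eq_left ht]

theorem busemann_le (ρ : GeodesicRay X) (y : X) {s : ℝ} (hs : 0 ≤ s) :
    busemann ρ y ≤ dist (ρ.toFun s) y - s := by
  refine le_of_tendsto (tendsto_busemann ρ y) ?_
  filter_upwards [eventually_ge_atTop s] with t ht
  exact ρ.dist_sub_le_of_le y hs ht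

theorem busemann_sub_le_dist (ρ : GeodesicRay X) (y z : X) :
    busemann ρ y - busemann ρ z ≤ dist y z := by
  refine le_of_tendsto ((tendsto_busemann ρ y).sub (tendsto_busemann ρ z))
    (Eventually.of_forall fun t => ?_)
  have := dist_triangle (ρ.toFun t) z y
  rw [dist_comm z y] at this
  linarith

theorem continuous_busemann (ρ : GeodesicRay X) : Continuous (busemann ρ) := by
  refine (LipschitzWith.of_le_add fun y z => ?_).continuous
  linarith [busemann_sub_le_dist ρ y z]

theorem busemann_zero (ρ : GeodesicRay X) : busemann ρ (ρ.toFun 0) = 0 := by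
  refine tendsto_nhds_unique (tendsto_busemann ρ _) (tendsto_const_nhds.congr' ?_)
  filter_upwards [eventually_ge_atTop 0] with t ht
  rw [ρ.dist_zero_s9 ht, sub_self]

theorem busemann_comp (ρ : GeodesicRay X) (f : X → X) (hf : Isometry f) (y : X) :
    busemann (ρ.comp f hf) (f y) = busemann ρ y := by
  refine tendsto_nhds_unique (tendsto_busemann _ _) ((tendsto_busemann ρ y).congr fun t => ?_)
  simp [GeodesicRay.comp, hf.dist_eq]

theorem busemann_le_of_isGeodesicSeg [CAT0Space X] (ρ : GeodesicRay X) {x y : X} {γ : ℝ → X}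
    (hγ : IsGeodesicSeg x y γ) {t : ℝ} (ht : t ∈ Set.Icc (0:ℝ) 1) :
    busemann ρ (γ t) ≤ (1 - t) * busemann ρ x + t * busemann ρ y := by
  refine le_of_tendsto_of_tendsto' (tendsto_busemann ρ _)
    (((tendsto_busemann ρ x).const_mul (1 - t)).add ((tendsto_busemann ρ y).const_mul t))
    fun u => ?_
  linarith [CAT0Space.dist_le_of_isGeodesicSeg (ρ.toFun u) hγ ht]

theorem GeodesicRay.Asymp.busemann_sub_le [CAT0Space X] {ρ σ : GeodesicRay X}
    (h : ρ.Asymp σ) (y z : X) :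
    busemann ρ y - busemann ρ z ≤ busemann σ y - busemann σ z := by
  obtain ⟨C, hC⟩ := h
  have hy := tendsto_busemann ρ y
  have hz := tendsto_busemann ρ z
  have ky := tendsto_busemann σ y
  have kz := tendsto_busemann σ z
  have hR := (((((hz.pow 2).sub (hy.pow 2)).add (ky.pow 2)).sub (kz.pow 2)).add_const
    (dist y z ^ 2 + C ^ 2)).mul ((tendsto_inv_atTop_zero (𝕜 := ℝ)).const_mul (1 / 2))
  have := le_of_tendsto_of_tendsto ((hy.sub hz).sub (ky.sub kz)) hR (by
    filter_upwards [eventually_gt_atTop 0] with t ht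
    have h4 := CAT0Space.dist_sq_add_dist_sq_le y z (ρ.toFun t) (σ.toFun t)
    have h5 : dist (ρ.toFun t) (σ.toFun t) ^ 2 ≤ C ^ 2 :=
      pow_le_pow_left₀ dist_nonneg (hC t ht.le) 2
    rw [dist_comm y, dist_comm z (σ.toFun t), dist_comm y (σ.toFun t),
      dist_comm z (ρ.toFun t)] at h4
    rw [show (1 / 2 : ℝ) * t⁻¹ = (2 * t)⁻¹ by rw [mul_inv]; norm_num, ← div_eq_mul_inv,
      le_div_iff₀ (by positivity)]
    nlinarith)
  simp only [mul_zero] at this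
  linarith

/-- In a proper CAT(0) space, every point is the origin of a ray asymptotic to a given ray, along
which the Busemann function decreases at unit speed. -/
theorem GeodesicRay.exists_asymp_from [ProperSpace X] [CAT0Space X] (ρ : GeodesicRay X) (q : X) :
    ∃ τ : GeodesicRay X, τ.toFun 0 = q ∧ τ.Asymp ρ ∧
      ∀ s, 0 ≤ s → busemann ρ (τ.toFun s) ≤ busemann ρ q - s := by
  choose γ hγ using fun n : ℕ => CAT0Space.exists_geodesic q (ρ.toFun n)
  set L : ℕ → ℝ := fun n => dist q (ρ.toFun n) with hL
  set C : ℝ := dist q (ρ.toFun 0) with hC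
  have hLn : ∀ n : ℕ, |(n : ℝ) - L n| ≤ C := fun n => by
    have h1 := dist_triangle q (ρ.toFun 0) (ρ.toFun n)
    have h2 := dist_triangle (ρ.toFun n) q (ρ.toFun 0)
    have h3 := ρ.dist_zero_s9 (Nat.cast_nonneg (α := ℝ) n)
    rw [dist_comm (ρ.toFun 0)] at h1
    rw [dist_comm (ρ.toFun n) q] at h2
    rw [abs_le]
    constructor <;> simp only [hL, hC] <;> linarith
  have hLtop : Tendsto L atTop atTop :=
    tendsto_atTop_mono (fun n => by linarith [(abs_le.1 (hLn n)).2])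
      (tendsto_atTop_add_const_right _ (-C) tendsto_natCast_atTop_atTop)
  let U : Ultrafilter ℕ := Ultrafilter.of atTop
  have hU : (U : Filter ℕ) ≤ atTop := Ultrafilter.of_le atTop
  have hbig : ∀ s : ℝ, ∀ᶠ n in (U : Filter ℕ), s < L n := fun s =>
    hU (hLtop.eventually_gt_atTop s)
  have hmem : ∀ s n, 0 ≤ s → s < L n → s / L n ∈ Set.Icc (0:ℝ) 1 := fun s n h0 h1 =>
    ⟨div_nonneg h0 (h0.trans h1.le), div_le_one_of_le₀ h1.le (h0.trans h1.le)⟩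
  have hd : ∀ s t n, 0 ≤ s → 0 ≤ t → s < L n → t < L n →
      dist (γ n (s / L n)) (γ n (t / L n)) = |s - t| := fun s t n hs ht hs' ht' => by
    have hpos : 0 < L n := hs.trans_lt hs'
    rw [(hγ n).2.2 _ (hmem s n hs hs') _ (hmem t n ht ht'), ← sub_div, abs_div, abs_of_pos hpos]
    exact div_mul_cancel₀ _ hpos.ne'
  have hlim : ∀ s : ℝ, ∃ x : X, 0 ≤ s → Tendsto (fun n => γ n (s / L n)) U (𝓝 x) := fun s => by
    by_cases hs : 0 ≤ s
    swap
    · exact ⟨q, fun h => absurd h hs⟩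
    have hev : ∀ᶠ n in (U : Filter ℕ), γ n (s / L n) ∈ closedBall q s := by
      filter_upwards [hbig s] with n hn
      have := hd s 0 n hs le_rfl hn (hs.trans_lt hn)
      rw [zero_div, (hγ n).1, sub_zero, abs_of_nonneg hs] at this
      exact mem_closedBall.2 this.le
    obtain ⟨x, -, hx⟩ := (isCompact_closedBall q s).ultrafilter_le_nhds
      (U.map fun n => γ n (s / L n)) (le_principal_iff.2 hev)
    exact ⟨x, fun _ => hx⟩
  choose τ hτ using hlim
  refine ⟨⟨τ, fun s hs t ht => ?_⟩, ?_, ⟨2 * C, fun s hs => ?_⟩, fun s hs => ?_⟩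
  · refine tendsto_nhds_unique ((hτ s hs).dist (hτ t ht)) (tendsto_const_nhds.congr' ?_)
    filter_upwards [hbig s, hbig t] with n h1 h2
    exact (hd s t n hs ht h1 h2).symm
  · refine tendsto_nhds_unique (hτ 0 le_rfl) (tendsto_const_nhds.congr fun n => ?_)
    rw [zero_div, (hγ n).1]
  · refine le_of_tendsto ((hτ s hs).dist tendsto_const_nhds) ?_
    filter_upwards [hbig s] with n hn
    have hpos : 0 < L n := hs.trans_lt hn
    have hl := hmem s n hs hn
    have h1 := CAT0Space.dist_le_of_common_endpoint (hγ n)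
      (ρ.isGeodesicSeg_s9 le_rfl (Nat.cast_nonneg (α := ℝ) n)) hl
    simp only [zero_add, sub_zero] at h1
    have h2 := ρ.isom (s / L n * n) (mul_nonneg hl.1 (Nat.cast_nonneg n)) s hs
    have h3 : |s / L n * n - s| ≤ C := by
      rw [show s / L n * n - s = s / L n * (n - L n) by field_simp, abs_mul, abs_of_nonneg hl.1]
      exact (mul_le_mul hl.2 (hLn n) (abs_nonneg _) zero_le_one).trans_eq (one_mul C)
    have h4 := dist_triangle (γ n (s / L n)) (ρ.toFun (s / L n * n)) (ρ.toFun s)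
    have h5 : (1 - s / L n) * C ≤ C :=
      mul_le_of_le_one_left dist_nonneg (by linarith [hl.1])
    linarith
  · have hnat : Tendsto (fun n : ℕ => (n : ℝ)) U atTop := tendsto_natCast_atTop_atTop.mono_left hU
    refine le_of_tendsto_of_tendsto (((continuous_busemann ρ).tendsto _).comp (hτ s hs))
      (((tendsto_busemann ρ q).comp hnat).sub_const s) ?_
    filter_upwards [hbig s] with n hn
    have hpos : 0 < L n := hs.trans_lt hn
    have hl := hmem s n hs hn
    have h1 := (hγ n).2.2 1 (by simp) _ hl
    rw [(hγ n).2.1, abs_of_nonneg (by linarith [hl.2])] at h1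
    have h2 : (1 - s / L n) * dist q (ρ.toFun n) = L n - s := by
      change (1 - s / L n) * L n = L n - s
      field_simp
    have h3 := busemann_le ρ (γ n (s / L n)) (Nat.cast_nonneg (α := ℝ) n)
    have h4 : dist (ρ.toFun n) q = L n := dist_comm _ _
    simp only [Function.comp]
    linarith

/-- The ray obtained by starting a given ray at a later time. -/
def GeodesicRay.shift_s9 (σ : GeodesicRay X) (T : ℝ) (hT : 0 ≤ T) : GeodesicRay X :=
  ⟨fun t => σ.toFun (T + t), fun s hs t ht => by
    rw [σ.isom _ (by linarith) _ (by linarith), add_sub_add_left_eq_sub]⟩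

theorem GeodesicRay.shift_asymp (σ : GeodesicRay X) (T : ℝ) (hT : 0 ≤ T) :
    (σ.shift_s9 T hT).Asymp σ :=
  ⟨T, fun t ht => by
    simp only [GeodesicRay.shift_s9]
    rw [σ.isom _ (by linarith) _ ht, add_sub_cancel_right, abs_of_nonneg hT]⟩

end Busemann

section Angles
variable [MetricSpace X]

theorem alexAngleRays_le_pi (ρ σ : ℝ → X) : alexAngleRays ρ σ ≤ Real.pi := by
  have hbdd : BddBelow {a : ℝ | ∃ s, 0 < s ∧ ∃ t, 0 < t ∧ a = cmpAngle (ρ 0) (ρ s) (σ t)} := by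
    refine ⟨0, ?_⟩
    rintro _ ⟨s, -, t, -, rfl⟩
    exact Real.arccos_nonneg _
  exact (csInf_le hbdd ⟨1, one_pos, 1, one_pos, rfl⟩).trans (Real.arccos_le_pi _)

theorem alexAngleRays_le_titsAngle (ρ σ : GeodesicRay X) (h : ρ.toFun 0 = σ.toFun 0) :
    alexAngleRays ρ.toFun σ.toFun ≤ titsAngle ρ.cls σ.cls := by
  refine le_csSup ⟨Real.pi, ?_⟩ ⟨ρ, σ, h, rfl, rfl, rfl⟩
  rintro _ ⟨ρ', σ', -, -, -, rfl⟩
  exact alexAngleRays_le_pi _ _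

/-- First variation bound: if points of two rays with common origin are as far apart as prescribed
by a slope `c`, then the Alexandrov angle is at least `arccos (-c)`. -/
theorem arccos_neg_le_alexAngleRays [CAT0Space X] (ρ σ : GeodesicRay X)
    (h0 : ρ.toFun 0 = σ.toFun 0) {c : ℝ} (hc : 0 ≤ c)
    (h : ∀ s, 0 ≤ s → ∀ t, 0 ≤ t → s + c * t ≤ dist (ρ.toFun s) (σ.toFun t)) :
    Real.arccos (-c) ≤ alexAngleRays ρ.toFun σ.toFun := by
  refine le_csInf ⟨_, 1, one_pos, 1, one_pos, rfl⟩ ?_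
  rintro _ ⟨s, hs, t, ht, rfl⟩
  refine Real.arccos_le_arccos ?_
  have hρs : dist (ρ.toFun s) (ρ.toFun 0) = s := ρ.dist_zero_s9 hs.le
  have hσt : dist (σ.toFun t) (σ.toFun 0) = t := σ.dist_zero_s9 ht.le
  rw [dist_comm (ρ.toFun 0), hρs, dist_comm (ρ.toFun 0), h0, hσt, div_le_iff₀ (by positivity)]
  have key : ∀ l : ℝ, l ∈ Set.Ioc (0:ℝ) 1 →
      s ^ 2 + 2 * c * s * t + (1 - l) * t ^ 2 ≤ dist (ρ.toFun s) (σ.toFun t) ^ 2 := by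
    intro l hl
    have h1 := CAT0Space.comparison (ρ.toFun s) _ _ _ (σ.isGeodesicSeg_s9 le_rfl ht.le) l ⟨hl.1.le, hl.2⟩
    simp only [zero_add, sub_zero] at h1
    rw [← h0, hρs, h0, dist_comm (σ.toFun 0), hσt] at h1
    have hlt : 0 ≤ l * t := mul_nonneg hl.1.le ht.le
    have h2 := pow_le_pow_left₀ (by positivity) (h s hs.le (l * t) hlt) 2
    have h3 : 0 ≤ (c * (l * t)) ^ 2 := sq_nonneg _
    refine le_of_mul_le_mul_left ?_ hl.1
    nlinarith
  have hlim : Tendsto (fun l : ℝ => s ^ 2 + 2 * c * s * t + (1 - l) * t ^ 2) (𝓝[>] 0)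
      (𝓝 (s ^ 2 + 2 * c * s * t + (1 - 0) * t ^ 2)) :=
    Continuous.tendsto' (by fun_prop) _ _ rfl |>.mono_left nhdsWithin_le_nhds
  have := le_of_tendsto hlim (by
    filter_upwards [Ioc_mem_nhdsGT (zero_lt_one' ℝ)] with l hl using key l hl)
  linarith

/-- If the Busemann function of `ρ` takes a larger value at some point of a ray `σ` than at its
origin, then the Tits angle between the endpoints of `ρ` and `σ` is obtuse. -/
theorem pi_div_two_lt_titsAngle_of_busemann_lt [ProperSpace X] [CAT0Space X]
    (ρ σ : GeodesicRay X) {T : ℝ} (hT : 0 < T)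
    (h : busemann ρ (σ.toFun 0) < busemann ρ (σ.toFun T)) :
    Real.pi / 2 < titsAngle ρ.cls σ.cls := by
  obtain ⟨τ, hτ0, hτ, hb⟩ := ρ.exists_asymp_from (σ.toFun T)
  set c : ℝ := (busemann ρ (σ.toFun T) - busemann ρ (σ.toFun 0)) / T with hc
  have hcpos : 0 < c := div_pos (sub_pos.2 h) hT
  have hcT : c * T = busemann ρ (σ.toFun T) - busemann ρ (σ.toFun 0) := div_mul_cancel₀ _ hT.ne'
  have hslope : ∀ t, 0 ≤ t → busemann ρ (σ.toFun T) + c * t ≤ busemann ρ (σ.toFun (T + t)) := by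
    intro t ht
    have hTt : 0 < T + t := by linarith
    have h1 := busemann_le_of_isGeodesicSeg ρ (σ.isGeodesicSeg_s9 le_rfl hTt.le)
      (t := T / (T + t)) ⟨by positivity, div_le_one_of_le₀ (by linarith) hTt.le⟩
    simp only [zero_add, sub_zero] at h1
    rw [div_mul_cancel₀ _ hTt.ne', show 1 - T / (T + t) = t / (T + t) by field_simp; ring,
      div_mul_eq_mul_div, div_mul_eq_mul_div, ← add_div, le_div_iff₀ hTt] at h1
    refine le_of_mul_le_mul_left ?_ hT
    nlinarith
  have h0 : τ.toFun 0 = (σ.shift_s9 T hT.le).toFun 0 := by simp [GeodesicRay.shift_s9, hτ0]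
  have hangle := arccos_neg_le_alexAngleRays τ (σ.shift_s9 T hT.le) h0 hcpos.le (fun s hs t ht => by
    have h1 := busemann_sub_le_dist ρ (σ.toFun (T + t)) (τ.toFun s)
    rw [dist_comm] at h1
    have h2 := hb s hs
    have h3 := hslope t ht
    simp only [GeodesicRay.shift_s9]
    linarith)
  have hle := alexAngleRays_le_titsAngle τ (σ.shift_s9 T hT.le) h0
  have e1 : τ.cls = ρ.cls := Quotient.sound hτ
  have e2 : (σ.shift_s9 T hT.le).cls = σ.cls := Quotient.sound (σ.shift_asymp T hT.le)
  rw [e1, e2] at hle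
  have h4 : Real.pi / 2 < Real.arccos (-c) := by
    rw [Real.arccos_neg]
    have := Real.arccos_lt_pi_div_two.2 hcpos
    linarith
  linarith

end Angles

section Dynamics
variable [MetricSpace X]

theorem busemann_apply_of_map_cls_eq [CAT0Space X] (ρ : GeodesicRay X) (g : X ≃ᵢ X)
    (hfix : Boundary.map (⇑g) g.isometry ρ.cls = ρ.cls) (y : X) :
    busemann ρ (g y) = busemann ρ y + busemann ρ (g (ρ.toFun 0)) := by
  have hasymp : (ρ.comp g g.isometry).Asymp ρ := Quotient.exact hfix
  have h1 := hasymp.busemann_sub_le (g y) (g (ρ.toFun 0))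
  have h2 := hasymp.busemann_sub_le (g (ρ.toFun 0)) (g y)
  rw [busemann_comp, busemann_comp, busemann_zero] at h1 h2
  linarith

theorem busemann_iterate_of_map_cls_eq [CAT0Space X] (ρ : GeodesicRay X) (g : X ≃ᵢ X)
    (hfix : Boundary.map (⇑g) g.isometry ρ.cls = ρ.cls) (y : X) (n : ℕ) :
    busemann ρ ((⇑g)^[n] y) = busemann ρ y + n * busemann ρ (g (ρ.toFun 0)) := by
  induction n with
  | zero => simp
  | succ n ih =>
    rw [Function.iterate_succ_apply', busemann_apply_of_map_cls_eq ρ g hfix, ih]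
    push_cast
    ring

theorem Isometry.dist_iterate_iterate {f : X → X} (hf : Isometry f) (x : X) {k n : ℕ}
    (hkn : k ≤ n) : dist (f^[k] x) (f^[n] x) = dist x (f^[n - k] x) := by
  obtain ⟨m, rfl⟩ := Nat.exists_eq_add_of_le hkn
  have hk : Isometry f^[k] := by
    induction k with
    | zero => exact isometry_id
    | succ k ih => exact (ih (Nat.le_add_right _ _)).comp hf
  rw [Function.iterate_add_apply, hk.dist_eq, Nat.add_sub_cancel_left]

theorem Isometry.subadditive_dist_iterate {f : X → X} (hf : Isometry f) (x : X) :
    Subadditive fun n => dist x (f^[n] x) := fun m n => by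
  have h := dist_triangle x (f^[m] x) (f^[m + n] x)
  rwa [hf.dist_iterate_iterate x (Nat.le_add_right m n), Nat.add_sub_cancel_left] at h

/-- An orbit of an isometry with linear drift comes linearly close to the ray to which it
converges. -/
theorem SeqTendstoBoundary.exists_dist_lt [CAT0Space X] {f : X → X} (hf : Isometry f)
    {x : X} {σ : GeodesicRay X}
    (hσ : ∀ γ : ℕ → ℝ → X, (∀ n, IsGeodesicSeg x (f^[n] x) (γ n)) → ∀ t, 0 ≤ t →
      Tendsto (fun n => γ n (t / dist x (f^[n] x))) atTop (𝓝 (σ.toFun t)))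
    {β : ℝ} (hβ : 0 < β) (hdrift : ∀ n : ℕ, n * β ≤ dist x (f^[n] x)) :
    ∃ k : ℕ, ∃ s : ℝ, 0 < s ∧ dist (f^[k] x) (σ.toFun s) < k * β := by
  choose γ hγ using fun n : ℕ => CAT0Space.exists_geodesic x (f^[n] x)
  set a : ℕ → ℝ := fun n => dist x (f^[n] x) with ha
  have hsub : Subadditive a := hf.subadditive_dist_iterate x
  have hbdd : BddBelow (range fun n => a n / n) :=
    ⟨0, by rintro _ ⟨n, rfl⟩; exact div_nonneg dist_nonneg (Nat.cast_nonneg n)⟩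
  have hlim := hsub.tendsto_lim hbdd
  set l : ℝ := hsub.lim with hl
  have hla : ∀ n : ℕ, l * n ≤ a n := fun n => by
    rcases Nat.eq_zero_or_pos n with rfl | hn
    · simp [ha]
    · exact (le_div_iff₀ (Nat.cast_pos.2 hn)).1 (hsub.lim_le_div hbdd hn.ne')
  have hlpos : 0 < l := by
    refine hβ.trans_le (ge_of_tendsto hlim ?_)
    filter_upwards [eventually_gt_atTop 0] with n hn
    rw [le_div_iff₀ (Nat.cast_pos.2 hn), mul_comm]
    exact hdrift n
  obtain ⟨ε, hε, hεl, hεβ⟩ : ∃ ε : ℝ, 0 < ε ∧ ε < l ∧ 4 * l * ε < β ^ 2 := by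
    refine ⟨min (l / 2) (β ^ 2 / (8 * l)), by positivity,
      (min_le_left _ _).trans_lt (by linarith), ?_⟩
    calc 4 * l * min (l / 2) (β ^ 2 / (8 * l)) ≤ 4 * l * (β ^ 2 / (8 * l)) := by
          gcongr; exact min_le_right _ _
      _ = β ^ 2 / 2 := by field_simp; norm_num
      _ < β ^ 2 := by have := pow_pos hβ 2; linarith
  obtain ⟨k, hka, hk⟩ := ((hlim.eventually_lt_const (show l < l + ε by linarith)).and
    (eventually_gt_atTop 0)).exists
  have hk' : (0 : ℝ) < k := Nat.cast_pos.2 hk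
  rw [div_lt_iff₀ hk'] at hka
  set s : ℝ := (l - ε) * k with hs
  have hspos : 0 < s := mul_pos (by linarith) hk'
  refine ⟨k, s, hspos, ?_⟩
  have hctop : Tendsto (fun n : ℕ => a n - (l - ε) * n) atTop atTop :=
    tendsto_atTop_mono (fun n => by have := hla n; linarith)
      (tendsto_natCast_atTop_atTop.const_mul_atTop hε)
  have hfreq : ∃ᶠ n in atTop,
      dist (f^[k] x) (γ n (s / a n)) ≤ √(4 * l * ε) * k := by
    refine ((frequently_high_scores hctop).and_eventually (eventually_gt_atTop k)).mono ?_
    rintro n ⟨hrec, hkn⟩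
    have hkn' : (k : ℝ) < n := Nat.cast_lt.2 hkn
    have hsa : s < a n := by nlinarith [hla n]
    have hapos : 0 < a n := hspos.trans hsa
    have hr := hrec (n - k) (by omega)
    rw [Nat.cast_sub hkn.le] at hr
    have hr' : a (n - k) ≤ a n - s := by rw [hs]; linarith
    have ht0 : 0 ≤ s / a n := by positivity
    have ht1 : s / a n ≤ 1 := div_le_one_of_le₀ hsa.le hapos.le
    have h1 := CAT0Space.comparison (f^[k] x) _ _ _ (hγ n) _ ⟨ht0, ht1⟩
    rw [hf.dist_iterate_iterate x hkn.le, dist_comm (f^[k] x) x] at h1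
    change _ ≤ (1 - s / a n) * a k ^ 2 + s / a n * a (n - k) ^ 2
      - s / a n * (1 - s / a n) * a n ^ 2 at h1
    have h2 : a (n - k) ^ 2 ≤ (a n - s) ^ 2 := pow_le_pow_left₀ dist_nonneg hr' 2
    have h3 : a k ^ 2 ≤ ((l + ε) * k) ^ 2 := pow_le_pow_left₀ dist_nonneg hka.le 2
    have h4 : s / a n * (a n - s) ^ 2 - s / a n * (1 - s / a n) * a n ^ 2 =
        -(1 - s / a n) * s ^ 2 := by field_simp; ring
    have h5 := mul_le_mul_of_nonneg_left h2 ht0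
    have h6 : ((l + ε) * k) ^ 2 - s ^ 2 = 4 * l * ε * k ^ 2 := by rw [hs]; ring
    have h7 : 0 ≤ 4 * l * ε * k ^ 2 := by positivity
    refine le_of_sq_le_sq ?_ (by positivity)
    rw [mul_pow, Real.sq_sqrt (by positivity)]
    nlinarith [mul_le_mul_of_nonneg_left h3 (sub_nonneg.2 ht1), mul_nonneg ht0 h7]
  refine (le_of_tendsto_of_frequently
    (tendsto_const_nhds.dist (hσ γ hγ s hspos.le)) hfreq).trans_lt ?_
  rw [mul_comm]
  exact mul_lt_mul_of_pos_left ((Real.sqrt_lt' hβ).2 hεβ) hk'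

end Dynamics

/-- isometries with nonvanishing Busemann character are ballistic, and
the attracting fixed point is at Tits angle > π/2 from the centre when the character
is positive. -/
theorem stmt9 (X : Type u) [MetricSpace X] [ProperSpace X] [CAT0Space X]
    (ρ : GeodesicRay X) (g : X ≃ᵢ X)
    (hfix : Boundary.map (⇑g) g.isometry ρ.cls = ρ.cls)
    (hchar : busemann ρ (g (ρ.toFun 0)) ≠ 0) :
    0 < sInf (Set.range fun x : X => dist (g x) x) ∧
    (0 < busemann ρ (g (ρ.toFun 0)) →
      ∀ η : Boundary X,
        (∃ x : X, SeqTendstoBoundary x (fun n => (⇑g)^[n] x) η) →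
        Real.pi / 2 < titsAngle ρ.cls η) := by
  have hshift := busemann_apply_of_map_cls_eq ρ g hfix
  refine ⟨(abs_pos.2 hchar).trans_le (le_csInf ⟨_, ρ.toFun 0, rfl⟩ ?_), ?_⟩
  · rintro _ ⟨x, rfl⟩
    have h1 := busemann_sub_le_dist ρ (g x) x
    have h2 := busemann_sub_le_dist ρ x (g x)
    rw [dist_comm x] at h2
    rw [hshift] at h1 h2
    exact abs_le.2 ⟨by linarith, by linarith⟩
  · rintro hpos η ⟨x, -, σ, hσ0, rfl, hσ⟩
    have hiter := busemann_iterate_of_map_cls_eq ρ g hfix x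
    obtain ⟨k, s, hs, hdist⟩ := SeqTendstoBoundary.exists_dist_lt g.isometry hσ hpos fun n => by
      have h := busemann_sub_le_dist ρ ((⇑g)^[n] x) x
      rw [hiter, dist_comm] at h
      linarith
    refine pi_div_two_lt_titsAngle_of_busemann_lt ρ σ hs ?_
    have h := busemann_sub_le_dist ρ ((⇑g)^[k] x) (σ.toFun s)
    rw [hiter] at h
    rw [hσ0]
    linarith
end
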